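/- arXiv:math/0512143 — 3 statements merged into one kernel-verified Lean document; each statement's English description precedes it below -/
import Mathlib

section
/- The Prime Number Theorem: π(x) ~ li(x) as x → ∞; that is, the ratio π(x)/li(x) tends to 1 as x tends to infinity (equivalently, the relative error |π(x) - li(x)|/π(x) tends to 0). -/
open Filter

/-- `π(x)`: the number of primes not exceeding the real number `x`. -/
noncomputable def primePi (x : ℝ) : ℝ :=
  ((Finset.range (⌊x⌋₊ + 1)).filter Nat.Prime).card

/-- The logarithmic integral `li(x) = ∫₂ˣ dt / log t`. -/
noncomputable def li (x : ℝ) : ℝ := ∫ t in (2:ℝ)..x, 1 / Real.log t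

open MeasureTheory Set Topology
noncomputable def pntB (t : ℝ) : ℝ := Chebyshev.psi (Real.exp t) * Real.exp (-t)

theorem pntB_nonneg (t : ℝ) : 0 ≤ pntB t :=
  mul_nonneg (Chebyshev.psi_nonneg _) (Real.exp_pos _).le

theorem pntB_le (t : ℝ) : pntB t ≤ Real.log 4 + 4 := by
  have h := Chebyshev.psi_le_const_mul_self (Real.exp_pos t).le
  have := mul_le_mul_of_nonneg_right h (Real.exp_pos (-t)).le
  rwa [mul_assoc, ← Real.exp_add, add_neg_cancel, Real.exp_zero, mul_one] at this

theorem pntB_measurable : Measurable pntB := by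
  unfold pntB
  exact (Chebyshev.psi_mono.measurable.comp Real.measurable_exp).mul (by fun_prop)

theorem pntB_abs (t : ℝ) : |pntB t - 1| ≤ 7 := by
  have h1 := pntB_nonneg t
  have h2 := pntB_le t
  have h3 : Real.log 4 ≤ 3 := by
    have := Real.log_le_sub_one_of_pos (show (0:ℝ) < 4 by norm_num)
    linarith
  rw [abs_le]; constructor <;> linarith

theorem pnt_cont : ∃ G : ℂ → ℂ, ContinuousOn G {s | 1 ≤ s.re} ∧ ∀ s : ℂ, 1 < s.re →
    G s = LSeries (fun n => (ArithmeticFunction.vonMangoldt n : ℂ)) s / s - 1 / (s - 1) := by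
  refine ⟨fun s => (ArithmeticFunction.vonMangoldt.LFunctionResidueClassAux (q := 1) 1 s - 1) / s,
    ?_, ?_⟩
  · apply ContinuousOn.div
    · exact (ArithmeticFunction.vonMangoldt.continuousOn_LFunctionResidueClassAux (q := 1) 1).sub
        continuousOn_const
    · exact continuousOn_id
    · rintro s hs rfl
      simp at hs
      linarith
  · intro s hs
    have h := ArithmeticFunction.vonMangoldt.eqOn_LFunctionResidueClassAux (q := 1) (a := 1)
      isUnit_one hs
    have hs0 : s ≠ 0 := by rintro rfl; simp at hs; linarith
    have hs1 : s - 1 ≠ 0 := by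
      intro h; rw [sub_eq_zero] at h; subst h; simp at hs
    have h2 : (fun n => ((ArithmeticFunction.vonMangoldt.residueClass (1 : ZMod 1) n : ℝ) : ℂ)) =
        fun n => (ArithmeticFunction.vonMangoldt n : ℂ) := by
      funext n
      rw [ArithmeticFunction.vonMangoldt.residueClass, indicator_of_mem]
      exact Subsingleton.elim _ _
    simp only at h ⊢
    rw [h, h2]
    simp
    field_simp
    ring

theorem pnt_exp_int {s : ℂ} (hs : 0 < s.re) :
    IntegrableOn (fun t : ℝ => Complex.exp (-s * t)) (Ioi 0) := 
  integrableOn_exp_mul_complex_Ioi (by simpa using hs) 0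

theorem pnt_beta_int {s : ℂ} (hs : 0 < s.re) :
    IntegrableOn (fun t : ℝ => ((pntB t - 1 : ℝ) : ℂ) * Complex.exp (-s * t)) (Ioi 0) := by
  apply (pnt_exp_int hs).bdd_mul (c := 7)
  · exact (Complex.measurable_ofReal.comp (pntB_measurable.sub_const 1)).aestronglyMeasurable
  · filter_upwards with t
    rw [Complex.norm_real]; exact pntB_abs t

theorem pnt_laplace {s : ℂ} (hs : 0 < s.re) :
    ∫ t in Ioi (0:ℝ), ((pntB t - 1 : ℝ) : ℂ) * Complex.exp (-s * t) =
      LSeries (fun n => (ArithmeticFunction.vonMangoldt n : ℂ)) (1 + s) / (1 + s) - 1 / s := by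
  have hs0 : s ≠ 0 := by rintro rfl; simp at hs
  have hs1 : 1 + s ≠ 0 := by
    intro h; have := congrArg Complex.re h; simp at this; linarith
  have key := LSeries_eq_mul_integral_of_nonneg (fun n => ArithmeticFunction.vonMangoldt n)
    (r := 1) zero_le_one (s := 1 + s) (by simpa using hs) (by
      apply Asymptotics.IsBigO.of_bound (Real.log 4 + 4)
      filter_upwards with n
      have h := Chebyshev.psi_le_const_mul_self (x := n) (by positivity)
      have h0 := Chebyshev.psi_nonneg n
      rw [Chebyshev.psi, Nat.floor_natCast] at h h0
      rw [← Finset.Icc_add_one_left_eq_Ioc, zero_add] at h h0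
      rw [Real.norm_of_nonneg h0, Real.rpow_one, Real.norm_of_nonneg (by positivity)]
      exact h) (fun n => ArithmeticFunction.vonMangoldt_nonneg)
  have himg : Real.exp '' Ioi 0 = Ioi 1 := by
    ext x; constructor
    · rintro ⟨t, ht, rfl⟩; simpa using ht
    · intro hx
      exact ⟨Real.log x, Real.log_pos hx, Real.exp_log (zero_lt_one.trans hx)⟩
  rw [← himg, integral_image_eq_integral_abs_deriv_smul measurableSet_Ioi
    (fun x _ => (Real.hasDerivAt_exp x).hasDerivWithinAt) Real.exp_injective.injOn] at key
  have h1 : ∫ t in Ioi (0:ℝ), |Real.exp t| • ((∑ k ∈ Finset.Icc 1 ⌊Real.exp t⌋₊,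
      ((ArithmeticFunction.vonMangoldt k : ℝ) : ℂ)) * ((Real.exp t : ℝ) : ℂ) ^ (-(1 + s + 1)))
      = ∫ t in Ioi (0:ℝ), (pntB t : ℂ) * Complex.exp (-s * t) := by
    congr 1; funext t
    rw [abs_of_pos (Real.exp_pos t), pntB, Chebyshev.psi, ← Finset.Icc_add_one_left_eq_Ioc,
      Complex.ofReal_exp, ← Complex.ofReal_exp, Complex.cpow_def_of_ne_zero (by simp), 
      ← Complex.ofReal_log (Real.exp_pos t).le, Real.log_exp, Complex.real_smul]
    push_cast
    have : Complex.exp (t * (-(1 + s + 1))) = Complex.exp (-t) * (Complex.exp (-t) * Complex.exp (-s * t)) := by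
      rw [← Complex.exp_add, ← Complex.exp_add]; congr 1; ring
    rw [this]
    have h2 : Complex.exp t * Complex.exp (-t) = 1 := by
      rw [← Complex.exp_add]; simp
    linear_combination (∑ k ∈ Finset.Icc (0+1) ⌊Real.exp t⌋₊,
      ((ArithmeticFunction.vonMangoldt k : ℝ) : ℂ)) * Complex.exp (-t) * Complex.exp (-s * t) * h2
  rw [h1] at key
  have h2 : ∫ t in Ioi (0:ℝ), Complex.exp (-s * t) = 1 / s := by
    rw [integral_exp_mul_complex_Ioi (by simpa using hs)]; simp
  have h3 : (∫ t in Ioi (0:ℝ), (pntB t : ℂ) * Complex.exp (-s * t)) =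
      (∫ t in Ioi (0:ℝ), ((pntB t - 1 : ℝ) : ℂ) * Complex.exp (-s * t)) + 1 / s := by
    rw [← h2, ← integral_add (pnt_beta_int hs) (pnt_exp_int hs)]
    congr 1; funext t; push_cast; ring
  rw [key, h3]
  field_simp
  ring

noncomputable def pntT (v : ℝ) : ℝ := max 0 (1 - |v|)
noncomputable def pntk (t : ℝ) : ℝ := Real.sinc (t / 2) ^ 2

theorem pntT_cont : Continuous pntT := by unfold pntT; fun_prop

theorem pntk_cont : Continuous pntk := by
  unfold pntk
  exact (Real.continuous_sinc.comp (by fun_prop)).pow 2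

theorem pntk_nonneg (t : ℝ) : 0 ≤ pntk t := sq_nonneg _

theorem pntk_eq {t : ℝ} (ht : t ≠ 0) : pntk t = 2 * (1 - Real.cos t) / t ^ 2 := by
  rw [pntk, Real.sinc_of_ne_zero (by simpa using ht)]
  have h : Real.cos t = 1 - 2 * Real.sin (t / 2) ^ 2 := by
    have := Real.cos_two_mul (t / 2)
    rw [show 2 * (t / 2) = t by ring] at this
    have h2 := Real.sin_sq_add_cos_sq (t / 2)
    linarith
  rw [h]; field_simp; ring

theorem pntk_le (t : ℝ) : pntk t ≤ 5 * (1 + t ^ 2)⁻¹ := by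
  rw [← div_eq_mul_inv, le_div_iff₀ (by positivity)]
  have h1 : pntk t ≤ 1 := by
    have := Real.abs_sinc_le_one (t / 2)
    rw [pntk]; exact (sq_le_one_iff_abs_le_one _).2 this
  have h2 : pntk t * t ^ 2 ≤ 4 := by
    rcases eq_or_ne t 0 with rfl | ht
    · simp
    · rw [pntk_eq ht]
      field_simp
      linarith [Real.neg_one_le_cos t]
  linarith

theorem pntk_int : Integrable pntk := by
  apply (integrable_inv_one_add_sq.const_mul 5).mono' pntk_cont.aestronglyMeasurable
  filter_upwards with t
  rw [Real.norm_of_nonneg (pntk_nonneg t)]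
  exact pntk_le t

theorem pntk_pos : 0 < ∫ t, pntk t := by
  rw [integral_pos_iff_support_of_nonneg pntk_nonneg pntk_int]
  apply IsOpen.measure_pos
  · exact pntk_cont.isOpen_support
  · exact ⟨0, by simp [pntk]⟩

theorem pntT_zero {v : ℝ} (hv : 1 ≤ |v|) : pntT v = 0 := by
  unfold pntT; exact max_eq_left (by linarith)

theorem pntT_fourier (t : ℝ) :
    ∫ v : ℝ, (pntT v : ℂ) * Complex.exp (-(Complex.I * t) * v) = pntk t := by
  have h0 : ∫ v : ℝ, (pntT v : ℂ) * Complex.exp (-(Complex.I * t) * v) =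
      ∫ v in (-1:ℝ)..1, (pntT v : ℂ) * Complex.exp (-(Complex.I * t) * v) := by
    rw [intervalIntegral.integral_of_le (by norm_num)]
    symm
    apply setIntegral_eq_integral_of_forall_compl_eq_zero
    intro x hx
    rw [pntT_zero, Complex.ofReal_zero, zero_mul]
    by_contra hc
    rw [not_le, abs_lt] at hc
    exact hx ⟨hc.1, hc.2.le⟩
  have hcont : Continuous fun v : ℝ => (pntT v : ℂ) * Complex.exp (-(Complex.I * t) * v) := by
    have := pntT_cont
    fun_prop
  rw [h0, ← intervalIntegral.integral_add_adjacent_intervals (b := 0)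
    (hcont.intervalIntegrable _ _) (hcont.intervalIntegrable _ _)]
  have hA : ∫ v in (-1:ℝ)..0, (pntT v : ℂ) * Complex.exp (-(Complex.I * t) * v) =
      ∫ v in (-1:ℝ)..0, (1 + v : ℂ) * Complex.exp (-(Complex.I * t) * v) := by
    apply intervalIntegral.integral_congr
    intro v hv
    rw [uIcc_of_le (by norm_num)] at hv
    have : pntT v = 1 + v := by
      rw [pntT, abs_of_nonpos hv.2, max_eq_right] <;> linarith [hv.1]
    simp [this]
  have hB : ∫ v in (0:ℝ)..1, (pntT v : ℂ) * Complex.exp (-(Complex.I * t) * v) =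
      ∫ v in (0:ℝ)..1, (1 - v : ℂ) * Complex.exp (-(Complex.I * t) * v) := by
    apply intervalIntegral.integral_congr
    intro v hv
    rw [uIcc_of_le (by norm_num)] at hv
    have : pntT v = 1 - v := by
      rw [pntT, abs_of_nonneg hv.1, max_eq_right]; linarith [hv.2]
    simp [this]
  rw [hA, hB]
  rcases eq_or_ne t 0 with rfl | ht
  · have e1 : ∫ v in (-1:ℝ)..0, (1 + v : ℂ) * Complex.exp (-(Complex.I * (0:ℝ)) * v) = 
      ((1/2 : ℝ) : ℂ) := by
      have : ∀ v : ℝ, (1 + v : ℂ) * Complex.exp (-(Complex.I * (0:ℝ)) * v) = ((1 + v : ℝ) : ℂ) := by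
        intro v; simp
      simp_rw [this]
      rw [intervalIntegral.integral_ofReal, intervalIntegral.integral_add (by simp) (by simp)]
      norm_num
    have e2 : ∫ v in (0:ℝ)..1, (1 - v : ℂ) * Complex.exp (-(Complex.I * (0:ℝ)) * v) = 
      ((1/2 : ℝ) : ℂ) := by
      have : ∀ v : ℝ, (1 - v : ℂ) * Complex.exp (-(Complex.I * (0:ℝ)) * v) = ((1 - v : ℝ) : ℂ) := by
        intro v; simp
      simp_rw [this]
      rw [intervalIntegral.integral_ofReal, intervalIntegral.integral_sub (by simp) (by simp)]
      norm_num
    rw [e1, e2]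
    simp [pntk]; norm_num
  · set c : ℂ := -(Complex.I * t) with hc
    have hc0 : c ≠ 0 := by simp [hc, ht]
    have hd : ∀ v : ℝ, HasDerivAt (fun v : ℝ => Complex.exp (c * v)) (Complex.exp (c * v) * c) v := by
      intro v
      have : HasDerivAt (fun v : ℝ => c * (v : ℂ)) (c * 1) v := 
        (Complex.ofRealCLM.hasDerivAt (x := v)).const_mul c
      simpa using this.cexp
    have hv1 : ∀ v : ℝ, HasDerivAt (fun v : ℝ => (v : ℂ)) 1 v := fun v => 
      Complex.ofRealCLM.hasDerivAt (x := v)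
    have e1 : ∫ v in (-1:ℝ)..0, (1 + v : ℂ) * Complex.exp (c * v) =
        1 / c - 1 / c ^ 2 + Complex.exp (-c) / c ^ 2 := by
      rw [intervalIntegral.integral_eq_sub_of_hasDerivAt 
        (f := fun v : ℝ => (1 + v : ℂ) * (Complex.exp (c * v) / c) - Complex.exp (c * v) / c ^ 2)]
      · simp
      · intro v _
        refine HasDerivAt.congr_deriv (((hv1 v).const_add 1).mul ((hd v).div_const c) |>.sub ((hd v).div_const (c ^ 2))) ?_
        field_simp; ring
      · apply Continuous.intervalIntegrable; fun_prop
    have e2 : ∫ v in (0:ℝ)..1, (1 - v : ℂ) * Complex.exp (c * v) =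
        - 1 / c - 1 / c ^ 2 + Complex.exp (c) / c ^ 2 := by
      rw [intervalIntegral.integral_eq_sub_of_hasDerivAt 
        (f := fun v : ℝ => (1 - v : ℂ) * (Complex.exp (c * v) / c) + Complex.exp (c * v) / c ^ 2)]
      · simp; ring
      · intro v _
        refine HasDerivAt.congr_deriv (((hv1 v).const_sub 1).mul ((hd v).div_const c) |>.add ((hd v).div_const (c ^ 2))) ?_
        field_simp; ring
      · apply Continuous.intervalIntegrable; fun_prop
    rw [e1, e2, pntk_eq ht]
    push_cast
    have hcc : c ^ 2 = - (t : ℂ) ^ 2 := by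
      rw [hc, neg_sq, mul_pow, Complex.I_sq]; ring
    have htc : (t : ℂ) ≠ 0 := by exact_mod_cast ht
    have hcos : 2 * Complex.cos t = Complex.exp c + Complex.exp (-c) := by
      rw [Complex.two_cos, add_comm]; congr 2 <;> rw [hc] <;> ring
    have : Complex.exp c = 2 * Complex.cos t - Complex.exp (-c) := by rw [hcos]; ring
    rw [this]
    have e3 : 1 / c - 1 / c ^ 2 + Complex.exp (-c) / c ^ 2 + (-1 / c - 1 / c ^ 2 + 
      (2 * Complex.cos t - Complex.exp (-c)) / c ^ 2) = 2 * (Complex.cos t - 1) / c ^ 2 := by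
      field_simp; ring
    rw [e3, hcc]
    field_simp; ring

theorem pntT_fourier_scaled {l : ℝ} (hl : 0 < l) (t : ℝ) :
    ∫ u : ℝ, (pntT (u / l) : ℂ) * Complex.exp (-(Complex.I * t) * u) = ((l * pntk (l * t) : ℝ) : ℂ) := by
  have := Measure.integral_comp_div 
    (fun v : ℝ => (pntT v : ℂ) * Complex.exp (-(Complex.I * (l * t : ℝ)) * v)) l
  rw [pntT_fourier, abs_of_pos hl] at this
  rw [Complex.ofReal_mul, ← Complex.real_smul, ← this]
  congr 1; funext u
  have : (l : ℂ) ≠ 0 := by exact_mod_cast hl.ne'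
  congr 2; push_cast; field_simp

theorem pntT_scaled_int {l : ℝ} (hl : 0 < l) : Integrable fun u : ℝ => (pntT (u / l) : ℂ) := by
  apply Continuous.integrable_of_hasCompactSupport
  · have := pntT_cont; fun_prop
  · apply HasCompactSupport.intro (isCompact_Icc (a := -l) (b := l))
    intro x hx
    rw [pntT_zero, Complex.ofReal_zero]
    rw [abs_div, abs_of_pos hl, le_div_iff₀ hl, one_mul]
    by_contra hc
    rw [not_le, abs_lt] at hc
    exact hx ⟨hc.1.le, hc.2.le⟩

theorem pnt_fubini {G : ℂ → ℂ} (hG : ∀ s : ℂ, 1 < s.re →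
    G s = LSeries (fun n => (ArithmeticFunction.vonMangoldt n : ℂ)) s / s - 1 / (s - 1))
    {l : ℝ} (hl : 0 < l) (y : ℝ) {σ : ℝ} (hσ : 0 < σ) :
    ∫ u : ℝ, (pntT (u / l) : ℂ) * Complex.exp (Complex.I * u * y) * G (1 + σ + Complex.I * u) =
    ∫ t in Ioi (0:ℝ), ((pntB t - 1 : ℝ) : ℂ) * Complex.exp (-σ * t) * 
      ((l * pntk (l * (t - y)) : ℝ) : ℂ) := by
  have h1 : ∀ u : ℝ, (pntT (u / l) : ℂ) * Complex.exp (Complex.I * u * y) * 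
      G (1 + σ + Complex.I * u) = ∫ t in Ioi (0:ℝ), Complex.exp (Complex.I * u * (y - t)) * 
        ((pntT (u / l) : ℂ) * (((pntB t - 1 : ℝ) : ℂ) * Complex.exp (-σ * t))) := by
    intro u
    have hL := pnt_laplace (s := σ + Complex.I * u) (by simpa using hσ)
    rw [hG _ (by simpa using hσ), show (1 + σ + Complex.I * u - 1 : ℂ) = σ + Complex.I * u by ring,
      add_assoc, ← hL, ← integral_const_mul]
    congr 1; funext t
    have : Complex.exp (Complex.I * u * y) * Complex.exp (-(σ + Complex.I * u) * t) = 
      Complex.exp (Complex.I * u * (y - t)) * Complex.exp (-σ * t) := by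
      rw [← Complex.exp_add, ← Complex.exp_add]; congr 1; ring
    linear_combination (pntT (u / l) : ℂ) * ((pntB t - 1 : ℝ) : ℂ) * this
  simp_rw [h1]
  rw [integral_integral_swap]
  · congr 1; funext t
    have h2 := pntT_fourier_scaled hl (t - y)
    rw [← h2, ← integral_const_mul]
    congr 1; funext u
    rw [show Complex.I * u * (y - t) = -(Complex.I * ((t - y : ℝ) : ℂ)) * u by push_cast; ring]
    ring
  · have hb : IntegrableOn (fun t : ℝ => ((pntB t - 1 : ℝ) : ℂ) * Complex.exp (-σ * t)) (Ioi 0) :=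
      pnt_beta_int (s := σ) (by simpa using hσ)
    have := (pntT_scaled_int hl).mul_prod hb
    apply this.bdd_mul (c := 1)
    · apply Continuous.aestronglyMeasurable; fun_prop
    · filter_upwards with p
      rw [show Complex.I * p.1 * (y - p.2) = ((p.1 * (y - p.2) : ℝ) : ℂ) * Complex.I by 
        push_cast; ring, Complex.norm_exp_ofReal_mul_I]

theorem pntk_scaled_int {l : ℝ} (hl : 0 < l) (y : ℝ) :
    Integrable fun t : ℝ => l * pntk (l * (t - y)) := 
  (((pntk_int.comp_mul_left' hl.ne').comp_sub_right y).const_mul l)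

theorem pnt_boundary {G : ℂ → ℂ} (hGc : ContinuousOn G {s | 1 ≤ s.re}) (hG : ∀ s : ℂ, 1 < s.re →
    G s = LSeries (fun n => (ArithmeticFunction.vonMangoldt n : ℂ)) s / s - 1 / (s - 1))
    {l : ℝ} (hl : 0 < l) (y : ℝ) :
    ∫ u : ℝ, (pntT (u / l) : ℂ) * Complex.exp (Complex.I * u * y) * G (1 + Complex.I * u) =
    ∫ t in Ioi (0:ℝ), ((pntB t - 1 : ℝ) : ℂ) * ((l * pntk (l * (t - y)) : ℝ) : ℂ) := by
  have hL : Tendsto (fun σ : ℝ => ∫ u : ℝ, (pntT (u / l) : ℂ) * Complex.exp (Complex.I * u * y) * 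
      G (1 + σ + Complex.I * u)) (𝓝[>] 0) (𝓝 (∫ u : ℝ, (pntT (u / l) : ℂ) * 
        Complex.exp (Complex.I * u * y) * G (1 + Complex.I * u))) := by
    have hc : ContinuousOn (fun σ : ℝ => ∫ u : ℝ, (pntT (u / l) : ℂ) * 
        Complex.exp (Complex.I * u * y) * G (1 + σ + Complex.I * u)) (Ici 0) := by
      apply continuousOn_integral_of_compact_support (isCompact_Icc (a := -l) (b := l))
      · have := pntT_cont
        apply ContinuousOn.mul
        · apply Continuous.continuousOn
          fun_prop
        · refine hGc.comp (f := fun p : ℝ × ℝ => (1 + p.1 + Complex.I * p.2 : ℂ)) 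
            (Continuous.continuousOn (by fun_prop)) ?_
          intro p hp
          have : 0 ≤ p.1 := hp.1
          simpa using this
      · intro p x _ hx
        rw [pntT_zero, Complex.ofReal_zero, zero_mul, zero_mul]
        rw [abs_div, abs_of_pos hl, le_div_iff₀ hl, one_mul]
        by_contra hc
        rw [not_le, abs_lt] at hc
        exact hx ⟨hc.1.le, hc.2.le⟩
    have := (hc 0 self_mem_Ici).tendsto
    simp only [Complex.ofReal_zero, add_zero] at this
    exact this.mono_left (nhdsWithin_mono _ Ioi_subset_Ici_self)
  have hR : Tendsto (fun σ : ℝ => ∫ t in Ioi (0:ℝ), ((pntB t - 1 : ℝ) : ℂ) * Complex.exp (-σ * t) * 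
      ((l * pntk (l * (t - y)) : ℝ) : ℂ)) (𝓝[>] 0) (𝓝 (∫ t in Ioi (0:ℝ), ((pntB t - 1 : ℝ) : ℂ) * 
      ((l * pntk (l * (t - y)) : ℝ) : ℂ))) := by
    apply tendsto_integral_filter_of_dominated_convergence (fun t => 7 * (l * pntk (l * (t - y))))
    · filter_upwards with σ
      apply Measurable.aestronglyMeasurable
      have := pntB_measurable
      have := pntk_cont.measurable
      fun_prop
    · filter_upwards [self_mem_nhdsWithin] with σ hσ
      filter_upwards [ae_restrict_mem measurableSet_Ioi] with t ht
      have hσ' : 0 < σ := hσ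
      have ht' : 0 < t := ht
      have hk : 0 ≤ l * pntk (l * (t - y)) := mul_nonneg hl.le (pntk_nonneg _)
      rw [norm_mul, norm_mul, Complex.norm_real, Complex.norm_real, Real.norm_of_nonneg hk,
        Complex.norm_exp]
      refine mul_le_mul_of_nonneg_right ?_ hk
      have h1 : Real.exp ((-σ * t : ℂ).re) ≤ 1 := by
        rw [Real.exp_le_one_iff]; simp; positivity
      have h2 := pntB_abs t
      rw [Real.norm_eq_abs]
      calc _ ≤ 7 * 1 := mul_le_mul h2 h1 (Real.exp_pos _).le (by norm_num)
        _ = 7 := by norm_num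
    · exact ((pntk_scaled_int hl y).const_mul 7).integrableOn
    · filter_upwards with t
      have : Continuous fun σ : ℝ => ((pntB t - 1 : ℝ) : ℂ) * Complex.exp (-σ * t) * 
        ((l * pntk (l * (t - y)) : ℝ) : ℂ) := by fun_prop
      have := (this.tendsto 0).mono_left (nhdsWithin_le_nhds (s := Ioi 0))
      simpa using this
  refine tendsto_nhds_unique hL (hR.congr' ?_)
  filter_upwards [self_mem_nhdsWithin] with σ hσ
  exact (pnt_fubini hG hl y hσ).symm

theorem pnt_wiener {l : ℝ} (hl : 0 < l) :
    Tendsto (fun y : ℝ => ∫ t in Ioi (0:ℝ), (pntB t - 1) * (l * pntk (l * (t - y)))) 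
      atTop (𝓝 0) := by
  obtain ⟨G, hGc, hG⟩ := pnt_cont
  have h := Real.tendsto_integral_exp_smul_cocompact 
    (fun u : ℝ => (pntT (u / l) : ℂ) * G (1 + Complex.I * u))
  have hw : Tendsto (fun y : ℝ => - (y / (2 * Real.pi))) atTop (cocompact ℝ) := by
    refine Tendsto.mono_right ?_ atBot_le_cocompact
    exact tendsto_neg_atTop_atBot.comp (tendsto_id.atTop_div_const (by positivity))
  have h2 := h.comp hw
  have h3 : Tendsto (fun y : ℝ => ((∫ t in Ioi (0:ℝ), (pntB t - 1) * (l * pntk (l * (t - y))) : ℝ) : ℂ)) 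
      atTop (𝓝 ((0 : ℝ) : ℂ)) := by
    rw [Complex.ofReal_zero]
    refine h2.congr fun y => ?_
    rw [← integral_complex_ofReal]
    have := pnt_boundary hGc hG hl y
    simp_rw [Complex.ofReal_mul (pntB _ - 1)]
    rw [← this]
    simp only [Function.comp]
    congr 1; funext u
    rw [Circle.smul_def, Real.fourierChar_apply, smul_eq_mul]
    have : ((2 * Real.pi * -(u * -(y / (2 * Real.pi))) : ℝ) : ℂ) * Complex.I = Complex.I * u * y := by
      have hp : 2 * Real.pi * -(u * -(y / (2 * Real.pi))) = u * y := by
        field_simp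
      rw [hp]; push_cast; ring
    rw [this]; ring
  exact Filter.tendsto_ofReal_iff.1 h3

theorem pntB_zero {t : ℝ} (ht : t ≤ 0) : pntB t = 0 := by
  rw [pntB, Chebyshev.psi_eq_zero_of_le_one (Real.exp_le_one_iff.2 ht), zero_mul]

theorem pntB_shift {t t' : ℝ} (h : t ≤ t') : pntB t ≤ Real.exp (t' - t) * pntB t' := by
  unfold pntB
  have h1 := Chebyshev.psi_mono (Real.exp_le_exp.2 h)
  have h2 : Real.exp (-t) = Real.exp (t' - t) * Real.exp (-t') := by
    rw [← Real.exp_add]; congr 1; ring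
  rw [h2]
  have := mul_le_mul_of_nonneg_right h1 
    (mul_pos (Real.exp_pos (t' - t)) (Real.exp_pos (-t'))).le
  linarith

theorem pntBk_int {l : ℝ} (y : ℝ) : Integrable fun s : ℝ => pntB (y + s / l) * pntk s := by
  apply pntk_int.bdd_mul (c := Real.log 4 + 4)
  · have := pntB_measurable
    exact (this.comp (by fun_prop)).aestronglyMeasurable
  · filter_upwards with s
    rw [Real.norm_of_nonneg (pntB_nonneg _)]
    exact pntB_le _

theorem pnt_mean {l : ℝ} (hl : 0 < l) :
    Tendsto (fun y : ℝ => ∫ s : ℝ, pntB (y + s / l) * pntk s) atTop (𝓝 (∫ s, pntk s)) := by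
  have h1 : Tendsto (fun y : ℝ => ∫ s : ℝ, (Ioi (0:ℝ)).indicator 1 (y + s / l) * pntk s) atTop 
      (𝓝 (∫ s, pntk s)) := by
    apply tendsto_integral_filter_of_dominated_convergence pntk
    · filter_upwards with y
      apply Measurable.aestronglyMeasurable
      refine Measurable.mul ?_ pntk_cont.measurable
      exact (measurable_one.indicator measurableSet_Ioi).comp (by fun_prop)
    · filter_upwards with y
      filter_upwards with s
      rw [norm_mul, Real.norm_of_nonneg (pntk_nonneg s)]
      refine mul_le_of_le_one_left (pntk_nonneg s) ?_
      by_cases h : y + s / l ∈ Ioi (0:ℝ)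
      · rw [indicator_of_mem h]; simp
      · rw [indicator_of_notMem h]; simp
    · exact pntk_int
    · filter_upwards with s
      apply tendsto_const_nhds.congr'
      filter_upwards [eventually_gt_atTop (- (s / l))] with y hy
      rw [indicator_of_mem (show y + s / l ∈ Ioi (0:ℝ) from by simp; linarith)]; simp
  have h2 := (pnt_wiener hl).add h1
  rw [zero_add] at h2
  refine h2.congr fun y => ?_
  have h3 : ∫ t in Ioi (0:ℝ), (pntB t - 1) * (l * pntk (l * (t - y))) = 
      ∫ s : ℝ, (pntB (y + s / l) - (Ioi (0:ℝ)).indicator 1 (y + s / l)) * pntk s := by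
    rw [← integral_indicator measurableSet_Ioi]
    have e := Measure.integral_comp_mul_left 
      (fun s : ℝ => (pntB (y + s / l) - (Ioi (0:ℝ)).indicator 1 (y + s / l)) * pntk s) l
    have e2 := integral_sub_right_eq_self (μ := volume) (fun t : ℝ => (pntB (y + (l * t) / l) - 
      (Ioi (0:ℝ)).indicator 1 (y + (l * t) / l)) * pntk (l * t)) y
    rw [e, abs_of_pos (inv_pos.2 hl)] at e2
    have e3 : ∫ s : ℝ, (pntB (y + s / l) - (Ioi (0:ℝ)).indicator 1 (y + s / l)) * pntk s = 
      l * (l⁻¹ • ∫ s : ℝ, (pntB (y + s / l) - (Ioi (0:ℝ)).indicator 1 (y + s / l)) * pntk s) := by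
      rw [smul_eq_mul, mul_inv_cancel_left₀ hl.ne']
    rw [e3, ← e2, ← integral_const_mul]
    congr 1; funext t
    have : y + l * (t - y) / l = t := by field_simp; ring
    rw [this]
    by_cases h : t ∈ Ioi (0:ℝ)
    · rw [indicator_of_mem h, indicator_of_mem h]; simp; ring
    · rw [indicator_of_notMem h, indicator_of_notMem h, pntB_zero (by simpa using h)]; simp
  rw [h3, ← integral_add]
  · congr 1; funext s; ring
  · have : Integrable fun s : ℝ => (Ioi (0:ℝ)).indicator 1 (y + s / l) * pntk s := by
      apply pntk_int.bdd_mul (c := 1)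
      · exact ((measurable_one.indicator measurableSet_Ioi).comp (by fun_prop)).aestronglyMeasurable
      · filter_upwards with s
        by_cases h : y + s / l ∈ Ioi (0:ℝ)
        · rw [indicator_of_mem h]; simp
        · rw [indicator_of_notMem h]; simp
    simp_rw [sub_mul]
    exact (pntBk_int y).sub this
  · apply pntk_int.bdd_mul (c := 1)
    · exact ((measurable_one.indicator measurableSet_Ioi).comp (by fun_prop)).aestronglyMeasurable
    · filter_upwards with s
      by_cases h : y + s / l ∈ Ioi (0:ℝ)
      · rw [indicator_of_mem h]; simp
      · rw [indicator_of_notMem h]; simp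

theorem pnt_J : Tendsto (fun R : ℝ => ∫ s in Ioc (-R) R, pntk s) atTop (𝓝 (∫ s, pntk s)) := by
  have := intervalIntegral_tendsto_integral pntk_int tendsto_neg_atTop_atBot tendsto_id
  refine this.congr' ?_
  filter_upwards [eventually_ge_atTop 0] with R hR
  simp only [id]
  rw [intervalIntegral.integral_of_le (by linarith)]

theorem pnt_upper {δ R : ℝ} (hδ : 0 < δ) (hR : 0 < R) (y : ℝ) :
    pntB (y - δ) * ∫ s in Ioc (-R) R, pntk s ≤ 
      Real.exp (2 * δ) * ∫ s, pntB (y + s / (R / δ)) * pntk s := by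
  have h1 : ∫ s in Ioc (-R) R, pntB (y + s / (R / δ)) * pntk s ≤ 
      ∫ s, pntB (y + s / (R / δ)) * pntk s := 
    setIntegral_le_integral (pntBk_int y) 
      (Eventually.of_forall fun s => mul_nonneg (pntB_nonneg _) (pntk_nonneg _))
  refine le_trans ?_ (mul_le_mul_of_nonneg_left h1 (Real.exp_pos _).le)
  rw [← integral_const_mul, ← integral_const_mul]
  apply setIntegral_mono_on (pntk_int.const_mul _).integrableOn 
    ((pntBk_int y).const_mul _).integrableOn measurableSet_Ioc
  intro s hs
  rw [← mul_assoc]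
  refine mul_le_mul_of_nonneg_right ?_ (pntk_nonneg s)
  have e : s / (R / δ) = (s / R) * δ := by field_simp
  have b1 : -1 ≤ s / R := by rw [le_div_iff₀ hR]; linarith [hs.1]
  have b2 : s / R ≤ 1 := by rw [div_le_iff₀ hR]; linarith [hs.2]
  rw [e]
  refine (pntB_shift (t' := y + s / R * δ) (by nlinarith)).trans ?_
  refine mul_le_mul_of_nonneg_right (Real.exp_le_exp.2 (by nlinarith)) (pntB_nonneg _)

theorem pnt_lower {δ R : ℝ} (hδ : 0 < δ) (hR : 0 < R) (y : ℝ) :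
    ∫ s, pntB (y + s / (R / δ)) * pntk s ≤ pntB (y + δ) * Real.exp (2 * δ) * (∫ s, pntk s) +
      (Real.log 4 + 4) * ((∫ s, pntk s) - ∫ s in Ioc (-R) R, pntk s) := by
  rw [← integral_add_compl (measurableSet_Ioc (a := -R) (b := R)) (pntBk_int y),
    ← setIntegral_compl measurableSet_Ioc pntk_int]
  refine add_le_add ?_ ?_
  · have h1 : ∫ s in Ioc (-R) R, pntk s ≤ ∫ s, pntk s := 
      setIntegral_le_integral pntk_int (Eventually.of_forall pntk_nonneg)
    refine le_trans ?_ (mul_le_mul_of_nonneg_left h1 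
      (mul_nonneg (pntB_nonneg _) (Real.exp_pos _).le))
    rw [← integral_const_mul]
    apply setIntegral_mono_on (pntBk_int y).integrableOn (pntk_int.const_mul _).integrableOn 
      measurableSet_Ioc
    intro s hs
    refine mul_le_mul_of_nonneg_right ?_ (pntk_nonneg s)
    have e : s / (R / δ) = (s / R) * δ := by field_simp
    have b1 : -1 ≤ s / R := by rw [le_div_iff₀ hR]; linarith [hs.1]
    have b2 : s / R ≤ 1 := by rw [div_le_iff₀ hR]; linarith [hs.2]
    rw [e]
    refine (pntB_shift (t' := y + δ) (by nlinarith)).trans ?_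
    rw [mul_comm]
    refine mul_le_mul_of_nonneg_left (Real.exp_le_exp.2 (by nlinarith)) (pntB_nonneg _)
  · rw [← integral_const_mul]
    apply setIntegral_mono_on (pntBk_int y).integrableOn (pntk_int.const_mul _).integrableOn 
      measurableSet_Ioc.compl
    intro s _
    exact mul_le_mul_of_nonneg_right (pntB_le _) (pntk_nonneg s)

theorem pntB_tendsto : Tendsto pntB atTop (𝓝 1) := by
  have hI := pntk_pos
  have hexp : Tendsto (fun δ : ℝ => Real.exp (2 * δ)) (𝓝[>] 0) (𝓝 1) := by
    have : Continuous fun δ : ℝ => Real.exp (2 * δ) := by fun_prop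
    have := (this.tendsto 0).mono_left (nhdsWithin_le_nhds (s := Ioi 0))
    simpa using this
  rw [tendsto_order]
  constructor
  · intro c hc
    obtain ⟨δ, h1, h2⟩ := (((hexp.const_mul c).eventually_lt_const (show c * 1 < 1 by linarith)).and 
      self_mem_nhdsWithin).exists
    have hδ : 0 < δ := h2
    have hJ : Tendsto (fun R : ℝ => c * Real.exp (2 * δ) * (∫ s, pntk s) +
      (Real.log 4 + 4) * ((∫ s, pntk s) - ∫ s in Ioc (-R) R, pntk s)) atTop 
      (𝓝 (c * Real.exp (2 * δ) * (∫ s, pntk s) + (Real.log 4 + 4) * ((∫ s, pntk s) - ∫ s, pntk s))) :=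
      ((pnt_J.const_sub _).const_mul _).const_add _
    rw [sub_self, mul_zero, add_zero] at hJ
    obtain ⟨R, h3, hR⟩ := ((hJ.eventually_lt_const 
      (show c * Real.exp (2 * δ) * (∫ s, pntk s) < ∫ s, pntk s by nlinarith)).and (eventually_gt_atTop 0)).exists
    have h4 := (pnt_mean (l := R / δ) (by positivity)).eventually_const_lt h3
    have h5 := (tendsto_atTop_add_const_right atTop (-δ) tendsto_id).eventually h4
    filter_upwards [h5] with y hy
    simp only [id] at hy
    have := hy.trans_le (pnt_lower hδ hR _)
    rw [neg_add_cancel_right] at this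
    have h6 : c * (Real.exp (2 * δ) * (∫ s, pntk s)) < pntB y * (Real.exp (2 * δ) * (∫ s, pntk s)) := by
      linarith
    exact lt_of_mul_lt_mul_right h6 (by positivity)
  · intro c hc
    obtain ⟨δ, h1, h2⟩ := ((hexp.eventually_lt_const (show 1 < c from hc)).and 
      self_mem_nhdsWithin).exists
    have hδ : 0 < δ := h2
    obtain ⟨R, ⟨h3, hJ⟩, hR⟩ := ((((pnt_J.const_mul c).eventually_const_lt 
      (u := Real.exp (2 * δ) * ∫ s, pntk s) (by nlinarith)).and 
      (pnt_J.eventually_const_lt hI)).and (eventually_gt_atTop 0)).exists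
    have h4 := ((pnt_mean (l := R / δ) (by positivity)).const_mul (Real.exp (2 * δ))).eventually_lt_const h3
    have h5 := (tendsto_atTop_add_const_right atTop δ tendsto_id).eventually h4
    filter_upwards [h5] with y hy
    simp only [id] at hy
    have := (pnt_upper hδ hR _).trans_lt hy
    rw [add_sub_cancel_right] at this
    exact lt_of_mul_lt_mul_right this hJ.le

theorem pnt_psi : Tendsto (fun x : ℝ => Chebyshev.psi x / x) atTop (𝓝 1) := by
  refine (pntB_tendsto.comp Real.tendsto_log_atTop).congr' ?_
  filter_upwards [eventually_gt_atTop 0] with x hx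
  simp only [Function.comp, pntB]
  rw [Real.exp_neg, Real.exp_log hx, div_eq_mul_inv]

theorem pnt_theta : Tendsto (fun x : ℝ => Chebyshev.theta x / x) atTop (𝓝 1) := by
  have h1 : (Chebyshev.psi - Chebyshev.theta) =o[atTop] fun x : ℝ => x := by
    refine Chebyshev.isBigO_psi_sub_theta_sqrt.trans_isLittleO ?_
    rw [Asymptotics.isLittleO_iff_tendsto' (by
      filter_upwards [eventually_ge_atTop 2] with x hx h
      linarith)]
    have h0 : Tendsto (fun x : ℝ => (Real.sqrt x)⁻¹) atTop (𝓝 0) :=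
      Real.tendsto_sqrt_atTop.inv_tendsto_atTop
    refine h0.congr' ?_
    filter_upwards [eventually_ge_atTop 2] with x hx
    have := Real.sq_sqrt (show 0 ≤ x by linarith)
    have h3 : 0 < Real.sqrt x := Real.sqrt_pos.2 (by linarith)
    rw [eq_div_iff (by linarith)]
    field_simp
    linarith
  have h2 := pnt_psi.sub h1.tendsto_div_nhds_zero
  rw [sub_zero] at h2
  refine h2.congr fun x => ?_
  simp only [Pi.sub_apply]; ring

theorem pnt_ratio_log : Tendsto (fun x : ℝ => 1 / Real.log x) atTop (𝓝 0) := by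
  simp_rw [one_div]
  exact Real.tendsto_log_atTop.inv_tendsto_atTop

theorem pnt_pi : Tendsto (fun x : ℝ => primePi x / (x / Real.log x)) atTop (𝓝 1) := by
  have h1 := (Chebyshev.integral_theta_div_log_sq_isLittleO).tendsto_div_nhds_zero
  have h2 := pnt_theta.add h1
  rw [add_zero] at h2
  refine h2.congr' ?_
  filter_upwards [eventually_ge_atTop 2] with x hx
  have hl : 0 < Real.log x := Real.log_pos (by linarith)
  have := Chebyshev.primeCounting_eq_theta_div_log_add_integral hx
  have e : primePi x = (Nat.primeCounting ⌊x⌋₊ : ℝ) := by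
    rw [primePi, Nat.primeCounting, Nat.primeCounting', Nat.count_eq_card_filter_range]
  rw [e, this, add_div]
  congr 1
  field_simp

theorem pnt_li_eq {x : ℝ} (hx : 2 ≤ x) :
    li x = x / Real.log x - 2 / Real.log 2 + ∫ t in (2:ℝ)..x, 1 / Real.log t ^ 2 := by
  have hi1 : IntervalIntegrable (fun t : ℝ => 1 / Real.log t) volume 2 x := by
    apply ContinuousOn.intervalIntegrable
    rw [uIcc_of_le hx]
    intro t ht
    have : Real.log t ≠ 0 := (Real.log_pos (by linarith [ht.1])).ne'
    have : t ≠ 0 := by linarith [ht.1]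
    apply ContinuousAt.continuousWithinAt
    fun_prop (disch := assumption)
  have hi2 := Chebyshev.intervalIntegrable_one_div_log_sq (a := 2) (b := x) (by norm_num) (by linarith)
  have h := intervalIntegral.integral_eq_sub_of_hasDerivAt (a := 2) (b := x)
    (f := fun t => t / Real.log t) (f' := fun t => 1 / Real.log t - 1 / Real.log t ^ 2) (by
      intro t ht
      rw [uIcc_of_le hx] at ht
      have h1 : Real.log t ≠ 0 := (Real.log_pos (by linarith [ht.1])).ne'
      have h2 : t ≠ 0 := by linarith [ht.1]
      refine ((hasDerivAt_id t).div (Real.hasDerivAt_log h2) h1).congr_deriv ?_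
      simp only [id]
      field_simp) (hi1.sub hi2)
  rw [intervalIntegral.integral_sub hi1 hi2] at h
  rw [li]; linarith

theorem pnt_li : Tendsto (fun x : ℝ => li x / (x / Real.log x)) atTop (𝓝 1) := by
  have hlx : (fun x : ℝ => Real.log x) =o[atTop] fun x : ℝ => x := Real.isLittleO_log_id_atTop
  have h0 := hlx.tendsto_div_nhds_zero.const_mul (2 / Real.log 2)
  have h1 : (fun x : ℝ => ∫ t in (2:ℝ)..x, 1 / Real.log t ^ 2) =o[atTop] fun x => x / Real.log x := by
    refine Chebyshev.integral_one_div_log_sq_isBigO.trans_isLittleO ?_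
    rw [Asymptotics.isLittleO_iff_tendsto' (by
      filter_upwards [eventually_ge_atTop 2] with x hx h
      have hl : 0 < Real.log x := Real.log_pos (by linarith)
      have : 0 < x / Real.log x := by positivity
      linarith)]
    refine pnt_ratio_log.congr' ?_
    filter_upwards [eventually_ge_atTop 2] with x hx
    have hl : 0 < Real.log x := Real.log_pos (by linarith)
    field_simp
  have h2 := ((tendsto_const_nhds (x := (1:ℝ))).sub h0).add h1.tendsto_div_nhds_zero
  rw [mul_zero, sub_zero, add_zero] at h2
  refine h2.congr' ?_
  filter_upwards [eventually_ge_atTop 2] with x hx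
  have hl : 0 < Real.log x := Real.log_pos (by linarith)
  rw [pnt_li_eq hx, add_div, sub_div]
  congr 2 <;> field_simp

/-- The Prime Number Theorem: `π(x) ~ li(x)` as `x → ∞`, i.e. the ratio
`π(x)/li(x)` tends to `1`. -/
theorem prime_number_theorem :
    Tendsto (fun x : ℝ => primePi x / li x) atTop (nhds 1) := by
  have h := pnt_pi.div pnt_li one_ne_zero
  rw [div_one] at h
  refine h.congr' ?_
  filter_upwards [eventually_ge_atTop 2] with x hx
  have hl : 0 < Real.log x := Real.log_pos (by linarith)
  have : x / Real.log x ≠ 0 := by positivity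
  simp only [Pi.div_apply]
  rw [div_div_div_cancel_right₀ this]
end

section
/- Assuming the Riemann Hypothesis, there exists a constant C > 0 such that |π(x) - li(x)| ≤ C √x log x for all real x ≥ 2; that is, RH implies π(x) = li(x) + O(√x log x). -/
lemma fac_prod_lower (S : Multiset ℂ) (R : ℝ) (hS : ∀ ρ ∈ S, ρ ≠ 0 ∧ ‖ρ‖ ≤ R)
    (z : ℂ) (hz : ‖z‖ = 4 * R) :
    (3:ℝ) ^ (Multiset.card S) ≤ ‖(S.map fun ρ => 1 - z / ρ).prod‖ := by
  induction S using Multiset.induction with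
  | empty => simp
  | cons a S ih =>
    have ha := hS a (by simp)
    have h1 := ih (fun ρ h => hS ρ (by simp [h]))
    have hpos : 0 < ‖a‖ := norm_pos_iff.mpr ha.1
    have h3 : (3:ℝ) ≤ ‖1 - z / a‖ := by
      have h4 : (4:ℝ) ≤ ‖z / a‖ := by
        rw [norm_div, le_div_iff₀ hpos, hz]; linarith [ha.2]
      have := norm_sub_norm_le (z / a) 1
      rw [norm_sub_rev, norm_one] at this
      linarith
    simp only [Multiset.card_cons, Multiset.map_cons, Multiset.prod_cons, norm_mul]
    rw [pow_succ, mul_comm]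
    exact mul_le_mul h3 h1 (by positivity) (by positivity)

lemma fac_bound (f g : ℂ → ℂ) (S : Multiset ℂ) (R B : ℝ) (hR : 0 < R)
    (hS : ∀ ρ ∈ S, ρ ≠ 0 ∧ ‖ρ‖ ≤ R) (hg : Differentiable ℂ g)
    (hfg : ∀ z, f z = (S.map fun ρ => 1 - z / ρ).prod * g z)
    (hB : ∀ z, ‖z‖ ≤ 4 * R → ‖f z‖ ≤ B) (z : ℂ) (hz : ‖z‖ ≤ 4 * R) :
    (3:ℝ) ^ (Multiset.card S) * ‖g z‖ ≤ B := by
  have hp : (0:ℝ) < 3 ^ (Multiset.card S) := by positivity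
  rw [mul_comm, ← le_div_iff₀ hp]
  refine Complex.norm_le_of_forall_mem_frontier_norm_le (U := Metric.ball 0 (4*R))
    Metric.isBounded_ball hg.diffContOnCl ?_ ?_
  · intro w hw
    rw [frontier_ball _ (by positivity)] at hw
    have hw' : ‖w‖ = 4 * R := by simpa using hw
    rw [le_div_iff₀ hp]
    have h1 := fac_prod_lower S R hS w hw'
    have h2 := hB w hw'.le
    rw [hfg, norm_mul] at h2
    nlinarith [norm_nonneg (g w)]
  · rw [closure_ball _ (by positivity)]
    simpa using hz

lemma fac_exists (f : ℂ → ℂ) (hf : Differentiable ℂ f) (h0 : f 0 ≠ 0) (R : ℝ) (hR : 0 < R) :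
    ∃ (S : Multiset ℂ) (g : ℂ → ℂ), (∀ ρ ∈ S, f ρ = 0 ∧ ρ ≠ 0 ∧ ‖ρ‖ ≤ R) ∧ Differentiable ℂ g ∧
      (∀ z, f z = (S.map fun ρ => 1 - z / ρ).prod * g z) ∧ (∀ z, ‖z‖ ≤ R → g z ≠ 0) := by
  by_contra hcon
  push Not at hcon
  have key : ∀ n : ℕ, ∃ (S : Multiset ℂ) (g : ℂ → ℂ), Multiset.card S = n ∧
      (∀ ρ ∈ S, f ρ = 0 ∧ ρ ≠ 0 ∧ ‖ρ‖ ≤ R) ∧ Differentiable ℂ g ∧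
      (∀ z, f z = (S.map fun ρ => 1 - z / ρ).prod * g z) := by
    intro n
    induction n with
    | zero => exact ⟨0, f, by simp, by simp, hf, by simp⟩
    | succ n ih =>
      obtain ⟨S, g, hc, hS, hg, hfg⟩ := ih
      obtain ⟨a, ha, hga⟩ := hcon S g hS hg hfg
      have hfa : f a = 0 := by rw [hfg, hga, mul_zero]
      have ha0 : a ≠ 0 := by rintro rfl; exact h0 hfa
      refine ⟨a ::ₘ S, fun z => (-a) * dslope g a z, by simp [hc], ?_, ?_, ?_⟩
      · intro ρ hρ
        rcases Multiset.mem_cons.mp hρ with rfl | h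
        · exact ⟨hfa, ha0, ha⟩
        · exact hS ρ h
      · refine Differentiable.const_mul ?_ _
        rw [← differentiableOn_univ] at hg ⊢
        exact (Complex.differentiableOn_dslope Filter.univ_mem).mpr hg
      · intro z
        rw [hfg z]
        have : (z - a) * dslope g a z = g z := by
          have := sub_smul_dslope g a z
          simpa [hga] using this
        simp only [Multiset.map_cons, Multiset.prod_cons]
        rw [← this]
        field_simp
        ring
  obtain ⟨B, hB⟩ := (isCompact_closedBall (0:ℂ) (4*R)).exists_bound_of_continuousOn
    hf.continuous.continuousOn
  obtain ⟨n, hn⟩ := pow_unbounded_of_one_lt (B / ‖f 0‖) (by norm_num : (1:ℝ) < 3)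
  obtain ⟨S, g, hc, hS, hg, hfg⟩ := key n
  have h1 := fac_bound f g S R B hR (fun ρ h => (hS ρ h).2) hg hfg
    (fun z hz => hB z (by simpa using hz)) 0 (by simp; positivity)
  have h2 : f 0 = g 0 := by rw [hfg 0]; simp
  rw [hc, ← h2] at h1
  rw [div_lt_iff₀ (norm_pos_iff.mpr h0)] at hn
  linarith

lemma logDeriv_small (g : ℂ → ℂ) (hg : Differentiable ℂ g) (R M : ℝ) (hR : 0 < R) (hM : 0 < M)
    (hne : ∀ z, ‖z‖ ≤ R → g z ≠ 0) (hb : ∀ z, ‖z‖ ≤ R → ‖g z‖ ≤ ‖g 0‖ * Real.exp M)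
    (s : ℂ) (hs : ‖s‖ ≤ R / 8) :
    ‖logDeriv g s - logDeriv g 0‖ ≤ 64 * M / R ^ 2 * ‖s‖ := by
  have hdl : DifferentiableOn ℂ (fun z => deriv g z / g z) (Metric.ball 0 R) := by
    intro z hz
    have hz' : ‖z‖ ≤ R := by have := Metric.mem_ball.mp hz; simp at this; exact this.le
    exact ((hg.deriv z).div (hg z) (hne z hz')).differentiableWithinAt
  obtain ⟨H, H0, hH⟩ := (hdl.isExactOn_ball).with_val_at 0 0
  have hHd : DifferentiableOn ℂ H (Metric.ball 0 R) :=
    fun z hz => (hH z hz).differentiableAt.differentiableWithinAt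
  have hexp : ∀ z ∈ Metric.ball (0:ℂ) R, g z = g 0 * Complex.exp (H z) := by
    intro z hz
    have hder : ∀ w ∈ Metric.ball (0:ℂ) R,
        HasDerivWithinAt (fun w => g w * Complex.exp (- H w)) 0 (Metric.ball (0:ℂ) R) w := by
      intro w hw
      have hw' : ‖w‖ ≤ R := by have := Metric.mem_ball.mp hw; simp at this; exact this.le
      have h1 := ((hg w).hasDerivAt.mul (hH w hw).neg.cexp).hasDerivWithinAt
        (s := Metric.ball (0:ℂ) R)
      convert! h1 using 1
      have := hne w hw'
      simp
      field_simp
      ring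
    have hc := (convex_ball (0:ℂ) R).is_const_of_fderivWithin_eq_zero (𝕜 := ℂ)
      (f := fun w => g w * Complex.exp (- H w))
      (fun w hw => (hder w hw).differentiableWithinAt)
      (fun w hw => by
        have := (hder w hw).hasFDerivWithinAt.fderivWithin
          (Metric.isOpen_ball.uniqueDiffWithinAt hw)
        rw [this]; ext; simp) hz (Metric.mem_ball_self hR)
    simp only [H0, neg_zero, Complex.exp_zero, mul_one] at hc
    rw [← hc, mul_assoc, ← Complex.exp_add]; simp
  have hRe : ∀ z ∈ Metric.ball (0:ℂ) R, (H z).re ≤ M := by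
    intro z hz
    have hz' : ‖z‖ ≤ R := by have := Metric.mem_ball.mp hz; simp at this; exact this.le
    have h1 := hb z hz'
    have hg0 : 0 < ‖g 0‖ := norm_pos_iff.mpr (hne 0 (by simp; exact hR.le))
    rw [hexp z hz, norm_mul, Complex.norm_exp] at h1
    exact Real.exp_le_exp.mp (le_of_mul_le_mul_left h1 hg0)
  have hBC : ∀ z : ℂ, ‖z‖ ≤ R / 2 → ‖H z‖ ≤ 2 * M := by
    intro z hz
    have hzb : z ∈ Metric.ball (0:ℂ) R := by simp; linarith
    have := Complex.borelCaratheodory_zero hM hHd (fun z hz => hRe z hz) hR hzb H0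
    refine this.trans ?_
    rw [div_le_iff₀ (by linarith)]
    nlinarith
  have hdH : ∀ z ∈ Metric.ball (0:ℂ) R, deriv H z = logDeriv g z := by
    intro z hz; rw [(hH z hz).deriv]; rfl
  have h1 : ∀ z : ℂ, ‖z‖ ≤ R / 4 → ‖logDeriv g z‖ ≤ 8 * M / R := by
    intro z hz
    rw [← hdH z (by simp; linarith)]
    have := Complex.norm_deriv_le_of_forall_mem_sphere_norm_le (c := z) (R := R/4) (C := 2*M)
      (f := H) (by positivity) ?_ ?_
    · refine this.trans (le_of_eq ?_); field_simp; norm_num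
    · apply DifferentiableOn.diffContOnCl
      apply hHd.mono
      rw [closure_ball _ (by positivity)]
      intro w hw
      simp only [Metric.mem_closedBall, dist_eq_norm] at hw
      simp only [Metric.mem_ball, dist_zero_right]
      have := norm_sub_norm_le w z
      linarith
    · intro w hw
      apply hBC
      simp only [mem_sphere_iff_norm] at hw
      have := norm_sub_norm_le w z
      linarith
  have hLd : DifferentiableOn ℂ (logDeriv g) (Metric.ball 0 R) := hdl
  have h2 : ∀ z : ℂ, z ∈ Metric.closedBall (0:ℂ) (R/8) → ‖deriv (logDeriv g) z‖ ≤ 64 * M / R ^ 2 := by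
    intro z hz
    replace hz : ‖z‖ ≤ R / 8 := by simpa using hz
    have := Complex.norm_deriv_le_of_forall_mem_sphere_norm_le (c := z) (R := R/8) (C := 8*M/R)
      (f := logDeriv g) (by positivity) ?_ ?_
    · refine this.trans (le_of_eq ?_); field_simp; norm_num
    · apply DifferentiableOn.diffContOnCl
      apply hLd.mono
      rw [closure_ball _ (by positivity)]
      intro w hw
      simp only [Metric.mem_closedBall, dist_eq_norm] at hw
      simp only [Metric.mem_ball, dist_zero_right]
      have := norm_sub_norm_le w z
      linarith
    · intro w hw
      apply h1
      simp only [mem_sphere_iff_norm] at hw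
      have := norm_sub_norm_le w z
      linarith
  have := (convex_closedBall (0:ℂ) (R/8)).norm_image_sub_le_of_norm_deriv_le (f := logDeriv g)
    (C := 64 * M / R ^ 2) (x := 0) (y := s) ?_ h2 (by simp; positivity) (by simpa using hs)
  · simpa using this
  · intro z hz
    apply hLd.differentiableAt
    apply Metric.isOpen_ball.mem_nhds
    simp at hz ⊢
    linarith

lemma logDeriv_fac (S : Multiset ℂ) (g : ℂ → ℂ) (hg : Differentiable ℂ g) (hS : ∀ ρ ∈ S, ρ ≠ 0)
    (s : ℂ) (hne : (S.map fun ρ => 1 - s / ρ).prod * g s ≠ 0) :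
    logDeriv (fun z => (S.map fun ρ => 1 - z / ρ).prod * g z) s
      = (S.map fun ρ => 1 / (s - ρ)).sum + logDeriv g s := by
  induction S using Multiset.induction with
  | empty => simp
  | cons a S ih =>
    have ha := hS a (by simp)
    simp only [Multiset.map_cons, Multiset.prod_cons, mul_assoc, Multiset.sum_cons] at hne ⊢
    have h1 := ih (fun ρ h => hS ρ (by simp [h])) (right_ne_zero_of_mul hne)
    have hd : Differentiable ℂ (fun z => (S.map fun ρ => 1 - z / ρ).prod * g z) := by
      refine Differentiable.mul ?_ hg
      clear * -
      induction S using Multiset.induction with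
      | empty => simp
      | cons a S ih =>
        simp only [Multiset.map_cons, Multiset.prod_cons]
        exact Differentiable.mul (by fun_prop) ih
    have hda : HasDerivAt (fun z : ℂ => 1 - z / a) (- (1 / a)) s := by
      simpa using ((hasDerivAt_id s).div_const a).const_sub 1
    rw [logDeriv_mul (f := fun z => 1 - z / a) s (left_ne_zero_of_mul hne)
      (right_ne_zero_of_mul hne) hda.differentiableAt (hd s), h1, add_assoc]
    congr 1
    rw [logDeriv_apply, hda.deriv]
    have h2 : (1 - s / a) ≠ 0 := left_ne_zero_of_mul hne
    have h3 : s - a ≠ 0 := by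
      intro h; apply h2
      rw [sub_eq_zero.mp h, div_self ha, sub_self]
    have h4 : a - s ≠ 0 := by rw [← neg_sub]; exact neg_ne_zero.mpr h3
    field_simp
    ring

theorem shells (f : ℂ → ℂ) (hf : Differentiable ℂ f) (h0 : f 0 ≠ 0) (C : ℝ) (hC : 0 < C)
    (hB : ∀ (n : ℕ) (z : ℂ), ‖z‖ ≤ 4 * 2 ^ n → ‖f z‖ ≤ ‖f 0‖ * Real.exp (C * (n + 1) * 2 ^ n)) :
    ∃ D : ℕ → Multiset ℂ, (∀ L, ∀ ρ ∈ D L, f ρ = 0 ∧ ρ ≠ 0 ∧ (L = 0 ∨ 2 ^ L < 2 * ‖ρ‖)) ∧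
      (∀ L, (Multiset.card (D L) : ℝ) ≤ C * (L + 1) * 2 ^ L) ∧
      ∀ s, f s ≠ 0 → Filter.Tendsto (fun N : ℕ => ∑ L ∈ Finset.range N,
        ((D L).map fun ρ => 1 / (s - ρ) + 1 / ρ).sum) Filter.atTop
        (nhds (logDeriv f s - logDeriv f 0)) := by
  have step : ∀ (n : ℕ) (g : {g : ℂ → ℂ // Differentiable ℂ g ∧ g 0 ≠ 0}),
      ∃ (S : Multiset ℂ) (g' : {g : ℂ → ℂ // Differentiable ℂ g ∧ g 0 ≠ 0}),
      (∀ ρ ∈ S, g.1 ρ = 0 ∧ ρ ≠ 0 ∧ ‖ρ‖ ≤ 2 ^ n) ∧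
      (∀ z, g.1 z = (S.map fun ρ => 1 - z / ρ).prod * g'.1 z) ∧
      (∀ z, ‖z‖ ≤ 2 ^ n → g'.1 z ≠ 0) := by
    intro n g
    obtain ⟨S, g', h1, h2, h3, h4⟩ := fac_exists g.1 g.2.1 g.2.2 (2 ^ n) (by positivity)
    exact ⟨S, ⟨g', h2, h4 0 (by simp)⟩, h1, h3, h4⟩
  choose S nx hS1 hS2 hS3 using step
  obtain ⟨q, q0, qs⟩ : ∃ q : ℕ → {g : ℂ → ℂ // Differentiable ℂ g ∧ g 0 ≠ 0},
      (q 0).1 = f ∧ ∀ n, q (n+1) = nx n (q n) :=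
    ⟨fun n => Nat.rec ⟨f, hf, h0⟩ (fun k g => nx k g) n, rfl, fun n => rfl⟩
  let D : ℕ → Multiset ℂ := fun n => S n (q n)
  let T : ℕ → Multiset ℂ := fun N => ∑ L ∈ Finset.range N, D L
  have Ts : ∀ N, T (N+1) = T N + D N := fun N => Finset.sum_range_succ _ _
  have hfac : ∀ N z, f z = ((T N).map fun ρ => 1 - z / ρ).prod * (q N).1 z := by
    intro N
    induction N with
    | zero => intro z; simp [T, q0]
    | succ N ih =>
      intro z
      rw [Ts, Multiset.map_add, Multiset.prod_add, mul_assoc, qs, ← hS2 N (q N) z, ih z]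
  have hDz : ∀ L, ∀ ρ ∈ D L, f ρ = 0 ∧ ρ ≠ 0 ∧ ‖ρ‖ ≤ 2 ^ L := by
    intro L ρ hρ
    obtain ⟨h1, h2, h3⟩ := hS1 L (q L) ρ hρ
    exact ⟨by rw [hfac L, h1, mul_zero], h2, h3⟩
  have hTz : ∀ N, ∀ ρ ∈ T (N+1), ρ ≠ 0 ∧ ‖ρ‖ ≤ 2 ^ N := by
    intro N ρ hρ
    obtain ⟨L, hL, hρ⟩ := Multiset.mem_sum.mp hρ
    obtain ⟨h1, h2, h3⟩ := hDz L ρ hρ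
    refine ⟨h2, h3.trans (pow_le_pow_right₀ (by norm_num) ?_)⟩
    have := Finset.mem_range.mp hL; omega
  have hq0 : ∀ N, (q N).1 0 = f 0 := by
    intro N; rw [hfac N 0]; simp
  have hf0 : 0 < ‖f 0‖ := norm_pos_iff.mpr h0
  have hbd : ∀ N z, ‖z‖ ≤ 4 * 2 ^ N →
      (3:ℝ) ^ (Multiset.card (T (N+1))) * ‖(q (N+1)).1 z‖ ≤ ‖f 0‖ * Real.exp (C * (N + 1) * 2 ^ N) := by
    intro N
    exact fac_bound f (q (N+1)).1 (T (N+1)) (2 ^ N) _ (by positivity) (hTz N) (q (N+1)).2.1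
      (hfac (N+1)) (hB N)
  have hcard : ∀ N, (Multiset.card (T (N+1)) : ℝ) ≤ C * (N + 1) * 2 ^ N := by
    intro N
    have h1 := hbd N 0 (by simp)
    rw [hq0, mul_comm] at h1
    have h2 := le_of_mul_le_mul_left h1 hf0
    rw [← Real.exp_le_exp]
    refine le_trans ?_ h2
    rw [← Real.exp_one_pow]
    exact pow_le_pow_left₀ (Real.exp_pos _).le (by linarith [Real.exp_one_lt_d9]) _
  refine ⟨D, ?_, ?_, ?_⟩
  · intro L ρ hρ
    refine ⟨(hDz L ρ hρ).1, (hDz L ρ hρ).2.1, ?_⟩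
    rcases L with _ | L
    · simp
    · right
      by_contra hlt
      push Not at hlt
      refine hS3 L (q L) ρ ?_ ?_
      · rw [pow_succ] at hlt; linarith
      · rw [← qs]; exact (hS1 (L+1) (q (L+1)) ρ hρ).1
  · intro L
    refine le_trans ?_ (hcard L)
    rw [Ts, Multiset.card_add]; push_cast
    linarith [(Nat.cast_nonneg (Multiset.card (T L)) : (0:ℝ) ≤ _)]
  · intro s hs
    rw [← Filter.tendsto_add_atTop_iff_nat 1]
    have hid : ∀ N, ∑ L ∈ Finset.range (N+1), ((D L).map fun ρ => 1 / (s - ρ) + 1 / ρ).sum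
        = (logDeriv f s - logDeriv f 0) - (logDeriv (q (N+1)).1 s - logDeriv (q (N+1)).1 0) := by
      intro N
      have hfe : f = fun z => ((T (N+1)).map fun ρ => 1 - z / ρ).prod * (q (N+1)).1 z :=
        funext (hfac (N+1))
      have e1 := logDeriv_fac (T (N+1)) (q (N+1)).1 (q (N+1)).2.1 (fun ρ h => (hTz N ρ h).1) s
        (by rw [← hfac]; exact hs)
      have e2 := logDeriv_fac (T (N+1)) (q (N+1)).1 (q (N+1)).2.1 (fun ρ h => (hTz N ρ h).1) 0
        (by rw [← hfac]; exact h0)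
      rw [← hfe] at e1 e2
      rw [e1, e2]
      have e3 : ∑ L ∈ Finset.range (N+1), ((D L).map fun ρ => 1 / (s - ρ) + 1 / ρ).sum
        = ((T (N+1)).map fun ρ => 1 / (s - ρ) + 1 / ρ).sum := by
        generalize N + 1 = K
        induction K with
        | zero => simp [T]
        | succ K ih => rw [Finset.sum_range_succ, ih, Ts, Multiset.map_add, Multiset.sum_add]
      rw [e3, Multiset.sum_map_add]
      have e4 : ((T (N+1)).map fun ρ => 1 / (0 - ρ)).sum = - ((T (N+1)).map fun ρ => 1 / ρ).sum := by
        rw [← Multiset.sum_map_neg']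
        simp [div_neg]
      rw [e4]; ring
    simp_rw [hid]
    have hz : Filter.Tendsto (fun N : ℕ => logDeriv (q (N+1)).1 s - logDeriv (q (N+1)).1 0)
        Filter.atTop (nhds 0) := by
      have hlim : Filter.Tendsto (fun N : ℕ => (64 * C * ‖s‖) * (((N:ℝ) + 1) * (1/2) ^ N))
          Filter.atTop (nhds 0) := by
        have h1 := tendsto_self_mul_const_pow_of_lt_one (r := (1/2:ℝ)) (by norm_num) (by norm_num)
        have h2 := tendsto_pow_atTop_nhds_zero_of_lt_one (r := (1/2:ℝ)) (by norm_num) (by norm_num)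
        have := ((h1.add h2).const_mul (64 * C * ‖s‖))
        simp only [add_zero, mul_zero] at this
        refine this.congr fun N => by ring
      refine squeeze_zero_norm' ?_ hlim
      obtain ⟨n0, hn0⟩ := pow_unbounded_of_one_lt (8 * ‖s‖) (by norm_num : (1:ℝ) < 2)
      filter_upwards [Filter.eventually_ge_atTop n0] with N hN
      have h2N : (8 * ‖s‖) ≤ 2 ^ N := hn0.le.trans (pow_le_pow_right₀ (by norm_num) hN)
      refine (logDeriv_small (q (N+1)).1 (q (N+1)).2.1 (2 ^ N) (C * (N + 1) * 2 ^ N) (by positivity)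
        (by positivity) (by rw [qs]; exact hS3 N (q N)) ?_ s (by linarith)).trans (le_of_eq ?_)
      · intro z hz
        rw [hq0]
        refine le_trans ?_ (hbd N z (by linarith [show (0:ℝ) < 2 ^ N by positivity]))
        exact le_mul_of_one_le_left (norm_nonneg _) (one_le_pow₀ (by norm_num))
      · rw [one_div, inv_pow]
        field_simp
    simpa using (tendsto_const_nhds (x := logDeriv f s - logDeriv f 0)).sub hz
open Set Filter Topology MeasureTheory in
lemma zeta1_B0 (F : ℝ → ℂ) (hF : F = indicator (Ioi 1) (fun t => ((Int.fract t : ℝ) : ℂ))) :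
    (∀ s : ℂ, 0 < s.re → DifferentiableAt ℂ (mellin F) (-s)) ∧
    (∀ s : ℂ, mellin F (-s) = ∫ t in Ioi (1:ℝ), ((Int.fract t : ℝ) : ℂ) * (t:ℂ) ^ (-(s+1))) ∧
    (∀ s : ℂ, 0 < s.re → ‖mellin F (-s)‖ ≤ 1 / s.re) := by
  have hm : Measurable F := by
    rw [hF]
    exact (Complex.measurable_ofReal.comp measurable_fract).indicator measurableSet_Ioi
  have hb : ∀ t, ‖F t‖ ≤ 1 := by
    intro t
    rw [hF]
    by_cases ht : t ∈ Ioi (1:ℝ)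
    · rw [indicator_of_mem ht, Complex.norm_real, Real.norm_eq_abs, abs_of_nonneg (Int.fract_nonneg _)]
      exact (Int.fract_lt_one _).le
    · rw [indicator_of_notMem ht]; simp
  have hint : ∀ s : ℂ, mellin F (-s) = ∫ t in Ioi (1:ℝ), ((Int.fract t : ℝ) : ℂ) * (t:ℂ) ^ (-(s+1)) := by
    intro s
    rw [mellin, hF]
    have : ∀ t : ℝ, (t:ℂ) ^ (-s - 1) • indicator (Ioi 1) (fun t => ((Int.fract t : ℝ) : ℂ)) t
        = indicator (Ioi 1) (fun t : ℝ => ((Int.fract t : ℝ) : ℂ) * (t:ℂ) ^ (-(s+1))) t := by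
      intro t
      by_cases ht : t ∈ Ioi (1:ℝ)
      · rw [indicator_of_mem ht, indicator_of_mem ht, smul_eq_mul, mul_comm]; ring_nf
      · rw [indicator_of_notMem ht, indicator_of_notMem ht, smul_zero]
    simp_rw [this]
    rw [setIntegral_indicator measurableSet_Ioi]
    congr 2
    ext t; simp only [mem_inter_iff, mem_Ioi]; constructor
    · exact fun h => h.2
    · exact fun h => ⟨by linarith, h⟩
  refine ⟨?_, hint, ?_⟩
  · intro s hs
    have hlb : LocallyIntegrable F := by
      refine (locallyIntegrable_const (1:ℝ)).mono hm.aestronglyMeasurable ?_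
      exact Eventually.of_forall fun t => by simpa using hb t
    refine mellin_differentiableAt_of_isBigO_rpow (a := 0) (b := -s.re - 1) (hlb.locallyIntegrableOn _) ?_
      (by simpa using hs) ?_ (by simp)
    · simp only [neg_zero, Real.rpow_zero]
      exact Asymptotics.IsBigO.of_bound 1 (Eventually.of_forall fun t => by simpa using hb t)
    · have : F =ᶠ[𝓝[>] 0] fun _ => 0 := by
        have h1 : Iio (1:ℝ) ∈ 𝓝[>] (0:ℝ) := mem_nhdsWithin_of_mem_nhds (Iio_mem_nhds (by norm_num))
        filter_upwards [h1] with t ht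
        rw [hF, indicator_of_notMem]
        simp only [mem_Ioi, not_lt]; exact le_of_lt ht
      exact this.trans_isBigO (Asymptotics.isBigO_zero _ _)
  · intro s hs
    rw [hint]
    have h1 : ∫ t in Ioi (1:ℝ), t ^ (-(s.re + 1)) = 1 / s.re := by
      rw [integral_Ioi_rpow_of_lt (by linarith) (by norm_num)]
      simp
    rw [← h1]
    refine norm_integral_le_of_norm_le ?_ ?_
    · exact integrableOn_Ioi_rpow_of_lt (by linarith) (by norm_num)
    · refine (ae_restrict_iff' measurableSet_Ioi).mpr (Eventually.of_forall fun t ht => ?_)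
      have ht0 : (0:ℝ) < t := lt_trans one_pos ht
      rw [norm_mul, Complex.norm_real, Real.norm_eq_abs, abs_of_nonneg (Int.fract_nonneg _),
        Complex.norm_cpow_eq_rpow_re_of_pos ht0]
      simp only [Complex.neg_re, Complex.add_re, Complex.one_re]
      exact mul_le_of_le_one_left (by positivity) (Int.fract_lt_one _).le

open Set Filter Topology MeasureTheory in
lemma zeta1_B1 (F : ℝ → ℂ) (hF : F = indicator (Ioi 1) (fun t => ((Int.fract t : ℝ) : ℂ)))
    (s : ℂ) (hs : 1 < s.re) : riemannZeta₁ s = s - s * (s - 1) * mellin F (-s) := by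
  obtain ⟨-, hint, -⟩ := zeta1_B0 F hF
  have hs1 : s ≠ 1 := by rintro rfl; simp at hs
  have hs1' : s - 1 ≠ 0 := sub_ne_zero.mpr hs1
  have hO : (fun n : ℕ => ∑ k ∈ Finset.Icc 1 n, (fun _ => (1:ℝ)) k) =O[atTop] fun n => (n : ℝ) ^ (1:ℝ) := by
    simp [Asymptotics.isBigO_refl]
  have h := LSeries_eq_mul_integral_of_nonneg (fun _ => (1:ℝ)) zero_le_one hs hO (fun _ => zero_le_one)
  have h2 : LSeries (fun n ↦ ((1:ℝ):ℂ)) s = riemannZeta s := by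
    rw [← LSeries_one_eq_riemannZeta hs]; congr 1
  rw [h2] at h
  have i1 : IntegrableOn (fun t : ℝ => (t:ℂ) ^ (-s)) (Ioi 1) :=
    integrableOn_Ioi_cpow_of_lt (by simpa using hs) one_pos
  have i2 : IntegrableOn (fun t : ℝ => ((Int.fract t : ℝ) : ℂ) * (t:ℂ) ^ (-(s+1))) (Ioi 1) := by
    have : IntegrableOn (fun t : ℝ => (t:ℂ) ^ (-(s+1))) (Ioi 1) :=
      integrableOn_Ioi_cpow_of_lt (by simp; linarith) one_pos
    refine this.bdd_mul (c := 1) (Complex.measurable_ofReal.comp measurable_fract).aestronglyMeasurable ?_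
    refine Eventually.of_forall fun t => ?_
    rw [Complex.norm_real, Real.norm_eq_abs, abs_of_nonneg (Int.fract_nonneg _)]
    exact (Int.fract_lt_one _).le
  have h3 : ∫ t in Ioi (1 : ℝ), (∑ k ∈ Finset.Icc 1 ⌊t⌋₊, ((1:ℝ) : ℂ)) * (t:ℂ) ^ (-(s + 1))
     = 1 / (s - 1) - mellin F (-s) := by
    rw [hint]
    have h4 : ∫ t in Ioi (1 : ℝ), (t:ℂ) ^ (-s) = 1 / (s - 1) := by
      rw [integral_Ioi_cpow_of_lt (by simpa using hs) one_pos]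
      simp
      rw [show -s + 1 = -(s - 1) by ring, neg_div_neg_eq, one_div]
    rw [← h4, ← integral_sub i1 i2]
    refine setIntegral_congr_fun measurableSet_Ioi fun t ht => ?_
    have ht0 : (0:ℝ) < t := lt_trans one_pos ht
    have ht0' : (t:ℂ) ≠ 0 := by exact_mod_cast ht0.ne'
    have e1 : (∑ k ∈ Finset.Icc 1 ⌊t⌋₊, ((1:ℝ) : ℂ)) = (t:ℂ) - ((Int.fract t : ℝ):ℂ) := by
      simp only [Complex.ofReal_one, Finset.sum_const, Nat.card_Icc, Nat.add_sub_cancel, nsmul_eq_mul, mul_one]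
      have : ((⌊t⌋₊ : ℕ) : ℝ) = t - Int.fract t := by
        rw [natCast_floor_eq_intCast_floor ht0.le]; linarith [Int.floor_add_fract t]
      rw [← Complex.ofReal_sub, ← this]; simp
    have e2 : (t:ℂ) ^ (-s) = t * (t:ℂ) ^ (-(s+1)) := by
      rw [show -s = -(s+1) + 1 by ring, Complex.cpow_add _ _ ht0', Complex.cpow_one, mul_comm]
    rw [e1, e2]; ring
  rw [h3, riemannZeta_eq_inv_sub_mul hs1] at h
  field_simp at h
  rw [h]; ring

open Set Filter Topology MeasureTheory in
lemma zeta1_B2 (s : ℂ) (hs : 1 / 2 ≤ s.re) : ‖riemannZeta₁ s‖ ≤ ‖s‖ + 2 * ‖s‖ * (‖s‖ + 1) := by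
  set F : ℝ → ℂ := indicator (Ioi 1) (fun t => ((Int.fract t : ℝ) : ℂ)) with hF
  obtain ⟨hd, -, hb⟩ := zeta1_B0 F hF
  have key : EqOn riemannZeta₁ (fun s => s - s * (s - 1) * mellin F (-s)) {s : ℂ | 0 < s.re} := by
    have ho : IsOpen {s : ℂ | 0 < s.re} := isOpen_lt continuous_const Complex.continuous_re
    refine AnalyticOnNhd.eqOn_of_preconnected_of_eventuallyEq (𝕜 := ℂ) (z₀ := 2) ?_ ?_ ?_ ?_ ?_
    · exact (differentiable_riemannZeta₁.differentiableOn).analyticOnNhd ho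
    · refine DifferentiableOn.analyticOnNhd ?_ ho
      intro z hz
      have : DifferentiableAt ℂ (fun s => mellin F (-s)) z :=
        DifferentiableAt.fun_comp' z (f := fun s : ℂ => -s) (g := mellin F) (hd z hz) (by fun_prop)
      exact (DifferentiableAt.sub (by fun_prop) ((by fun_prop : DifferentiableAt ℂ (fun s : ℂ => s * (s-1)) z).mul this)).differentiableWithinAt
    · exact (convex_halfSpace_re_gt 0).isPreconnected
    · simp
    · have h1 : {s : ℂ | 1 < s.re} ∈ 𝓝 (2:ℂ) :=
        (isOpen_lt continuous_const Complex.continuous_re).mem_nhds (by simp)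
      filter_upwards [h1] with z hz
      exact zeta1_B1 F hF z hz
  have hpos : 0 < s.re := by linarith
  rw [key hpos]
  refine (norm_sub_le _ _).trans ?_
  have h2 : ‖mellin F (-s)‖ ≤ 2 := (hb s hpos).trans (by rw [div_le_iff₀ hpos]; linarith)
  have h3 : ‖s - 1‖ ≤ ‖s‖ + 1 := (norm_sub_le _ _).trans (by simp)
  rw [norm_mul, norm_mul]
  have : ‖s‖ * ‖s - 1‖ * ‖mellin F (-s)‖ ≤ ‖s‖ * (‖s‖ + 1) * 2 := by gcongr
  linarith
open Set Filter Topology MeasureTheory in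
lemma norm_Gamma_le' (z : ℂ) (hz : 0 < z.re) : ‖Complex.Gamma z‖ ≤ Real.Gamma z.re := by
  rw [Complex.Gamma_eq_integral hz, Real.Gamma_eq_integral hz, Complex.GammaIntegral]
  refine norm_integral_le_of_norm_le (Real.GammaIntegral_convergent hz) ?_
  refine (ae_restrict_iff' measurableSet_Ioi).mpr (Eventually.of_forall fun t ht => ?_)
  rw [norm_mul, Complex.norm_cpow_eq_rpow_re_of_pos ht, Complex.norm_real, Real.norm_eq_abs,
    abs_of_pos (Real.exp_pos _)]
  simp

lemma norm_cos_le' (z : ℂ) : ‖Complex.cos z‖ ≤ Real.exp ‖z‖ := by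
  rw [Complex.cos, norm_div]
  have h1 : ‖Complex.exp (z * Complex.I)‖ ≤ Real.exp ‖z‖ := by
    refine (Complex.norm_exp_le_exp_norm _).trans (le_of_eq (by simp))
  have h2 : ‖Complex.exp (-z * Complex.I)‖ ≤ Real.exp ‖z‖ := by
    refine (Complex.norm_exp_le_exp_norm _).trans (le_of_eq (by simp))
  have h3 := norm_add_le (Complex.exp (z * Complex.I)) (Complex.exp (-z * Complex.I))
  rw [div_le_iff₀ (by simp)]
  simp only [Complex.norm_ofNat]
  linarith

lemma Gamma_le_fac (σ : ℝ) (hσ : 1 / 2 ≤ σ) (M : ℕ) (hM : σ ≤ M + 1) :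
    Real.Gamma σ ≤ 2 * ((M + 2 : ℕ) : ℝ) ^ (M + 2) := by
  have e1 : Real.Gamma (σ + 2) = (σ + 1) * (σ * Real.Gamma σ) := by
    rw [show σ + 2 = (σ + 1) + 1 by ring, Real.Gamma_add_one (by linarith), Real.Gamma_add_one (by linarith)]
  have h0 : 0 < Real.Gamma σ := Real.Gamma_pos_of_pos (by linarith)
  have h1 : Real.Gamma (σ + 2) ≤ Real.Gamma ((M + 2 : ℕ) + 1) := by
    refine Real.Gamma_strictMonoOn_Ici.monotoneOn ?_ ?_ ?_
    · simp; linarith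
    · simp; linarith [(Nat.cast_nonneg M : (0:ℝ) ≤ M)]
    · push_cast; linarith
  rw [Real.Gamma_nat_eq_factorial] at h1
  have h2 : ((M + 2).factorial : ℝ) ≤ ((M + 2 : ℕ) : ℝ) ^ (M + 2) := by
    exact_mod_cast Nat.factorial_le_pow _
  have h3 : (1/2) * Real.Gamma σ ≤ (σ + 1) * (σ * Real.Gamma σ) := by
    rw [← mul_assoc]; gcongr; nlinarith
  linarith

lemma zeta1_B3 (s : ℂ) (hs : s.re < 1 / 2) (M : ℕ) (h1 : 1 ≤ ‖s‖) (hM : ‖s‖ ≤ M) :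
    ‖riemannZeta₁ s‖ ≤ 16 * ((M + 2 : ℕ) : ℝ) ^ (M + 5) * Real.exp (2 * (M + 2)) := by
  set w := 1 - s with hw
  have hwre : 1 / 2 < w.re := by simp [hw]; linarith
  have hs0 : s ≠ 0 := by rintro rfl; simp at h1; linarith
  have hs1 : s ≠ 1 := by rintro rfl; simp at hs; linarith
  have hw1 : w ≠ 1 := by
    intro h; apply hs0; rw [hw] at h; linear_combination -h
  have hwn : ∀ n : ℕ, w ≠ -n := by
    intro n h
    rw [h] at hwre; simp at hwre; linarith [(Nat.cast_nonneg n : (0:ℝ) ≤ n)]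
  have fe := riemannZeta_one_sub hwn hw1
  rw [show 1 - w = s by rw [hw]; ring, riemannZeta_eq_inv_sub_mul hs1, riemannZeta_eq_inv_sub_mul hw1] at fe
  have hs1' : s - 1 ≠ 0 := sub_ne_zero.mpr hs1
  have fe2 : riemannZeta₁ s = (s - 1) * (2 * (2 * ↑Real.pi) ^ (-w) * Complex.Gamma w *
      Complex.cos (↑Real.pi * w / 2) * ((w - 1)⁻¹ * riemannZeta₁ w)) := by
    rw [← fe, mul_inv_cancel_left₀ hs1']
  have hwn1 : ‖w‖ ≤ M + 1 := by
    rw [hw]; refine (norm_sub_le _ _).trans ?_; simp; linarith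
  have n1 : ‖s - 1‖ ≤ M + 1 := by rw [← norm_neg]; simpa [hw] using hwn1
  have n2 : ‖(2 * (Real.pi:ℂ)) ^ (-w)‖ ≤ 1 := by
    have : (2 * (Real.pi:ℂ)) = ((2 * Real.pi : ℝ) : ℂ) := by push_cast; ring
    rw [this, Complex.norm_cpow_eq_rpow_re_of_pos (by positivity)]
    refine Real.rpow_le_one_of_one_le_of_nonpos ?_ ?_
    · linarith [Real.pi_gt_three]
    · simp; linarith
  have n3 : ‖Complex.Gamma w‖ ≤ 2 * ((M + 2 : ℕ) : ℝ) ^ (M + 2) :=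
    (norm_Gamma_le' w (by linarith)).trans (Gamma_le_fac _ hwre.le _
      ((Complex.re_le_norm w).trans hwn1))
  have n4 : ‖Complex.cos (↑Real.pi * w / 2)‖ ≤ Real.exp (2 * (M + 2)) := by
    refine (norm_cos_le' _).trans (Real.exp_le_exp.mpr ?_)
    simp only [norm_div, norm_mul, Complex.norm_real, Real.norm_eq_abs, abs_of_pos Real.pi_pos, Complex.norm_ofNat]
    nlinarith [Real.pi_lt_four, Real.pi_pos, norm_nonneg w]
  have n5 : ‖(w - 1)⁻¹‖ ≤ 1 := by
    rw [norm_inv, hw, show 1 - s - 1 = - s by ring, norm_neg]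
    exact inv_le_one_of_one_le₀ h1
  have n6 : ‖riemannZeta₁ w‖ ≤ 4 * ((M + 2 : ℕ) : ℝ) ^ 2 := by
    refine (zeta1_B2 w hwre.le).trans ?_
    push_cast
    nlinarith [norm_nonneg w]
  rw [fe2]
  simp only [norm_mul, Complex.norm_ofNat]
  calc _ ≤ ((M + 2 : ℕ) : ℝ) * (2 * 1 * (2 * ((M + 2 : ℕ) : ℝ) ^ (M + 2)) * Real.exp (2 * (M + 2)) * (1 * (4 * ((M + 2 : ℕ) : ℝ) ^ 2))) := by
        gcongr
        push_cast; linarith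
    _ = _ := by ring

lemma zeta1_zero : riemannZeta₁ 0 = 1 / 2 := by
  have := riemannZeta_eq_inv_sub_mul (s := 0) (by norm_num)
  rw [riemannZeta_zero] at this
  norm_num at this ⊢
  linear_combination -this

lemma zeta1_growth : ∃ C : ℝ, 0 < C ∧ ∀ (n : ℕ) (z : ℂ), ‖z‖ ≤ 4 * 2 ^ n →
    ‖riemannZeta₁ z‖ ≤ ‖riemannZeta₁ 0‖ * Real.exp (C * (n + 1) * 2 ^ n) := by
  obtain ⟨B, hB⟩ := (isCompact_closedBall (0:ℂ) 1).exists_bound_of_continuousOn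
    (f := riemannZeta₁) differentiable_riemannZeta₁.continuous.continuousOn
  refine ⟨|B| + 60, by positivity, fun n z hz => ?_⟩
  have h2n : (1:ℝ) ≤ 2 ^ n := one_le_pow₀ (by norm_num)
  have hn2 : (1:ℝ) ≤ (n + 1) * 2 ^ n := by nlinarith [(Nat.cast_nonneg n : (0:ℝ) ≤ n)]
  have hz0 : ‖riemannZeta₁ 0‖ = Real.exp (- Real.log 2) := by
    rw [zeta1_zero, Real.exp_neg, Real.exp_log (by norm_num)]; norm_num
  rw [hz0, ← Real.exp_add]
  have hlog : Real.log 2 ≤ 1 := by linarith [Real.log_two_lt_d9]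
  suffices h : ‖riemannZeta₁ z‖ ≤ Real.exp ((|B| + 59) * ((n + 1) * 2 ^ n)) by
    refine h.trans (Real.exp_le_exp.mpr ?_)
    nlinarith [abs_nonneg B]
  by_cases hz1 : ‖z‖ ≤ 1
  · have := hB z (by simpa using hz1)
    refine this.trans ((le_abs_self B).trans ?_)
    refine le_trans ?_ (Real.add_one_le_exp _)
    nlinarith [abs_nonneg B]
  push Not at hz1
  set N : ℝ := ((4 * 2 ^ n + 2 : ℕ) : ℝ) with hN
  have hNv : N = 4 * 2 ^ n + 2 := by rw [hN]; push_cast; ring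
  have hN1 : 1 ≤ N := by rw [hNv]; linarith
  have hNe : N ≤ Real.exp (n + 2) := by
    have h6 : N ≤ 6 * 2 ^ n := by rw [hNv]; linarith
    refine h6.trans ?_
    rw [add_comm, Real.exp_add]
    have a1 : (6:ℝ) ≤ Real.exp 2 := by
      rw [show (2:ℝ) = 1 + 1 by norm_num, Real.exp_add]; nlinarith [Real.exp_one_gt_d9]
    have a2 : (2:ℝ) ^ n ≤ Real.exp n := by
      rw [← Real.exp_one_pow]; exact pow_le_pow_left₀ (by norm_num) (by linarith [Real.exp_one_gt_d9]) _
    gcongr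
  have main : ‖riemannZeta₁ z‖ ≤ 16 * N ^ (4 * 2 ^ n + 5) * Real.exp (2 * N) := by
    by_cases hre : z.re < 1 / 2
    · have := zeta1_B3 z hre (4 * 2 ^ n) hz1.le (by push_cast; exact hz)
      refine this.trans (le_of_eq ?_)
      rw [hNv]; push_cast; rfl
    · push Not at hre
      refine (zeta1_B2 z hre).trans ?_
      have b1 : ‖z‖ ≤ N := by rw [hNv]; linarith
      have b2 : ‖z‖ + 1 ≤ N := by rw [hNv]; linarith
      have b3 : ‖z‖ + 2 * ‖z‖ * (‖z‖ + 1) ≤ N + 2 * N * N := by gcongr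
      have b4 : N + 2 * N * N ≤ 16 * N ^ 2 := by nlinarith
      have b5 : N ^ 2 ≤ N ^ (4 * 2 ^ n + 5) := pow_le_pow_right₀ hN1 (by omega)
      have b6 : 16 * N ^ 2 * 1 ≤ 16 * N ^ (4 * 2 ^ n + 5) * Real.exp (2 * N) := by
        gcongr
        exact Real.one_le_exp (by linarith)
      linarith
  have c1 : N ^ (4 * 2 ^ n + 5) ≤ Real.exp ((n + 2) * (4 * 2 ^ n + 5)) := by
    refine (pow_le_pow_left₀ (by linarith) hNe _).trans (le_of_eq ?_)
    rw [← Real.exp_nat_mul]; congr 1; push_cast; ring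
  have c2 : (16:ℝ) ≤ Real.exp 4 := by
    rw [show (4:ℝ) = 1 + 1 + 1 + 1 by norm_num, Real.exp_add, Real.exp_add, Real.exp_add]
    have h := Real.exp_one_gt_d9
    have : (2:ℝ) ≤ Real.exp 1 := by linarith
    calc (16:ℝ) = 2 * 2 * 2 * 2 := by norm_num
      _ ≤ _ := by gcongr
  have c3 : 16 * N ^ (4 * 2 ^ n + 5) * Real.exp (2 * N) ≤
      Real.exp 4 * Real.exp ((n + 2) * (4 * 2 ^ n + 5)) * Real.exp (2 * N) := by gcongr
  refine (main.trans c3).trans ?_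
  rw [← Real.exp_add, ← Real.exp_add, Real.exp_le_exp, hNv]
  have hn : (0:ℝ) ≤ n := Nat.cast_nonneg n
  have hA : 0 ≤ |B| * ((n + 1) * 2 ^ n) := by positivity
  nlinarith [mul_nonneg hn (by linarith : (0:ℝ) ≤ 2 ^ n - 1)]
lemma zeta1_zeros (RH : ∀ s : ℂ, riemannZeta s = 0 → 0 < s.re → s.re < 1 → s.re = 1 / 2)
    (ρ : ℂ) (h : riemannZeta₁ ρ = 0) :
    ρ.re ≤ 1 / 2 ∧ 1 / 2 ≤ ‖ρ‖ ∧ ‖ρ‖ ≤ 2 * ‖ρ + 1‖ := by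
  have h1 : ρ ≠ 1 := by
    rintro rfl; rw [riemannZeta₁_one] at h; exact one_ne_zero h
  have hz : riemannZeta ρ = 0 := by rw [riemannZeta_eq_inv_sub_mul h1, h, mul_zero]
  have h0 : ρ ≠ 0 := by
    rintro rfl; rw [riemannZeta_zero] at hz; norm_num at hz
  have hre : ρ.re < 1 := by
    by_contra hc
    push Not at hc
    exact riemannZeta_ne_zero_of_one_le_re hc hz
  by_cases hp : 0 < ρ.re
  · have hh := RH ρ hz hp hre
    refine ⟨hh.le, ?_, ?_⟩
    · rw [← hh]; exact Complex.re_le_norm ρ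
    · have : ‖ρ‖ ≤ ‖ρ + 1‖ := by
        rw [← sq_le_sq₀ (norm_nonneg _) (norm_nonneg _), ← Complex.normSq_eq_norm_sq,
          ← Complex.normSq_eq_norm_sq, Complex.normSq_apply, Complex.normSq_apply]
        simp only [Complex.add_re, Complex.one_re, Complex.add_im, Complex.one_im, hh]
        nlinarith
      linarith [norm_nonneg ρ]
  · push Not at hp
    have hw1 : 1 ≤ (1 - ρ).re := by simp; linarith
    have hwn : ∀ n : ℕ, 1 - ρ ≠ -n := by
      intro n hn
      rw [hn] at hw1; simp at hw1; linarith [(Nat.cast_nonneg n : (0:ℝ) ≤ n)]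
    have hne1 : 1 - ρ ≠ 1 := by
      intro hh; apply h0; linear_combination -hh
    have fe := riemannZeta_one_sub hwn hne1
    rw [show 1 - (1 - ρ) = ρ by ring, hz] at fe
    have c1 : (2 * (Real.pi:ℂ)) ^ (-(1 - ρ)) ≠ 0 := by
      rw [Complex.cpow_ne_zero_iff]; left
      simp [Real.pi_ne_zero]
    have c2 : Complex.Gamma (1 - ρ) ≠ 0 := Complex.Gamma_ne_zero_of_re_pos (by linarith)
    have c3 : riemannZeta (1 - ρ) ≠ 0 := riemannZeta_ne_zero_of_one_le_re hw1
    have c4 : Complex.cos (↑Real.pi * (1 - ρ) / 2) = 0 := by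
      by_contra hc
      exact (mul_ne_zero (mul_ne_zero (mul_ne_zero (mul_ne_zero two_ne_zero c1) c2) hc) c3) fe.symm
    obtain ⟨k, hk⟩ := Complex.cos_eq_zero_iff.mp c4
    have hpi : (Real.pi : ℂ) ≠ 0 := by exact_mod_cast Real.pi_ne_zero
    have hρ : ρ = ((-2 * k : ℝ) : ℂ) := by
      have : (Real.pi : ℂ) * (ρ + 2 * k) = 0 := by linear_combination -2 * hk
      rcases mul_eq_zero.mp this with h | h
      · exact absurd h hpi
      · push_cast; linear_combination h
    have hk1 : 1 ≤ k := by
      by_contra hc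
      have h5 : k ≤ 0 := by omega
      rw [hρ, Complex.ofReal_re] at hp
      have h6 : (0:ℝ) ≤ k := by linarith
      have h7 : k = 0 := by
        have : (0:ℤ) ≤ k := by exact_mod_cast h6
        omega
      apply h0; rw [hρ, h7]; simp
    have hk1' : (1:ℝ) ≤ k := by exact_mod_cast hk1
    have e1 : ρ + 1 = ((-2 * k + 1 : ℝ) : ℂ) := by rw [hρ]; push_cast; ring
    refine ⟨by linarith, ?_, ?_⟩
    · rw [hρ, Complex.norm_real, Real.norm_eq_abs, abs_of_neg (by linarith)]; linarith
    · rw [e1, hρ, Complex.norm_real, Complex.norm_real, Real.norm_eq_abs, Real.norm_eq_abs,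
        abs_of_neg (by linarith), abs_of_neg (by linarith)]; linarith
open Set Filter Topology MeasureTheory in
lemma mellin_zero (G : ℝ → ℂ) (hG : ContinuousOn G (Ioi 1)) (K : ℝ) (hK : ∀ x, 1 < x → ‖G x‖ ≤ K * x)
    (hz : ∀ s : ℂ, s.re = 2 → ∫ x in Ioi (1:ℝ), G x * (x:ℂ) ^ (-(s+1)) = 0) (x : ℝ) (hx : 1 < x) :
    G x = 0 := by
  set H : ℝ → ℂ := indicator (Ioi 1) G with hH
  have hind : ∀ s : ℂ, ∀ t : ℝ, (t:ℂ) ^ (-s - 1) • H t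
        = indicator (Ioi 1) (fun t : ℝ => G t * (t:ℂ) ^ (-(s+1))) t := by
    intro s t
    rw [hH]
    by_cases ht : t ∈ Ioi (1:ℝ)
    · rw [indicator_of_mem ht, indicator_of_mem ht, smul_eq_mul, mul_comm]; ring_nf
    · rw [indicator_of_notMem ht, indicator_of_notMem ht, smul_zero]
  have hset : Ioi (0:ℝ) ∩ Ioi 1 = Ioi 1 := by
    ext t; simp only [mem_inter_iff, mem_Ioi]; constructor
    · exact fun h => h.2
    · exact fun h => ⟨by linarith, h⟩
  have hmel : ∀ s : ℂ, s.re = 2 → mellin H (-s) = 0 := by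
    intro s hs
    rw [mellin]
    simp_rw [hind s]
    rw [setIntegral_indicator measurableSet_Ioi, hset, hz s hs]
  have hconv : MellinConvergent H ((-2 : ℝ) : ℂ) := by
    rw [MellinConvergent]
    have := hind 2
    rw [show ((-2 : ℝ) : ℂ) = -2 by push_cast; rfl]
    simp_rw [this]
    rw [integrableOn_indicator_iff measurableSet_Ioi, inter_comm, hset]
    have hi : IntegrableOn (fun t : ℝ => K * t ^ (-2:ℝ)) (Ioi 1) :=
      (integrableOn_Ioi_rpow_of_lt (by norm_num) one_pos).const_mul K
    refine Integrable.mono' hi ?_ ?_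
    · refine ContinuousOn.aestronglyMeasurable ?_ measurableSet_Ioi
      refine hG.mul ?_
      intro t ht
      have ht0 : (0:ℝ) < t := lt_trans one_pos ht
      exact (Complex.continuousAt_ofReal_cpow_const _ _ (Or.inr ht0.ne')).continuousWithinAt
    · refine (ae_restrict_iff' measurableSet_Ioi).mpr (Eventually.of_forall fun t ht => ?_)
      have ht0 : (0:ℝ) < t := lt_trans one_pos ht
      rw [norm_mul, Complex.norm_cpow_eq_rpow_re_of_pos ht0]
      have e : t ^ (-2:ℝ) = t * t ^ (-(2+1) : ℝ) := by
        nth_rewrite 2 [← Real.rpow_one t]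
        rw [← Real.rpow_add ht0]; norm_num
      have e2 : (-((2:ℂ)+1)).re = (-(2+1) : ℝ) := by simp
      rw [e, e2, ← mul_assoc]
      exact mul_le_mul_of_nonneg_right (hK t ht) (by positivity)
  have hzero : ∀ y : ℝ, mellin H (((-2 : ℝ) : ℂ) + y * Complex.I) = 0 := by
    intro y
    have := hmel (-(((-2 : ℝ) : ℂ) + y * Complex.I)) (by simp)
    rwa [neg_neg] at this
  have hvert : Complex.VerticalIntegrable (mellin H) (-2) := by
    rw [Complex.VerticalIntegrable]
    simp_rw [hzero]
    exact integrable_zero _ _ _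
  have hev : H =ᶠ[𝓝 x] G := by
    filter_upwards [Ioi_mem_nhds hx] with t ht
    rw [hH, indicator_of_mem ht]
  have hcont : ContinuousAt H x :=
    (hG.continuousAt (Ioi_mem_nhds hx)).congr hev.symm
  have := mellinInv_mellin_eq (-2) H (by linarith : 0 < x) hconv hvert hcont
  rw [← hev.eq_of_nhds, ← this, mellinInv]
  simp_rw [hzero]
  simp
noncomputable def psi1 (x : ℝ) : ℝ :=
  ∑ n ∈ Finset.range (⌊x⌋₊ + 1), ArithmeticFunction.vonMangoldt n * max (x - n) 0

lemma psi1_eq (x : ℝ) (N : ℕ) (hN : x < N) :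
    psi1 x = ∑ n ∈ Finset.range N, ArithmeticFunction.vonMangoldt n * max (x - n) 0 := by
  rw [psi1]
  have hgt : ∀ n : ℕ, ⌊x⌋₊ + 1 ≤ n → max (x - n) 0 = 0 := by
    intro n hn
    apply max_eq_right
    have h2 : x < n := Nat.lt_of_floor_lt (by omega)
    linarith
  rcases Nat.eq_zero_or_pos N with h0 | h0
  · subst h0
    have hx : x < 0 := by simpa using hN
    simp only [Finset.range_zero, Finset.sum_empty]
    refine Finset.sum_eq_zero fun n _ => ?_
    rw [max_eq_right, mul_zero]
    linarith [(Nat.cast_nonneg n : (0:ℝ) ≤ n)]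
  · refine Finset.sum_subset ?_ ?_
    · intro n hn
      rw [Finset.mem_range] at hn ⊢
      have : ⌊x⌋₊ < N := (Nat.floor_lt' h0.ne').mpr hN
      omega
    · intro n _ hn
      rw [Finset.mem_range] at hn
      rw [hgt n (by omega), mul_zero]

lemma psi_eq_range (x : ℝ) (hx : 0 ≤ x) (N : ℕ) (hN : x < N) :
    Chebyshev.psi x = ∑ n ∈ Finset.range N, if (n:ℝ) ≤ x then ArithmeticFunction.vonMangoldt n else 0 := by
  rw [Chebyshev.psi_eq_sum_Icc, ← Finset.sum_filter]
  refine Finset.sum_congr ?_ fun _ _ => rfl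
  ext n
  simp only [Finset.mem_Icc, Finset.mem_filter, Finset.mem_range, Nat.zero_le, true_and]
  rw [Nat.le_floor_iff hx]
  constructor
  · intro h; exact ⟨by exact_mod_cast lt_of_le_of_lt h hN, h⟩
  · exact fun h => h.2

lemma psi1_sub (x y : ℝ) (hx : 0 ≤ x) (hxy : x ≤ y) :
    (y - x) * Chebyshev.psi x ≤ psi1 y - psi1 x ∧ psi1 y - psi1 x ≤ (y - x) * Chebyshev.psi y := by
  obtain ⟨N, hN⟩ := exists_nat_gt y
  rw [psi1_eq y N hN, psi1_eq x N (lt_of_le_of_lt hxy hN), psi_eq_range y (hx.trans hxy) N hN,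
    psi_eq_range x hx N (lt_of_le_of_lt hxy hN), ← Finset.sum_sub_distrib, Finset.mul_sum, Finset.mul_sum]
  constructor
  · refine Finset.sum_le_sum fun n _ => ?_
    have hL : 0 ≤ ArithmeticFunction.vonMangoldt n := ArithmeticFunction.vonMangoldt_nonneg
    rw [← mul_sub]
    split_ifs with h
    · rw [max_eq_left (by linarith), max_eq_left (by linarith)]; apply le_of_eq; ring
    · rw [mul_zero]; refine mul_nonneg hL (sub_nonneg.mpr (max_le_max (by linarith) le_rfl))
  · refine Finset.sum_le_sum fun n _ => ?_
    have hL : 0 ≤ ArithmeticFunction.vonMangoldt n := ArithmeticFunction.vonMangoldt_nonneg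
    rw [← mul_sub]
    split_ifs with h
    · rw [mul_comm]
      refine mul_le_mul_of_nonneg_right ?_ hL
      rw [max_eq_left (by linarith : 0 ≤ y - n)]
      linarith [le_max_left (x - n) 0]
    · push Not at h
      rw [max_eq_right (by linarith), max_eq_right (by linarith)]; simp

lemma psi1_nonneg (x : ℝ) : 0 ≤ psi1 x :=
  Finset.sum_nonneg fun _ _ => mul_nonneg ArithmeticFunction.vonMangoldt_nonneg (le_max_right _ _)

lemma psi1_le (x : ℝ) (hx : 0 ≤ x) : psi1 x ≤ (Real.log 4 + 4) * x ^ 2 := by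
  have h := (psi1_sub 0 x le_rfl hx).2
  have h0 : psi1 0 = 0 := by simp [psi1]
  have h2 := Chebyshev.psi_le_const_mul_self hx
  rw [h0] at h
  nlinarith

lemma continuous_psi1 : Continuous psi1 := by
  rw [continuous_iff_continuousAt]
  intro x
  obtain ⟨N, hN⟩ := exists_nat_gt x
  have : psi1 =ᶠ[nhds x] fun x => ∑ n ∈ Finset.range N, ArithmeticFunction.vonMangoldt n * max (x - n) 0 := by
    filter_upwards [Iio_mem_nhds hN] with y hy
    exact psi1_eq y N hy
  refine ContinuousAt.congr ?_ this.symm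
  fun_prop

open Set Filter Topology MeasureTheory in
lemma cpow_Ioi_int (s : ℂ) (hs : 0 < s.re) (c : ℝ) (hc : 0 < c) :
    IntegrableOn (fun x : ℝ => (x:ℂ) ^ (-(s+1))) (Ioi c) ∧
    ∫ x in Ioi c, (x:ℂ) ^ (-(s+1)) = (c:ℂ) ^ (-s) / s := by
  have h1 : (-(s+1)).re < -1 := by simp; linarith
  refine ⟨integrableOn_Ioi_cpow_of_lt h1 hc, ?_⟩
  rw [integral_Ioi_cpow_of_lt h1 hc, show -(s+1)+1 = -s by ring, neg_div_neg_eq]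

open Set Filter Topology MeasureTheory in
lemma tri_int (s : ℂ) (hs : 0 < s.re) (n : ℕ) (hn : 1 ≤ n) :
    IntegrableOn (fun x : ℝ => ((max (x - n) 0 / x : ℝ) : ℂ) * (x:ℂ) ^ (-(s+1))) (Ioi 1) ∧
    ∫ x in Ioi (1:ℝ), ((max (x - n) 0 / x : ℝ) : ℂ) * (x:ℂ) ^ (-(s+1)) = (n:ℂ) ^ (-s) / (s * (s+1)) := by
  have hn' : (1:ℝ) ≤ n := by exact_mod_cast hn
  have hn0 : (n:ℂ) ≠ 0 := by exact_mod_cast (by omega : n ≠ 0)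
  have hs0 : s ≠ 0 := by rintro rfl; simp at hs
  have hs1 : s + 1 ≠ 0 := by
    intro h; have := congrArg Complex.re h; simp at this; linarith
  have hind : ∀ x : ℝ, x ∈ Ioi (1:ℝ) → ((max (x - n) 0 / x : ℝ) : ℂ) * (x:ℂ) ^ (-(s+1)) =
      indicator (Ioi (n:ℝ)) (fun x : ℝ => (x:ℂ) ^ (-(s+1)) - n * (x:ℂ) ^ (-((s+1)+1))) x := by
    intro x hx
    have hx0 : (x:ℂ) ≠ 0 := by
      have : (0:ℝ) < x := lt_trans one_pos hx
      exact_mod_cast this.ne'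
    by_cases h : x ∈ Ioi (n:ℝ)
    · rw [indicator_of_mem h, max_eq_left (by simp only [mem_Ioi] at h; linarith)]
      rw [show (-(s+1)) = (-((s+1)+1)) + 1 by ring, Complex.cpow_add _ _ hx0, Complex.cpow_one]
      push_cast
      field_simp
    · rw [indicator_of_notMem h, max_eq_right (by simp only [mem_Ioi, not_lt] at h; linarith)]
      simp
  obtain ⟨i1, e1⟩ := cpow_Ioi_int s hs n (by linarith)
  obtain ⟨i2, e2⟩ := cpow_Ioi_int (s+1) (by simp; linarith) n (by linarith)
  have hset : Ioi (1:ℝ) ∩ Ioi (n:ℝ) = Ioi (n:ℝ) := by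
    ext t; simp only [mem_inter_iff, mem_Ioi]; constructor
    · exact fun h => h.2
    · exact fun h => ⟨by linarith, h⟩
  have i3 := i1.sub (i2.const_mul (n:ℂ))
  constructor
  · rw [integrableOn_congr_fun hind measurableSet_Ioi, integrableOn_indicator_iff measurableSet_Ioi,
      inter_comm, hset]
    exact i3
  · rw [setIntegral_congr_fun measurableSet_Ioi hind, setIntegral_indicator measurableSet_Ioi, hset,
      integral_sub i1 (i2.const_mul (n:ℂ)), integral_const_mul, e1, e2]
    have e3 : (n:ℂ) ^ (-s) = (n:ℂ) ^ (-(s+1)) * n := by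
      rw [show -s = (-(s+1)) + 1 by ring, Complex.cpow_add _ _ hn0, Complex.cpow_one]
    rw [Complex.ofReal_natCast, e3]
    generalize (n:ℂ) ^ (-(s+1)) = X
    field_simp
    ring

open Set Filter Topology MeasureTheory in
lemma psi1_mellin (s : ℂ) (hs : s.re = 2) :
    ∫ x in Ioi (1:ℝ), ((psi1 x / x : ℝ) : ℂ) * (x:ℂ) ^ (-(s+1)) =
      LSeries (fun n => (ArithmeticFunction.vonMangoldt n : ℂ)) s / (s * (s+1)) := by
  set F : ℕ → ℝ → ℂ := fun n x => (ArithmeticFunction.vonMangoldt n : ℂ) *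
    (((max (x - n) 0 / x : ℝ) : ℂ) * (x:ℂ) ^ (-(s+1))) with hF
  have hs0 : 0 < s.re := by linarith
  have hsum : LSeriesSummable (fun n => (ArithmeticFunction.vonMangoldt n : ℂ)) s :=
    ArithmeticFunction.LSeriesSummable_vonMangoldt (by linarith)
  have hint : ∀ n, Integrable (F n) (volume.restrict (Ioi 1)) := by
    intro n
    rcases Nat.eq_zero_or_pos n with rfl | hn
    · simp [hF]
    · exact (tri_int s hs0 n hn).1.const_mul _
  have hS : Summable fun n => ∫ x in Ioi (1:ℝ), ‖F n x‖ := by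
    refine Summable.of_nonneg_of_le (fun n => integral_nonneg fun x => norm_nonneg _) ?_
      ((hsum.norm).mul_left (1/2 : ℝ))
    intro n
    rcases Nat.eq_zero_or_pos n with rfl | hn
    · simp [hF]
    have hn' : (1:ℝ) ≤ n := by exact_mod_cast hn
    have hnt : ‖LSeries.term (fun n => (ArithmeticFunction.vonMangoldt n : ℂ)) s n‖ =
        ArithmeticFunction.vonMangoldt n * (n:ℝ) ^ (-2:ℝ) := by
      rw [LSeries.term_of_ne_zero (by omega), norm_div, Complex.norm_natCast_cpow_of_pos hn, hs,
        Complex.norm_real, Real.norm_eq_abs, abs_of_nonneg ArithmeticFunction.vonMangoldt_nonneg,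
        Real.rpow_neg (by positivity), div_eq_mul_inv]
    rw [hnt]
    have hval : ∫ x in Ioi (n:ℝ), x ^ (-3:ℝ) = (1/2) * (n:ℝ) ^ (-2:ℝ) := by
      rw [integral_Ioi_rpow_of_lt (by norm_num) (by linarith)]
      norm_num
      ring
    have hi : IntegrableOn (fun x : ℝ => x ^ (-3:ℝ)) (Ioi (n:ℝ)) :=
      integrableOn_Ioi_rpow_of_lt (by norm_num) (by linarith)
    have hset : Ioi (1:ℝ) ∩ Ioi (n:ℝ) = Ioi (n:ℝ) := by
      ext t; simp only [mem_inter_iff, mem_Ioi]; constructor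
      · exact fun h => h.2
      · exact fun h => ⟨by linarith, h⟩
    calc ∫ x in Ioi (1:ℝ), ‖F n x‖ ≤ ∫ x in Ioi (1:ℝ), indicator (Ioi (n:ℝ))
          (fun x : ℝ => ArithmeticFunction.vonMangoldt n * x ^ (-3:ℝ)) x := by
          refine setIntegral_mono_on (hint n).norm ?_ measurableSet_Ioi ?_
          · rw [integrableOn_indicator_iff measurableSet_Ioi, inter_comm, hset]
            exact hi.const_mul _
          · intro x hx
            have hx0 : (0:ℝ) < x := lt_trans one_pos hx
            have en : ‖F n x‖ = ArithmeticFunction.vonMangoldt n * ((max (x - n) 0 / x) * x ^ (-3:ℝ)) := by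
              rw [hF]
              simp only [norm_mul]
              rw [Complex.norm_cpow_eq_rpow_re_of_pos hx0, Complex.norm_real, Complex.norm_real,
                Real.norm_eq_abs, Real.norm_eq_abs, abs_of_nonneg ArithmeticFunction.vonMangoldt_nonneg,
                abs_of_nonneg (div_nonneg (le_max_right _ _) hx0.le)]
              congr 3
              simp [hs]; norm_num
            rw [en]
            by_cases h : x ∈ Ioi (n:ℝ)
            · rw [indicator_of_mem h, max_eq_left (by simp only [mem_Ioi] at h; linarith)]
              refine mul_le_mul_of_nonneg_left ?_ ArithmeticFunction.vonMangoldt_nonneg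
              refine mul_le_of_le_one_left (by positivity) ?_
              rw [div_le_one hx0]; linarith
            · rw [indicator_of_notMem h, max_eq_right (by simp only [mem_Ioi, not_lt] at h; linarith)]
              simp
      _ = ArithmeticFunction.vonMangoldt n * ((1/2) * (n:ℝ) ^ (-2:ℝ)) := by
          rw [setIntegral_indicator measurableSet_Ioi, hset, integral_const_mul, hval]
      _ ≤ _ := by apply le_of_eq; ring
  have key := hasSum_integral_of_summable_integral_norm hint hS
  have hpt : ∀ x : ℝ, ∑' n, F n x = ((psi1 x / x : ℝ) : ℂ) * (x:ℂ) ^ (-(s+1)) := by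
    intro x
    rw [tsum_eq_sum (s := Finset.range (⌊x⌋₊ + 1))]
    · rw [psi1, Finset.sum_div]; push_cast; rw [Finset.sum_mul]
      refine Finset.sum_congr rfl fun n _ => ?_
      rw [hF]; push_cast; ring
    · intro n hn
      rw [Finset.mem_range] at hn
      have h2 : x < n := Nat.lt_of_floor_lt (by omega)
      rw [hF]; simp only; rw [max_eq_right (by linarith)]; simp
  simp_rw [hpt] at key
  rw [← key.tsum_eq, LSeries, ← tsum_div_const]
  congr 1; ext n
  rw [hF]
  rcases Nat.eq_zero_or_pos n with rfl | hn
  · simp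
  · simp only
    rw [integral_const_mul, (tri_int s hs0 n hn).2, LSeries.term_of_ne_zero (by omega), Complex.cpow_neg]
    ring
lemma norm_msum_le (S : Multiset ℂ) (g : ℂ → ℂ) (B : ℝ) (h : ∀ ρ ∈ S, ‖g ρ‖ ≤ B) :
    ‖(S.map g).sum‖ ≤ Multiset.card S * B := by
  induction S using Multiset.induction with
  | empty => simp
  | cons a S ih =>
    rw [Multiset.map_cons, Multiset.sum_cons, Multiset.card_cons]
    have h1 := h a (Multiset.mem_cons_self a S)
    have h2 := ih fun ρ hρ => h ρ (Multiset.mem_cons_of_mem hρ)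
    refine (norm_add_le _ _).trans ?_
    push_cast; linarith

noncomputable def zsum (S : Multiset ℂ) (x : ℝ) : ℂ :=
  (S.map fun ρ => ((x:ℂ) ^ ρ - (x:ℂ)⁻¹) / (ρ * (ρ + 1))).sum

lemma zero_den (ρ : ℂ) (L : ℕ) (h : ρ.re ≤ 1 / 2 ∧ 2 ^ L ≤ 2 * ‖ρ‖ ∧ ‖ρ‖ ≤ 2 * ‖ρ + 1‖) :
    (2 ^ L) ^ 2 / 8 ≤ ‖ρ * (ρ + 1)‖ := by
  obtain ⟨h1, h2, h3⟩ := h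
  rw [norm_mul]
  have h0 : (0:ℝ) < 2 ^ L := by positivity
  have : (2:ℝ) ^ L / 2 * (2 ^ L / 4) ≤ ‖ρ‖ * ‖ρ + 1‖ := by
    gcongr <;> linarith
  linarith [this]

lemma zero_ne (ρ : ℂ) (L : ℕ) (h : ρ.re ≤ 1 / 2 ∧ 2 ^ L ≤ 2 * ‖ρ‖ ∧ ‖ρ‖ ≤ 2 * ‖ρ + 1‖) :
    ρ ≠ 0 ∧ ρ + 1 ≠ 0 := by
  have h1 := zero_den ρ L h
  have h0 : 0 < ‖ρ * (ρ + 1)‖ := lt_of_lt_of_le (by positivity) h1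
  rw [norm_pos_iff] at h0
  exact mul_ne_zero_iff.mp h0

lemma zsum_bound (S : Multiset ℂ) (L : ℕ) (C : ℝ) (hC : 0 < C)
    (hS : ∀ ρ ∈ S, ρ.re ≤ 1 / 2 ∧ 2 ^ L ≤ 2 * ‖ρ‖ ∧ ‖ρ‖ ≤ 2 * ‖ρ + 1‖)
    (hcard : (Multiset.card S : ℝ) ≤ C * (L + 1) * 2 ^ L) (x : ℝ) (hx : 1 ≤ x) :
    ‖zsum S x‖ ≤ 16 * C * ((L + 1) * (1/2) ^ L) * √x := by
  have hx0 : 0 < x := by linarith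
  have h2L : (0:ℝ) < 2 ^ L := by positivity
  have hsx : 1 ≤ √x := Real.one_le_sqrt.mpr hx
  refine (norm_msum_le S _ (16 * √x / (2 ^ L) ^ 2) ?_).trans ?_
  · intro ρ hρ
    rw [norm_div]
    have h1 := zero_den ρ L (hS ρ hρ)
    have h2 : ‖(x:ℂ) ^ ρ - (x:ℂ)⁻¹‖ ≤ 2 * √x := by
      refine (norm_sub_le _ _).trans ?_
      rw [Complex.norm_cpow_eq_rpow_re_of_pos hx0, norm_inv, Complex.norm_real, Real.norm_eq_abs,
        abs_of_pos hx0]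
      have a1 : x ^ ρ.re ≤ √x := by
        rw [Real.sqrt_eq_rpow]; exact Real.rpow_le_rpow_of_exponent_le hx (hS ρ hρ).1
      have a2 : x⁻¹ ≤ 1 := inv_le_one_of_one_le₀ hx
      linarith
    calc _ ≤ (2 * √x) / ((2 ^ L) ^ 2 / 8) := by gcongr
      _ = _ := by field_simp; ring
  · calc _ ≤ (C * (L + 1) * 2 ^ L) * (16 * √x / (2 ^ L) ^ 2) := by gcongr
      _ = _ := by rw [one_div, inv_pow]; field_simp

open Set Filter Topology MeasureTheory in
lemma zsum_mellin (S : Multiset ℂ) (hS : ∀ ρ ∈ S, ρ.re ≤ 1 / 2 ∧ ρ ≠ 0 ∧ ρ + 1 ≠ 0) (s : ℂ) (hs : s.re = 2) :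
    IntegrableOn (fun x : ℝ => zsum S x * (x:ℂ) ^ (-(s+1))) (Ioi 1) ∧
    ∫ x in Ioi (1:ℝ), zsum S x * (x:ℂ) ^ (-(s+1)) =
      (S.map fun ρ => 1 / (s - ρ) + 1 / ρ).sum / (s * (s + 1)) := by
  induction S using Multiset.induction with
  | empty => simp [zsum]
  | cons a S ih =>
    obtain ⟨i1, e1⟩ := ih fun ρ hρ => hS ρ (Multiset.mem_cons_of_mem hρ)
    obtain ⟨ha, ha0, ha1⟩ := hS a (Multiset.mem_cons_self a S)
    obtain ⟨i2, e2⟩ := cpow_Ioi_int (s - a) (by simp; linarith) 1 one_pos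
    obtain ⟨i3, e3⟩ := cpow_Ioi_int (s + 1) (by simp; linarith) 1 one_pos
    have hsa : s - a ≠ 0 := by
      intro h; have := congrArg Complex.re h; simp at this; linarith
    have hs0 : s ≠ 0 := by rintro rfl; simp at hs
    have hs1 : s + 1 ≠ 0 := by
      intro h; have := congrArg Complex.re h; simp at this; linarith
    have hpt : ∀ x : ℝ, x ∈ Ioi (1:ℝ) → zsum (a ::ₘ S) x * (x:ℂ) ^ (-(s+1)) =
        ((x:ℂ) ^ (-((s - a) + 1)) - (x:ℂ) ^ (-((s + 1) + 1))) * (1 / (a * (a + 1))) + zsum S x * (x:ℂ) ^ (-(s+1)) := by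
      intro x hx
      have hx0 : (x:ℂ) ≠ 0 := by
        have : (0:ℝ) < x := lt_trans one_pos hx
        exact_mod_cast this.ne'
      rw [zsum, Multiset.map_cons, Multiset.sum_cons, ← zsum]
      have c1 : (x:ℂ) ^ (-((s - a) + 1)) = (x:ℂ) ^ a * (x:ℂ) ^ (-(s+1)) := by
        rw [← Complex.cpow_add _ _ hx0]; congr 1; ring
      have c2 : (x:ℂ) ^ (-((s + 1) + 1)) = (x:ℂ)⁻¹ * (x:ℂ) ^ (-(s+1)) := by
        rw [← Complex.cpow_neg_one, ← Complex.cpow_add _ _ hx0]; congr 1; ring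
      rw [c1, c2]; ring
    have i4 : IntegrableOn (fun x : ℝ => ((x:ℂ) ^ (-((s - a) + 1)) - (x:ℂ) ^ (-((s + 1) + 1))) * (1 / (a * (a + 1)))) (Ioi 1) :=
      (i2.sub i3).mul_const (1 / (a * (a + 1)))
    constructor
    · rw [integrableOn_congr_fun hpt measurableSet_Ioi]
      exact i4.add i1
    · rw [setIntegral_congr_fun measurableSet_Ioi hpt, integral_add i4 i1, integral_mul_const,
        integral_sub i2 i3, e1, e2, e3, Multiset.map_cons, Multiset.sum_cons]
      simp only [Complex.ofReal_one, Complex.one_cpow]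
      rw [add_div]; congr 1
      field_simp
      ring

lemma summable_shell : Summable fun L : ℕ => ((L:ℝ) + 1) * (1/2) ^ L := by
  have h1 : Summable fun L : ℕ => (L:ℝ) ^ 1 * (1/2:ℝ) ^ L :=
    summable_pow_mul_geometric_of_norm_lt_one 1 (by norm_num)
  have h2 : Summable fun L : ℕ => (1/2:ℝ) ^ L := summable_geometric_of_lt_one (by norm_num) (by norm_num)
  exact (h1.add h2).congr fun L => by ring

lemma zsum_continuousAt (S : Multiset ℂ) (x : ℝ) (hx : 1 < x) : ContinuousAt (zsum S) x := by
  induction S using Multiset.induction with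
  | empty =>
    have : zsum 0 = fun _ => 0 := by ext x; simp [zsum]
    rw [this]; exact continuousAt_const
  | cons a S ih =>
    have : zsum (a ::ₘ S) = fun x : ℝ => ((x:ℂ) ^ a - (x:ℂ)⁻¹) / (a * (a + 1)) + zsum S x := by
      ext x; rw [zsum, Multiset.map_cons, Multiset.sum_cons, ← zsum]
    rw [this]
    have hx0 : x ≠ 0 := by linarith
    refine ContinuousAt.add (ContinuousAt.div_const (ContinuousAt.sub ?_ ?_) _) ih
    · exact Complex.continuousAt_ofReal_cpow_const _ _ (Or.inr hx0)
    · exact (Complex.continuous_ofReal.continuousAt).inv₀ (by exact_mod_cast hx0)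

open Set Filter Topology MeasureTheory in
lemma explicit_formula (D : ℕ → Multiset ℂ) (C : ℝ) (hC : 0 < C)
    (hD : ∀ L, ∀ ρ ∈ D L, ρ.re ≤ 1 / 2 ∧ 2 ^ L ≤ 2 * ‖ρ‖ ∧ ‖ρ‖ ≤ 2 * ‖ρ + 1‖)
    (hcard : ∀ L, (Multiset.card (D L) : ℝ) ≤ C * (L + 1) * 2 ^ L)
    (hlim : ∀ s, riemannZeta₁ s ≠ 0 → Tendsto (fun N : ℕ => ∑ L ∈ Finset.range N,
        ((D L).map fun ρ => 1 / (s - ρ) + 1 / ρ).sum) atTop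
        (𝓝 (logDeriv riemannZeta₁ s - logDeriv riemannZeta₁ 0))) (x : ℝ) (hx : 1 < x) :
    ((psi1 x / x : ℝ) : ℂ) - (x / 2 - 1 + (x:ℂ)⁻¹ / 2) + logDeriv riemannZeta₁ 0 * (1 - (x:ℂ)⁻¹)
      + ∑' L, zsum (D L) x = 0 := by
  set b := logDeriv riemannZeta₁ 0 with hb
  set u : ℕ → ℝ := fun L => 16 * C * (((L:ℝ) + 1) * (1/2) ^ L) with hu
  have hus : Summable u := summable_shell.mul_left _
  have hu0 : ∀ L, 0 ≤ u L := fun L => by positivity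
  have hzb : ∀ L, ∀ x : ℝ, 1 ≤ x → ‖zsum (D L) x‖ ≤ u L * √x :=
    fun L x hx => zsum_bound (D L) L C hC (hD L) (hcard L) x hx
  have hzc : ∀ x : ℝ, 1 < x → ContinuousAt (fun x => ∑' L, zsum (D L) x) x := by
    intro x hx
    have : ContinuousOn (fun x => ∑' L, zsum (D L) x) (Ioo 1 (x+1)) := by
      refine continuousOn_tsum (u := fun L => u L * √(x+1)) ?_ (hus.mul_right _) ?_
      · intro L y hy; exact (zsum_continuousAt _ _ hy.1).continuousWithinAt
      · intro L y hy
        refine (hzb L y hy.1.le).trans ?_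
        exact mul_le_mul_of_nonneg_left (Real.sqrt_le_sqrt hy.2.le) (hu0 L)
    exact this.continuousAt (Ioo_mem_nhds hx (by linarith))
  have hzt : ∀ x : ℝ, 1 ≤ x → ‖∑' L, zsum (D L) x‖ ≤ (∑' L, u L) * √x := by
    intro x hx
    rw [← tsum_mul_right]
    exact tsum_of_norm_bounded (hus.mul_right _).hasSum (fun L => hzb L x hx)
  refine mellin_zero (fun x : ℝ => ((psi1 x / x : ℝ) : ℂ) - (x / 2 - 1 + (x:ℂ)⁻¹ / 2) + b * (1 - (x:ℂ)⁻¹)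
      + ∑' L, zsum (D L) x) ?_ ((Real.log 4 + 4) + 2 + 2 * ‖b‖ + ∑' L, u L) ?_ ?_ x hx
  · intro y hy
    have hy0 : (y:ℂ) ≠ 0 := by
      have : (0:ℝ) < y := lt_trans one_pos hy
      exact_mod_cast this.ne'
    have hinv : ContinuousAt (fun x : ℝ => (x:ℂ)⁻¹) y :=
      (Complex.continuous_ofReal.continuousAt).inv₀ hy0
    have hid : ContinuousAt (fun x : ℝ => (x:ℂ)) y := Complex.continuous_ofReal.continuousAt
    have hps : ContinuousAt (fun x : ℝ => ((psi1 x / x : ℝ) : ℂ)) y := by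
      refine Complex.continuous_ofReal.continuousAt.comp ?_
      exact continuous_psi1.continuousAt.div continuousAt_id (by have : (1:ℝ) < y := hy; simp; linarith)
    refine ContinuousAt.continuousWithinAt ?_
    refine ((hps.sub (((hid.div_const 2).sub continuousAt_const).add (hinv.div_const 2))).add
      (continuousAt_const.mul (continuousAt_const.sub hinv))).add (hzc y hy)
  · intro y hy
    have hy0 : 0 < y := by linarith
    have n1 : ‖((psi1 y / y : ℝ) : ℂ)‖ ≤ (Real.log 4 + 4) * y := by
      rw [Complex.norm_real, Real.norm_eq_abs, abs_of_nonneg (div_nonneg (psi1_nonneg _) hy0.le),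
        div_le_iff₀ hy0]
      have := psi1_le y hy0.le
      nlinarith
    have hi : ‖(y:ℂ)⁻¹‖ ≤ 1 := by
      rw [norm_inv, Complex.norm_real, Real.norm_eq_abs, abs_of_pos hy0]
      exact inv_le_one_of_one_le₀ hy.le
    have n2 : ‖(y / 2 - 1 + (y:ℂ)⁻¹ / 2)‖ ≤ 2 * y := by
      have a1 : ‖(y / 2 - 1 + (y:ℂ)⁻¹ / 2)‖ ≤ ‖(y:ℂ)/2‖ + ‖(1:ℂ)‖ + ‖(y:ℂ)⁻¹ / 2‖ :=
        (norm_add_le _ _).trans (add_le_add_left (norm_sub_le _ _) _)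
      rw [norm_div, norm_div, Complex.norm_real, Real.norm_eq_abs, abs_of_pos hy0] at a1
      simp only [Complex.norm_ofNat, norm_one] at a1
      linarith
    have n3 : ‖b * (1 - (y:ℂ)⁻¹)‖ ≤ 2 * ‖b‖ * y := by
      rw [norm_mul]
      have a1 : ‖(1 - (y:ℂ)⁻¹)‖ ≤ 2 := (norm_sub_le _ _).trans (by simp only [norm_one]; linarith)
      have a2 : ‖b‖ * ‖(1 - (y:ℂ)⁻¹)‖ ≤ ‖b‖ * 2 := by gcongr
      nlinarith [norm_nonneg b]
    have n4 : ‖∑' L, zsum (D L) y‖ ≤ (∑' L, u L) * y := by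
      refine (hzt y hy.le).trans (mul_le_mul_of_nonneg_left ?_ (tsum_nonneg hu0))
      rw [Real.sqrt_le_left hy0.le]; nlinarith
    refine (norm_add_le _ _).trans ?_
    refine (add_le_add_left (norm_add_le _ _) _).trans ?_
    refine (add_le_add_left (add_le_add_left (norm_sub_le _ _) _) _).trans ?_
    linarith
  · intro s hs
    have hs0 : s ≠ 0 := by rintro rfl; simp at hs
    have hs1 : s + 1 ≠ 0 := by
      intro h; have := congrArg Complex.re h; simp at this; linarith
    have hs2 : s - 1 ≠ 0 := by
      intro h; have := congrArg Complex.re h; simp at this; linarith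
    have hs2' : s ≠ 1 := sub_ne_zero.mp hs2
    have hζ : riemannZeta s ≠ 0 := riemannZeta_ne_zero_of_one_le_re (by linarith)
    have hfs : riemannZeta₁ s = (s - 1) * riemannZeta s := by
      rw [riemannZeta_eq_inv_sub_mul hs2', mul_inv_cancel_left₀ hs2]
    have hf : riemannZeta₁ s ≠ 0 := by rw [hfs]; exact mul_ne_zero hs2 hζ
    have hld : logDeriv riemannZeta₁ s = 1 / (s - 1) + deriv riemannZeta s / riemannZeta s := by
      have hev : riemannZeta₁ =ᶠ[𝓝 s] fun z => (z - 1) * riemannZeta z := by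
        filter_upwards [isOpen_ne.mem_nhds hs2'] with z hz
        rw [riemannZeta_eq_inv_sub_mul hz, mul_inv_cancel_left₀ (sub_ne_zero.mpr hz)]
      have hd : HasDerivAt (fun z => (z - 1) * riemannZeta z)
          (1 * riemannZeta s + (s - 1) * deriv riemannZeta s) s :=
        ((hasDerivAt_id s).sub_const 1).mul (differentiableAt_riemannZeta hs2').hasDerivAt
      rw [logDeriv_apply, hev.deriv_eq, hd.deriv, hfs]
      field_simp
    have iz : ∀ L, IntegrableOn (fun x : ℝ => zsum (D L) x * (x:ℂ) ^ (-(s+1))) (Ioi 1) ∧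
        ∫ x in Ioi (1:ℝ), zsum (D L) x * (x:ℂ) ^ (-(s+1)) =
        ((D L).map fun ρ => 1 / (s - ρ) + 1 / ρ).sum / (s * (s + 1)) := fun L =>
      zsum_mellin (D L) (fun ρ hρ => ⟨(hD L ρ hρ).1, zero_ne ρ L (hD L ρ hρ)⟩) s hs
    have ib : IntegrableOn (fun x : ℝ => x ^ (-(5/2) : ℝ)) (Ioi 1) :=
      integrableOn_Ioi_rpow_of_lt (by norm_num) one_pos
    have hnorm : ∀ y : ℝ, 1 < y → √y * ‖(y:ℂ) ^ (-(s+1))‖ = y ^ (-(5/2) : ℝ) := by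
      intro y hy
      have hy0 : 0 < y := by linarith
      rw [Complex.norm_cpow_eq_rpow_re_of_pos hy0, Real.sqrt_eq_rpow, ← Real.rpow_add hy0]
      congr 1; simp [hs]; norm_num
    have hS : Summable fun L => ∫ x in Ioi (1:ℝ), ‖zsum (D L) x * (x:ℂ) ^ (-(s+1))‖ := by
      refine Summable.of_nonneg_of_le (fun n => integral_nonneg fun x => norm_nonneg _) ?_
        (hus.mul_right (∫ x in Ioi (1:ℝ), x ^ (-(5/2) : ℝ)))
      intro L
      rw [← integral_const_mul]
      refine setIntegral_mono_on (iz L).1.norm (ib.const_mul _) measurableSet_Ioi ?_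
      intro y hy
      rw [norm_mul, ← hnorm y hy, ← mul_assoc]
      exact mul_le_mul_of_nonneg_right (hzb L y (le_of_lt hy)) (norm_nonneg _)
    have key := hasSum_integral_of_summable_integral_norm (fun L => (iz L).1) hS
    have hval : ∫ x in Ioi (1:ℝ), (∑' L, zsum (D L) x) * (x:ℂ) ^ (-(s+1)) =
        (logDeriv riemannZeta₁ s - b) / (s * (s+1)) := by
      have t1 := key.tendsto_sum_nat
      simp_rw [(iz _).2, tsum_mul_right] at t1
      have t2 := (hlim s hf).div_const (s * (s+1))
      simp_rw [Finset.sum_div] at t2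
      exact tendsto_nhds_unique t1 t2
    have iZ : IntegrableOn (fun x : ℝ => (∑' L, zsum (D L) x) * (x:ℂ) ^ (-(s+1))) (Ioi 1) := by
      refine Integrable.mono' (ib.const_mul (∑' L, u L)) ?_ ?_
      · refine ContinuousOn.aestronglyMeasurable ?_ measurableSet_Ioi
        intro t ht
        have ht0 : (0:ℝ) < t := lt_trans one_pos ht
        exact ((hzc t ht).mul (Complex.continuousAt_ofReal_cpow_const _ _ (Or.inr ht0.ne'))).continuousWithinAt
      · refine (ae_restrict_iff' measurableSet_Ioi).mpr (Eventually.of_forall fun t ht => ?_)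
        rw [norm_mul, ← hnorm t ht, ← mul_assoc]
        exact mul_le_mul_of_nonneg_right (hzt t (le_of_lt ht)) (norm_nonneg _)
    have iP : IntegrableOn (fun x : ℝ => ((psi1 x / x : ℝ) : ℂ) * (x:ℂ) ^ (-(s+1))) (Ioi 1) := by
      have ic : IntegrableOn (fun x : ℝ => x ^ (-2 : ℝ)) (Ioi 1) :=
        integrableOn_Ioi_rpow_of_lt (by norm_num) one_pos
      refine Integrable.mono' (ic.const_mul (Real.log 4 + 4)) ?_ ?_
      · refine ContinuousOn.aestronglyMeasurable ?_ measurableSet_Ioi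
        intro t ht
        have ht0 : (0:ℝ) < t := lt_trans one_pos ht
        refine ContinuousAt.continuousWithinAt ?_
        refine ContinuousAt.mul ?_ (Complex.continuousAt_ofReal_cpow_const _ _ (Or.inr ht0.ne'))
        exact Complex.continuous_ofReal.continuousAt.comp
          (continuous_psi1.continuousAt.div continuousAt_id ht0.ne')
      · refine (ae_restrict_iff' measurableSet_Ioi).mpr (Eventually.of_forall fun t ht => ?_)
        have ht0 : (0:ℝ) < t := lt_trans one_pos ht
        rw [norm_mul, Complex.norm_real, Real.norm_eq_abs, abs_of_nonneg (div_nonneg (psi1_nonneg _) ht0.le),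
          Complex.norm_cpow_eq_rpow_re_of_pos ht0]
        have e : t ^ (-2:ℝ) = t * t ^ (-(s+1)).re := by
          nth_rewrite 2 [← Real.rpow_one t]
          rw [← Real.rpow_add ht0]; congr 1; simp only [Complex.neg_re, Complex.add_re, Complex.one_re, hs]; norm_num
        rw [e, ← mul_assoc]
        refine mul_le_mul_of_nonneg_right ?_ (by positivity)
        rw [div_le_iff₀ ht0]
        have := psi1_le t ht0.le
        nlinarith
    obtain ⟨i1, e1⟩ := cpow_Ioi_int (s - 1) (by simp [hs]) 1 one_pos
    obtain ⟨i2, e2⟩ := cpow_Ioi_int s (by linarith) 1 one_pos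
    obtain ⟨i3, e3⟩ := cpow_Ioi_int (s + 1) (by simp; linarith) 1 one_pos
    have hpt : ∀ x : ℝ, x ∈ Ioi (1:ℝ) → (((psi1 x / x : ℝ) : ℂ) - (x / 2 - 1 + (x:ℂ)⁻¹ / 2)
        + b * (1 - (x:ℂ)⁻¹) + ∑' L, zsum (D L) x) * (x:ℂ) ^ (-(s+1)) =
        ((((psi1 x / x : ℝ) : ℂ) * (x:ℂ) ^ (-(s+1)) + (∑' L, zsum (D L) x) * (x:ℂ) ^ (-(s+1)))
        + (-1/2) * (x:ℂ) ^ (-((s-1)+1))) + ((1 + b) * (x:ℂ) ^ (-(s+1)) + (-1/2 - b) * (x:ℂ) ^ (-((s+1)+1))) := by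
      intro x hx
      have hx0 : (x:ℂ) ≠ 0 := by
        have : (0:ℝ) < x := lt_trans one_pos hx
        exact_mod_cast this.ne'
      have c1 : (x:ℂ) ^ (-((s - 1) + 1)) = x * (x:ℂ) ^ (-(s+1)) := by
        nth_rewrite 2 [← Complex.cpow_one (x:ℂ)]
        rw [← Complex.cpow_add _ _ hx0]; congr 1; ring
      have c2 : (x:ℂ) ^ (-((s + 1) + 1)) = (x:ℂ)⁻¹ * (x:ℂ) ^ (-(s+1)) := by
        rw [← Complex.cpow_neg_one, ← Complex.cpow_add _ _ hx0]; congr 1; ring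
      rw [c1, c2]; ring
    rw [setIntegral_congr_fun measurableSet_Ioi hpt]
    have j1 : IntegrableOn (fun x : ℝ => ((psi1 x / x : ℝ) : ℂ) * (x:ℂ) ^ (-(s+1)) + (∑' L, zsum (D L) x) * (x:ℂ) ^ (-(s+1))) (Ioi 1) := iP.add iZ
    have j2 := i1.const_mul (-1/2 : ℂ)
    have j3 := i2.const_mul (1 + b)
    have j4 := i3.const_mul (-1/2 - b)
    have j5 : IntegrableOn (fun x : ℝ => (((psi1 x / x : ℝ) : ℂ) * (x:ℂ) ^ (-(s+1)) + (∑' L, zsum (D L) x) * (x:ℂ) ^ (-(s+1)))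
        + (-1/2) * (x:ℂ) ^ (-((s-1)+1))) (Ioi 1) := j1.add j2
    have j6 : IntegrableOn (fun x : ℝ => (1 + b) * (x:ℂ) ^ (-(s+1)) + (-1/2 - b) * (x:ℂ) ^ (-((s+1)+1))) (Ioi 1) := j3.add j4
    rw [integral_add j5 j6, integral_add j1 j2, integral_add iP iZ,
      integral_add j3 j4, integral_const_mul, integral_const_mul, integral_const_mul, e1, e2, e3, hval,
      psi1_mellin s hs, ArithmeticFunction.LSeries_vonMangoldt_eq_deriv_riemannZeta_div (by linarith), hld, neg_div]
    simp only [Complex.ofReal_one, Complex.one_cpow]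
    generalize deriv riemannZeta s / riemannZeta s = X
    field_simp
    ring
lemma shells_zeta (RH : ∀ s : ℂ, riemannZeta s = 0 → 0 < s.re → s.re < 1 → s.re = 1 / 2) :
    ∃ (D : ℕ → Multiset ℂ) (C : ℝ), 0 < C ∧
    (∀ L, ∀ ρ ∈ D L, ρ.re ≤ 1 / 2 ∧ 2 ^ L ≤ 2 * ‖ρ‖ ∧ ‖ρ‖ ≤ 2 * ‖ρ + 1‖) ∧
    (∀ L, (Multiset.card (D L) : ℝ) ≤ C * (L + 1) * 2 ^ L) ∧
    (∀ s, riemannZeta₁ s ≠ 0 → Filter.Tendsto (fun N : ℕ => ∑ L ∈ Finset.range N,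
        ((D L).map fun ρ => 1 / (s - ρ) + 1 / ρ).sum) Filter.atTop
        (nhds (logDeriv riemannZeta₁ s - logDeriv riemannZeta₁ 0))) := by
  obtain ⟨C, hC, hB⟩ := zeta1_growth
  obtain ⟨D, h1, h2, h3⟩ := shells riemannZeta₁ differentiable_riemannZeta₁
    (by rw [zeta1_zero]; norm_num) C hC hB
  refine ⟨D, C, hC, fun L ρ hρ => ?_, h2, h3⟩
  obtain ⟨a1, a2, a3⟩ := h1 L ρ hρ
  obtain ⟨b1, b2, b3⟩ := zeta1_zeros RH ρ a1
  refine ⟨b1, ?_, b3⟩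
  rcases a3 with rfl | h
  · simp; linarith
  · exact h.le

lemma cpow_diff (ρ : ℂ) (hρ : ρ.re ≤ 1 / 2) (hρ1 : ρ + 1 ≠ 0) (u v : ℝ) (hu : 1 < u) (huv : u ≤ v) :
    ‖(v:ℂ) ^ (ρ + 1) - (u:ℂ) ^ (ρ + 1)‖ ≤ ‖ρ + 1‖ * √v * (v - u) ∧
    ‖(v:ℂ) ^ (ρ + 1) - (u:ℂ) ^ (ρ + 1)‖ ≤ 2 * (v * √v) := by
  have hv0 : 0 < v := by linarith
  constructor
  · have := Convex.norm_image_sub_le_of_norm_hasDerivWithin_le (f := fun t : ℝ => (t:ℂ) ^ (ρ + 1))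
      (f' := fun t : ℝ => (ρ + 1) * (t:ℂ) ^ ρ) (s := Set.Icc u v) (C := ‖ρ + 1‖ * √v) ?_ ?_
      (convex_Icc u v) (Set.left_mem_Icc.mpr huv) (Set.right_mem_Icc.mpr huv)
    · rwa [Real.norm_eq_abs, abs_of_nonneg (by linarith)] at this
    · intro t ht
      have ht0 : (0:ℝ) < t := by linarith [ht.1]
      have h1 := (hasDerivAt_ofReal_cpow_const (x := t) ht0.ne' (r := ρ + 1) hρ1).hasDerivWithinAt (s := Set.Icc u v)
      rwa [add_sub_cancel_right] at h1
    · intro t ht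
      have ht0 : (0:ℝ) < t := by linarith [ht.1]
      rw [norm_mul, Complex.norm_cpow_eq_rpow_re_of_pos ht0]
      refine mul_le_mul_of_nonneg_left ?_ (norm_nonneg _)
      calc t ^ ρ.re ≤ t ^ (1/2 : ℝ) := Real.rpow_le_rpow_of_exponent_le (by linarith [ht.1]) hρ
        _ = √t := (Real.sqrt_eq_rpow t).symm
        _ ≤ √v := Real.sqrt_le_sqrt ht.2
  · have hb : ∀ t : ℝ, 1 < t → t ≤ v → ‖(t:ℂ) ^ (ρ + 1)‖ ≤ v * √v := by
      intro t ht htv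
      have ht0 : (0:ℝ) < t := by linarith
      rw [Complex.norm_cpow_eq_rpow_re_of_pos ht0]
      calc t ^ (ρ + 1).re ≤ t ^ (1 + 1/2 : ℝ) :=
            Real.rpow_le_rpow_of_exponent_le ht.le (by simp; linarith)
        _ = t * √t := by rw [Real.rpow_add ht0, Real.rpow_one, Real.sqrt_eq_rpow]
        _ ≤ v * √v := mul_le_mul htv (Real.sqrt_le_sqrt htv) (Real.sqrt_nonneg _) hv0.le
    refine (norm_sub_le _ _).trans ?_
    linarith [hb v (by linarith) le_rfl, hb u hu huv]

lemma zsum_diff (S : Multiset ℂ) (L : ℕ) (C : ℝ) (hC : 0 < C)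
    (hS : ∀ ρ ∈ S, ρ.re ≤ 1 / 2 ∧ 2 ^ L ≤ 2 * ‖ρ‖ ∧ ‖ρ‖ ≤ 2 * ‖ρ + 1‖)
    (hcard : (Multiset.card S : ℝ) ≤ C * (L + 1) * 2 ^ L) (u v : ℝ) (hu : 1 < u) (huv : u ≤ v) :
    ‖v * zsum S v - u * zsum S u‖ ≤ 2 * C * (L + 1) * (√v * (v - u)) ∧
    ‖v * zsum S v - u * zsum S u‖ ≤ 16 * C * ((L + 1) * (1/2) ^ L) * (v * √v) := by
  have h2L : (0:ℝ) < 2 ^ L := by positivity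
  have hv0 : 0 < v := by linarith
  have huv' : 0 ≤ v - u := by linarith
  have hx : ∀ x : ℝ, 1 < x → x * zsum S x = (S.map fun ρ => ((x:ℂ) ^ (ρ + 1) - 1) / (ρ * (ρ + 1))).sum := by
    intro x hx
    have hx0 : (x:ℂ) ≠ 0 := by
      have : (0:ℝ) < x := lt_trans one_pos hx
      exact_mod_cast this.ne'
    rw [zsum, ← Multiset.sum_map_mul_left]
    congr 2; ext ρ
    rw [Complex.cpow_add _ _ hx0, Complex.cpow_one]
    field_simp
  have heq : v * zsum S v - u * zsum S u =
      (S.map fun ρ => ((v:ℂ) ^ (ρ + 1) - (u:ℂ) ^ (ρ + 1)) / (ρ * (ρ + 1))).sum := by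
    rw [hx v (by linarith), hx u hu, ← Multiset.sum_map_sub]
    congr 2; ext ρ; ring
  rw [heq]
  constructor
  · refine (norm_msum_le S _ (2 * (√v * (v - u)) / 2 ^ L) ?_).trans ?_
    · intro ρ hρ
      obtain ⟨c1, c2, c3⟩ := hS ρ hρ
      obtain ⟨n0, n1⟩ := zero_ne ρ L (hS ρ hρ)
      have h1 := (cpow_diff ρ c1 n1 u v hu huv).1
      have p0 : 0 < ‖ρ‖ := norm_pos_iff.mpr n0
      have p1 : 0 < ‖ρ + 1‖ := norm_pos_iff.mpr n1
      rw [norm_div, norm_mul]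
      calc _ ≤ (‖ρ + 1‖ * √v * (v - u)) / (‖ρ‖ * ‖ρ + 1‖) := by gcongr
        _ = (√v * (v - u)) / ‖ρ‖ := by field_simp
        _ ≤ (√v * (v - u)) / (2 ^ L / 2) := by
          apply div_le_div_of_nonneg_left (by positivity) (by positivity); linarith
        _ = _ := by field_simp
    · calc _ ≤ (C * (L + 1) * 2 ^ L) * (2 * (√v * (v - u)) / 2 ^ L) := by gcongr
        _ = _ := by field_simp
  · refine (norm_msum_le S _ (16 * (v * √v) / (2 ^ L) ^ 2) ?_).trans ?_
    · intro ρ hρ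
      have h1 := zero_den ρ L (hS ρ hρ)
      have h2 := (cpow_diff ρ (hS ρ hρ).1 (zero_ne ρ L (hS ρ hρ)).2 u v hu huv).2
      rw [norm_div]
      calc _ ≤ (2 * (v * √v)) / ((2 ^ L) ^ 2 / 8) := by gcongr
        _ = _ := by field_simp; ring
    · calc _ ≤ (C * (L + 1) * 2 ^ L) * (16 * (v * √v) / (2 ^ L) ^ 2) := by gcongr
        _ = _ := by rw [one_div, inv_pow]; field_simp

lemma zsum_total (D : ℕ → Multiset ℂ) (C : ℝ) (hC : 0 < C)
    (hD : ∀ L, ∀ ρ ∈ D L, ρ.re ≤ 1 / 2 ∧ 2 ^ L ≤ 2 * ‖ρ‖ ∧ ‖ρ‖ ≤ 2 * ‖ρ + 1‖)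
    (hcard : ∀ L, (Multiset.card (D L) : ℝ) ≤ C * (L + 1) * 2 ^ L) :
    ∃ C1 : ℝ, 0 < C1 ∧ ∀ x u v : ℝ, 4 ≤ x → 1 < u → v - u = √x → v ≤ 2 * x →
      ‖v * ∑' L, zsum (D L) v - u * ∑' L, zsum (D L) u‖ ≤ C1 * x * (Real.log x) ^ 2 := by
  set w : ℕ → ℝ := fun L => ((L:ℝ) + 1) * (1/2) ^ L with hw
  have hws : Summable w := summable_shell
  have hw0 : ∀ L, 0 ≤ w L := fun L => by positivity
  set T := ∑' L, w L with hT
  have hT0 : 0 ≤ T := tsum_nonneg hw0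
  refine ⟨(4 * C + 128 * C * T) * 4, by positivity, fun x u v hx hu hvu hv => ?_⟩
  have hx0 : 0 < x := by linarith
  have hsx : 0 < √x := Real.sqrt_pos.mpr hx0
  have huv : u ≤ v := by linarith
  have hv0 : 0 < v := by linarith
  have hsum : ∀ y : ℝ, 1 ≤ y → Summable fun L => zsum (D L) y := by
    intro y hy
    refine Summable.of_norm_bounded ((hws.mul_left (16 * C)).mul_right (√y)) fun L => ?_
    exact zsum_bound (D L) L C hC (hD L) (hcard L) y hy
  have sv := (hsum v (by linarith)).mul_left (v:ℂ)
  have su := (hsum u hu.le).mul_left (u:ℂ)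
  rw [← tsum_mul_left, ← tsum_mul_left, ← sv.tsum_sub su]
  have hsd := sv.sub su
  obtain ⟨K, hK1, hK2⟩ := exists_nat_pow_near (Real.one_le_sqrt.mpr (by linarith : 1 ≤ x)) (by norm_num : (1:ℝ) < 2)
  have hd := fun L => zsum_diff (D L) L C hC (hD L) (hcard L) u v hu huv
  rw [← hsd.sum_add_tsum_nat_add K]
  have hsvx : √v ≤ 2 * √x := by
    rw [Real.sqrt_le_left (by positivity), mul_pow, Real.sq_sqrt hx0.le]; linarith
  have first : ‖∑ L ∈ Finset.range K, (v * zsum (D L) v - u * zsum (D L) u)‖ ≤ 4 * C * x * ((K:ℝ) + 1) ^ 2 := by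
    have hterm : ∀ L ∈ Finset.range K, ‖v * zsum (D L) v - u * zsum (D L) u‖ ≤ 4 * C * x * ((K:ℝ) + 1) := by
      intro L hL
      have hLK : (L:ℝ) ≤ K := by exact_mod_cast (Finset.mem_range.mp hL).le
      refine (hd L).1.trans ?_
      rw [hvu]
      have a1 : √v * √x ≤ 2 * x := by
        calc √v * √x ≤ 2 * √x * √x := by gcongr
          _ = 2 * x := by rw [mul_assoc, Real.mul_self_sqrt hx0.le]
      calc 2 * C * (L + 1) * (√v * √x) ≤ 2 * C * (K + 1) * (2 * x) := by gcongr
        _ = _ := by ring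
    refine (norm_sum_le_of_le _ hterm).trans ?_
    rw [Finset.sum_const, Finset.card_range, nsmul_eq_mul]
    have : 0 ≤ 4 * C * x * ((K:ℝ) + 1) := by positivity
    nlinarith
  have second : ‖∑' L, (v * zsum (D (L + K)) v - u * zsum (D (L + K)) u)‖ ≤ 128 * C * T * x * ((K:ℝ) + 1) := by
    have hvv : (1/2:ℝ) ^ K * (v * √v) ≤ 8 * x := by
      have b1 : (1/2:ℝ) ^ K ≤ 2 / √x := by
        rw [one_div, inv_pow, le_div_iff₀ hsx, inv_mul_le_iff₀ (by positivity)]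
        rw [pow_succ] at hK2; linarith
      calc (1/2:ℝ) ^ K * (v * √v) ≤ 2 / √x * ((2 * x) * (2 * √x)) := by gcongr
        _ = 8 * x := by field_simp; ring
    have hbd : ∀ L, ‖v * zsum (D (L + K)) v - u * zsum (D (L + K)) u‖ ≤ w L * (128 * C * x * (K + 1)) := by
      intro L
      refine (hd (L + K)).2.trans ?_
      push_cast
      have c1 : ((L:ℝ) + K + 1) ≤ (L + 1) * (K + 1) := by
        nlinarith [(by positivity : (0:ℝ) ≤ L * K)]
      calc 16 * C * (((L:ℝ) + K + 1) * (1/2) ^ (L + K)) * (v * √v)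
          = 16 * C * ((L:ℝ) + K + 1) * (1/2) ^ L * ((1/2) ^ K * (v * √v)) := by rw [pow_add]; ring
        _ ≤ 16 * C * ((L + 1) * (K + 1)) * (1/2) ^ L * (8 * x) := by gcongr
        _ = _ := by rw [hw]; ring
    refine (tsum_of_norm_bounded (hws.mul_right _).hasSum hbd).trans (le_of_eq ?_)
    rw [tsum_mul_right]; ring
  have hlog1 : 1 ≤ Real.log x := by
    rw [Real.le_log_iff_exp_le hx0]; linarith [Real.exp_one_lt_d9]
  have hKlog : (K:ℝ) ≤ Real.log x := by
    have := Real.log_le_log (by positivity) hK1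
    rw [Real.log_pow, Real.log_sqrt hx0.le] at this
    nlinarith [Real.log_two_gt_d9, (Nat.cast_nonneg K : (0:ℝ) ≤ K)]
  have hK0 : (0:ℝ) ≤ K := Nat.cast_nonneg K
  refine (norm_add_le _ _).trans ((add_le_add first second).trans ?_)
  have d1 : ((K:ℝ) + 1) ^ 2 ≤ 4 * Real.log x ^ 2 := by nlinarith
  have d2 : ((K:ℝ) + 1) ≤ 4 * Real.log x ^ 2 := by nlinarith
  calc _ ≤ 4 * C * x * (4 * Real.log x ^ 2) + 128 * C * T * x * (4 * Real.log x ^ 2) := by gcongr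
    _ = _ := by ring

lemma psi_bound (RH : ∀ s : ℂ, riemannZeta s = 0 → 0 < s.re → s.re < 1 → s.re = 1 / 2) :
    ∃ C : ℝ, 0 < C ∧ ∀ x : ℝ, 2 ≤ x → |Chebyshev.psi x - x| ≤ C * √x * (Real.log x) ^ 2 := by
  obtain ⟨D, C, hC, hD, hcard, hlim⟩ := shells_zeta RH
  obtain ⟨C1, hC1, hW⟩ := zsum_total D C hC hD hcard
  set b := logDeriv riemannZeta₁ 0 with hb
  have hef : ∀ x : ℝ, 1 < x → (psi1 x : ℂ) = x ^ 2 / 2 - x + 1 / 2 - b * (x - 1) - x * ∑' L, zsum (D L) x := by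
    intro x hx
    have hx0 : (x:ℂ) ≠ 0 := by
      have : (0:ℝ) < x := lt_trans one_pos hx
      exact_mod_cast this.ne'
    have h := explicit_formula D C hC hD hcard hlim x hx
    push_cast at h
    rw [← hb] at h
    have h2 := congrArg (fun z => (x:ℂ) * z) h
    simp only [mul_zero] at h2
    have e : (x:ℂ) * ((psi1 x : ℂ) / x - (x / 2 - 1 + (x:ℂ)⁻¹ / 2) + b * (1 - (x:ℂ)⁻¹) + ∑' L, zsum (D L) x)
      = psi1 x - (x ^ 2 / 2 - x + 1 / 2) + b * (x - 1) + x * ∑' L, zsum (D L) x := by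
      field_simp
    rw [e] at h2
    linear_combination h2
  have hdiff : ∀ x u v : ℝ, 4 ≤ x → 1 < u → v - u = √x → v ≤ 2 * x →
      |psi1 v - psi1 u - (v ^ 2 - u ^ 2) / 2| ≤ (1 + ‖b‖) * √x + C1 * x * (Real.log x) ^ 2 := by
    intro x u v hx hu hvu hv
    have hsx : 0 ≤ √x := Real.sqrt_nonneg x
    have h := hW x u v hx hu hvu hv
    rw [← Real.norm_eq_abs, ← Complex.norm_real]
    have e : ((psi1 v - psi1 u - (v ^ 2 - u ^ 2) / 2 : ℝ) : ℂ) = -((1 + b) * ((√x : ℝ) : ℂ)) -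
        (v * ∑' L, zsum (D L) v - u * ∑' L, zsum (D L) u) := by
      rw [← hvu]; push_cast
      rw [hef v (by linarith), hef u hu]; ring
    rw [e]
    refine (norm_sub_le _ _).trans (add_le_add ?_ h)
    rw [norm_neg, norm_mul, Complex.norm_real, Real.norm_eq_abs, abs_of_nonneg hsx]
    refine mul_le_mul_of_nonneg_right ((norm_add_le _ _).trans ?_) hsx
    simp
  refine ⟨120 + ‖b‖ + C1, by positivity, fun x hx => ?_⟩
  have hx0 : 0 < x := by linarith
  have hs1 : 1 ≤ √x := Real.one_le_sqrt.mpr (by linarith)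
  have hpsi0 := Chebyshev.psi_nonneg x
  by_cases hx4 : x < 4
  · have h1 := Chebyshev.psi_le_const_mul_self hx0.le
    have hl4 : Real.log 4 ≤ 2 := by
      rw [show (4:ℝ) = 2 ^ 2 by norm_num, Real.log_pow]; push_cast; linarith [Real.log_two_lt_d9]
    have h2 : Chebyshev.psi x ≤ 24 := by nlinarith
    have hl : 0.69 ≤ Real.log x := by
      have := Real.log_le_log (by norm_num) hx; linarith [Real.log_two_gt_d9]
    have hl2 : 0.2 ≤ Real.log x ^ 2 := by nlinarith
    have h3 : |Chebyshev.psi x - x| ≤ 24 := by rw [abs_le]; constructor <;> linarith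
    have h4 : (24:ℝ) ≤ 120 * 1 * 0.2 := by norm_num
    refine h3.trans (h4.trans ?_)
    gcongr
    linarith [norm_nonneg b]
  push Not at hx4
  have hlog1 : 1 ≤ Real.log x := by
    rw [Real.le_log_iff_exp_le hx0]; linarith [Real.exp_one_lt_d9]
  have hss : √x * √x = x := Real.mul_self_sqrt hx0.le
  have hs2 : 2 ≤ √x := Real.le_sqrt_of_sq_le (by norm_num; linarith)
  have hsx0 : 0 < √x := by linarith
  have hA := hdiff x x (x + √x) hx4 (by linarith) (by ring) (by nlinarith)
  have hB := hdiff x (x - √x) x hx4 (by nlinarith) (by ring) (by linarith)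
  have hA2 := (psi1_sub x (x + √x) hx0.le (by linarith)).1
  have hB2 := (psi1_sub (x - √x) x (by nlinarith) (by linarith)).2
  rw [abs_le] at hA hB
  have hl2 : 1 ≤ Real.log x ^ 2 := by nlinarith
  have hfin : (1 + ‖b‖) * √x + C1 * x * (Real.log x) ^ 2 + x / 2
      ≤ √x * ((120 + ‖b‖ + C1) * √x * (Real.log x) ^ 2) := by
    have e : √x * ((120 + ‖b‖ + C1) * √x * (Real.log x) ^ 2) = (120 + ‖b‖) * (x * Real.log x ^ 2) + C1 * x * Real.log x ^ 2 := by
      have e2 : √x * ((120 + ‖b‖ + C1) * √x * (Real.log x) ^ 2) = (120 + ‖b‖ + C1) * (√x * √x) * (Real.log x) ^ 2 := by ring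
      rw [e2, hss]; ring
    rw [e]
    have g1 : √x ≤ x * Real.log x ^ 2 := by nlinarith
    have g2 : x ≤ x * Real.log x ^ 2 := by nlinarith
    have g3 : ‖b‖ * √x ≤ ‖b‖ * (x * Real.log x ^ 2) := mul_le_mul_of_nonneg_left g1 (norm_nonneg b)
    linarith
  have hsq : √x ^ 2 = x := Real.sq_sqrt hx0.le
  rw [abs_le]
  constructor
  · refine le_of_mul_le_mul_left ?_ hsx0
    nlinarith
  · refine le_of_mul_le_mul_left ?_ hsx0
    nlinarith

lemma li_parts (x : ℝ) (hx : 2 ≤ x) :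
    ∫ t in (2:ℝ)..x, 1 / Real.log t =
      x / Real.log x - 2 / Real.log 2 + ∫ t in (2:ℝ)..x, 1 / Real.log t ^ 2 := by
  have hmem : ∀ t ∈ Set.uIcc 2 x, 2 ≤ t := by
    intro t ht; rw [Set.uIcc_of_le hx] at ht; exact ht.1
  have hlog : ∀ t : ℝ, 2 ≤ t → Real.log t ≠ 0 := fun t ht => (Real.log_pos (by linarith)).ne'
  have hc : ContinuousOn Real.log (Set.uIcc 2 x) := by
    intro t ht
    exact (Real.continuousAt_log (by linarith [hmem t ht])).continuousWithinAt
  have i1 : IntervalIntegrable (fun t => 1 / Real.log t) MeasureTheory.volume 2 x :=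
    (continuousOn_const.div hc fun t ht => hlog t (hmem t ht)).intervalIntegrable
  have i2 : IntervalIntegrable (fun t => 1 / Real.log t ^ 2) MeasureTheory.volume 2 x :=
    (continuousOn_const.div (hc.pow 2) fun t ht => pow_ne_zero 2 (hlog t (hmem t ht))).intervalIntegrable
  have h := intervalIntegral.integral_eq_sub_of_hasDerivAt (a := 2) (b := x)
    (f := fun t => t / Real.log t) (f' := fun t => 1 / Real.log t - 1 / Real.log t ^ 2) ?_ (i1.sub i2)
  · rw [intervalIntegral.integral_sub i1 i2] at h
    linarith
  · intro t ht
    have h2 := hmem t ht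
    have := (hasDerivAt_id t).div (Real.hasDerivAt_log (by linarith : t ≠ 0)) (hlog t h2)
    refine this.congr_deriv ?_
    have := hlog t h2
    have ht0 : t ≠ 0 := by linarith
    simp only [id]
    field_simp

lemma primePi_eq (x : ℝ) : primePi x = (Nat.primeCounting ⌊x⌋₊ : ℝ) := by
  rw [primePi, Nat.primeCounting, Nat.primeCounting', Nat.count_eq_card_filter_range]

lemma final_bound (C : ℝ) (hC : 0 < C)
    (h : ∀ x : ℝ, 2 ≤ x → |Chebyshev.psi x - x| ≤ C * √x * (Real.log x) ^ 2) :
    ∃ C : ℝ, 0 < C ∧ ∀ x : ℝ, 2 ≤ x →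
      |primePi x - li x| ≤ C * Real.sqrt x * Real.log x := by
  have hlg : ∀ x : ℝ, 2 ≤ x → 0.69 ≤ Real.log x := by
    intro x hx
    have := Real.log_le_log (by norm_num) hx; linarith [Real.log_two_gt_d9]
  have hth : ∀ x : ℝ, 2 ≤ x → |Chebyshev.theta x - x| ≤ (C + 3) * √x * (Real.log x) ^ 2 := by
    intro x hx
    have h1 := h x hx
    have h2 := Chebyshev.abs_psi_sub_theta_le_sqrt_mul_log (x := x) (by linarith)
    have h3 : 2 * √x * Real.log x ≤ 3 * √x * Real.log x ^ 2 := by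
      have := hlg x hx
      have : 2 * Real.log x ≤ 3 * Real.log x ^ 2 := by nlinarith
      have := mul_le_mul_of_nonneg_left this (Real.sqrt_nonneg x)
      linarith
    rw [abs_le] at *
    constructor <;> linarith
  refine ⟨(C + 3) + 5 + 4 * (C + 3), by positivity, fun x hx => ?_⟩
  have hl := hlg x hx
  have hs1 : 1 ≤ √x := Real.one_le_sqrt.mpr (by linarith)
  have hmem : ∀ t ∈ Set.uIcc 2 x, 2 ≤ t := by
    intro t ht; rw [Set.uIcc_of_le hx] at ht; exact ht.1
  have i1 : IntervalIntegrable (fun t => Chebyshev.theta t / (t * Real.log t ^ 2)) MeasureTheory.volume 2 x := by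
    rw [intervalIntegrable_iff_integrableOn_Icc_of_le hx]
    exact Chebyshev.integrableOn_theta_div_id_mul_log_sq x
  have hc : ContinuousOn Real.log (Set.uIcc 2 x) := by
    intro t ht
    exact (Real.continuousAt_log (by linarith [hmem t ht])).continuousWithinAt
  have i2 : IntervalIntegrable (fun t => 1 / Real.log t ^ 2) MeasureTheory.volume 2 x :=
    (continuousOn_const.div (hc.pow 2) fun t ht => pow_ne_zero 2
      (by linarith [hlg t (hmem t ht)])).intervalIntegrable
  have e : primePi x - li x = (Chebyshev.theta x - x) / Real.log x + 2 / Real.log 2 +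
      ∫ t in (2:ℝ)..x, (Chebyshev.theta t / (t * Real.log t ^ 2) - 1 / Real.log t ^ 2) := by
    rw [primePi_eq, Chebyshev.primeCounting_eq_theta_div_log_add_integral hx, li, li_parts x hx,
      intervalIntegral.integral_sub i1 i2]
    ring
  have b1 : |(Chebyshev.theta x - x) / Real.log x| ≤ (C + 3) * (√x * Real.log x) := by
    rw [abs_div, abs_of_pos (by linarith : 0 < Real.log x), div_le_iff₀ (by linarith)]
    have := hth x hx
    linarith
  have hsl : 0.69 ≤ √x * Real.log x := by nlinarith
  have b2 : |2 / Real.log 2| ≤ 5 * (√x * Real.log x) := by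
    have := hlg 2 le_rfl
    rw [abs_of_pos (by positivity), div_le_iff₀ (by linarith)]
    nlinarith
  have hd : ∀ t ∈ Set.uIcc 2 x, HasDerivAt (fun t => (C + 3) * (2 * √t)) ((C + 3) * (1 / √t)) t := by
    intro t ht
    have h2 := hmem t ht
    have := ((Real.hasDerivAt_sqrt (by linarith : t ≠ 0)).const_mul 2).const_mul (C + 3)
    refine this.congr_deriv ?_
    have : √t ≠ 0 := (Real.sqrt_pos.mpr (by linarith)).ne'
    field_simp
  have i3 : IntervalIntegrable (fun t => (C + 3) * (1 / √t)) MeasureTheory.volume 2 x :=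
    (continuousOn_const.mul (continuousOn_const.div Real.continuous_sqrt.continuousOn
      fun t ht => (Real.sqrt_pos.mpr (by linarith [hmem t ht])).ne')).intervalIntegrable
  have b3 : |∫ t in (2:ℝ)..x, (Chebyshev.theta t / (t * Real.log t ^ 2) - 1 / Real.log t ^ 2)|
      ≤ 4 * (C + 3) * (√x * Real.log x) := by
    have h1 : ‖∫ t in (2:ℝ)..x, (Chebyshev.theta t / (t * Real.log t ^ 2) - 1 / Real.log t ^ 2)‖
        ≤ ∫ t in (2:ℝ)..x, (C + 3) * (1 / √t) := by
      refine intervalIntegral.norm_integral_le_of_norm_le hx ?_ i3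
      refine Filter.Eventually.of_forall fun t ht => ?_
      have ht2 : 2 ≤ t := ht.1.le
      have hlt := hlg t ht2
      have ht0 : 0 < t := by linarith
      have hst : 0 < √t := Real.sqrt_pos.mpr ht0
      have e1 : Chebyshev.theta t / (t * Real.log t ^ 2) - 1 / Real.log t ^ 2
          = (Chebyshev.theta t - t) / (t * Real.log t ^ 2) := by
        have : Real.log t ≠ 0 := by linarith
        field_simp
      have hlp : 0 < Real.log t := by linarith
      rw [e1, Real.norm_eq_abs, abs_div, abs_of_pos (by positivity : 0 < t * Real.log t ^ 2),
        div_le_iff₀ (by positivity)]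
      refine (hth t ht2).trans (le_of_eq ?_)
      have e3 : t / √t = √t := Real.div_sqrt
      calc (C + 3) * √t * Real.log t ^ 2 = (C + 3) * (t / √t) * Real.log t ^ 2 := by rw [e3]
        _ = _ := by ring
    rw [intervalIntegral.integral_eq_sub_of_hasDerivAt hd i3, Real.norm_eq_abs] at h1
    have : 0 ≤ √(2:ℝ) := Real.sqrt_nonneg 2
    have g : (C + 3) * (2 * √x) ≤ 4 * (C + 3) * (√x * Real.log x) := by
      have : 2 * √x ≤ 4 * (√x * Real.log x) := by nlinarith
      have := mul_le_mul_of_nonneg_left this (by linarith : 0 ≤ C + 3)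
      linarith
    have g2 : 0 ≤ (C + 3) * (2 * √(2:ℝ)) := by positivity
    linarith
  rw [e]
  refine (abs_add_le _ _).trans ?_
  have := abs_add_le ((Chebyshev.theta x - x) / Real.log x) (2 / Real.log 2)
  linarith

/-- Assuming the Riemann Hypothesis (every zero of `ζ` with real part strictly
between `0` and `1` has real part `1/2`), there is a constant `C > 0` with
`|π(x) - li(x)| ≤ C √x log x` for all `x ≥ 2`. -/
theorem rh_implies_primePi_error_bound
    (RH : ∀ s : ℂ, riemannZeta s = 0 → 0 < s.re → s.re < 1 → s.re = 1 / 2) :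
    ∃ C : ℝ, 0 < C ∧ ∀ x : ℝ, 2 ≤ x →
      |primePi x - li x| ≤ C * Real.sqrt x * Real.log x := by
  obtain ⟨C, hC, h⟩ := psi_bound RH
  exact final_bound C hC h
end

section
/- Conversely, if there exists a constant C > 0 such that |π(x) - li(x)| ≤ C √x log x for all real x ≥ 2, then the Riemann Hypothesis holds; that is, the bound π(x) = li(x) + O(√x log x) implies RH. -/
section AuxSec

open Complex Set Filter Topology MeasureTheory Asymptotics

lemma aux_mellin_ind (g : ℝ → ℂ) (z : ℂ) :
    mellin ((Ioi (2:ℝ)).indicator g) z = ∫ t in Ioi (2:ℝ), (t:ℂ) ^ (z - 1) * g t := by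
  unfold mellin
  have : (fun t : ℝ => (t:ℂ) ^ (z - 1) • (Ioi (2:ℝ)).indicator g t)
      = (Ioi (2:ℝ)).indicator (fun t : ℝ => (t:ℂ) ^ (z - 1) * g t) := by
    ext t
    by_cases ht : t ∈ Ioi (2:ℝ) <;> simp [ht]
  rw [this, setIntegral_indicator measurableSet_Ioi]
  congr 2
  ext t
  simp only [mem_inter_iff, mem_Ioi]
  constructor
  · exact fun h => h.2
  · exact fun h => ⟨by linarith, h⟩

lemma aux_conv_ind (g : ℝ → ℂ) (z : ℂ) (h : MellinConvergent ((Ioi (2:ℝ)).indicator g) z) :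
    IntegrableOn (fun t : ℝ => (t:ℂ) ^ (z - 1) * g t) (Ioi (2:ℝ)) := by
  unfold MellinConvergent at h
  have h2 := h.mono_set (s := Ioi (2:ℝ)) (fun t ht => by simp only [mem_Ioi] at *; linarith)
  refine h2.congr_fun (fun t ht => ?_) measurableSet_Ioi
  simp [indicator_of_mem ht]

lemma aux_bigO_zero (g : ℝ → ℂ) (b : ℝ) :
    ((Ioi (2:ℝ)).indicator g) =O[𝓝[>] 0] (fun t : ℝ => t ^ (-b)) := by
  have : ((Ioi (2:ℝ)).indicator g) =ᶠ[𝓝[>] 0] (fun _ => (0:ℂ)) := by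
    have h2 : ∀ᶠ t : ℝ in 𝓝[>] 0, t < 2 :=
      (eventually_lt_nhds (by norm_num : (0:ℝ) < 2)).filter_mono nhdsWithin_le_nhds
    filter_upwards [h2] with t ht
    exact indicator_of_notMem (by simp only [mem_Ioi]; linarith) _
  exact this.trans_isBigO (isBigO_zero _ _)

lemma aux_locint (g h : ℝ → ℝ) (hh : LocallyIntegrable h) (heq : EqOn g h (Ioi 2)) :
    LocallyIntegrableOn ((Ioi (2:ℝ)).indicator (fun t => (g t : ℂ))) (Ioi 0) := by
  have h1 : LocallyIntegrable (fun t => (h t : ℂ)) := by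
    intro x
    obtain ⟨U, hU, hi⟩ := hh x
    exact ⟨U, hU, hi.ofReal⟩
  have h2 := h1.indicator (measurableSet_Ioi (a := (2:ℝ)))
  have h3 : (Ioi (2:ℝ)).indicator (fun t => (g t : ℂ)) = (Ioi (2:ℝ)).indicator (fun t => (h t : ℂ)) :=
    indicator_congr (fun t ht => by rw [heq ht])
  rw [h3]
  exact h2.locallyIntegrableOn _

lemma aux_primePi_mono : Monotone primePi := by
  intro x y hxy
  unfold primePi
  gcongr

lemma aux_cont_invlog : Continuous (fun t : ℝ => 1 / Real.log (max t 2)) := by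
  refine continuous_const.div ?_ ?_
  · refine Continuous.log (by fun_prop) ?_
    intro x
    have : (2:ℝ) ≤ max x 2 := le_max_right _ _
    linarith
  · intro x
    have : (2:ℝ) ≤ max x 2 := le_max_right _ _
    exact (Real.log_pos (by linarith)).ne'

noncomputable def auxL (x : ℝ) : ℝ := ∫ t in (2:ℝ)..x, 1 / Real.log (max t 2)

lemma aux_li_eq (x : ℝ) (hx : 2 ≤ x) : li x = auxL x := by
  unfold li auxL
  refine intervalIntegral.integral_congr (fun t ht => ?_)
  rw [uIcc_of_le hx] at ht
  simp only [max_eq_left ht.1]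

lemma auxL_deriv (x : ℝ) : HasDerivAt auxL (1 / Real.log (max x 2)) x :=
  aux_cont_invlog.integral_hasStrictDerivAt 2 x |>.hasDerivAt

lemma auxL_cont : Continuous auxL :=
  continuous_iff_continuousAt.2 fun x => (auxL_deriv x).continuousAt

lemma auxL_bound (x : ℝ) (hx : 2 ≤ x) : |auxL x| ≤ 1 / Real.log 2 * x := by
  have h2 : 0 < Real.log 2 := Real.log_pos (by norm_num)
  have := intervalIntegral.norm_integral_le_of_norm_le_const (a := (2:ℝ)) (b := x)
    (f := fun t : ℝ => 1 / Real.log (max t 2)) (C := 1 / Real.log 2) (by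
      intro t ht
      have h3 : (2:ℝ) ≤ max t 2 := le_max_right _ _
      have h4 : Real.log 2 ≤ Real.log (max t 2) := Real.log_le_log (by norm_num) h3
      rw [Real.norm_of_nonneg (one_div_nonneg.2 (by linarith))]
      gcongr)
  rw [Real.norm_eq_abs, abs_of_nonneg (by linarith : 0 ≤ x - 2)] at this
  refine this.trans ?_
  gcongr
  linarith

lemma aux_pi_bound (x : ℝ) (hx : 0 ≤ x) : |primePi x| ≤ x := by
  unfold primePi
  rw [abs_of_nonneg (by positivity)]
  have h1 : ((Finset.range (⌊x⌋₊ + 1)).filter Nat.Prime) ⊆ Finset.Icc 1 ⌊x⌋₊ := by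
    intro p hp
    simp only [Finset.mem_filter, Finset.mem_range] at hp
    simp only [Finset.mem_Icc]
    exact ⟨hp.2.one_lt.le, by omega⟩
  have h2 := Finset.card_le_card h1
  rw [Nat.card_Icc, Nat.add_sub_cancel] at h2
  calc _ ≤ (⌊x⌋₊ : ℝ) := by exact_mod_cast h2
    _ ≤ x := Nat.floor_le hx

noncomputable def fP : ℝ → ℂ := (Ioi (2:ℝ)).indicator (fun t => (primePi t : ℂ))
noncomputable def fL : ℝ → ℂ := (Ioi (2:ℝ)).indicator (fun t => (li t : ℂ))
noncomputable def fE : ℝ → ℂ := (Ioi (2:ℝ)).indicator (fun t => ((primePi t - li t : ℝ) : ℂ))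
noncomputable def fG : ℝ → ℂ := (Ioi (2:ℝ)).indicator (fun t => ((1 / Real.log t : ℝ) : ℂ))

lemma fP_loc : LocallyIntegrableOn fP (Ioi 0) :=
  aux_locint _ _ aux_primePi_mono.locallyIntegrable (fun _ _ => rfl)
lemma fL_loc : LocallyIntegrableOn fL (Ioi 0) :=
  aux_locint _ _ auxL_cont.locallyIntegrable (fun t ht => aux_li_eq t (le_of_lt ht))
lemma fE_loc : LocallyIntegrableOn fE (Ioi 0) :=
  aux_locint _ _ (aux_primePi_mono.locallyIntegrable.sub auxL_cont.locallyIntegrable)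
    (fun t ht => by simp [aux_li_eq t (le_of_lt ht)])
lemma fG_loc : LocallyIntegrableOn fG (Ioi 0) :=
  aux_locint _ _ aux_cont_invlog.locallyIntegrable
    (fun t ht => by simp only [max_eq_left (le_of_lt (mem_Ioi.1 ht))])

lemma aux_bigO_top (g : ℝ → ℝ) (a C : ℝ) (h : ∀ t : ℝ, 2 < t → |g t| ≤ C * t ^ a) :
    ((Ioi (2:ℝ)).indicator (fun t => (g t : ℂ))) =O[atTop] (fun t : ℝ => t ^ (- -a)) := by
  refine IsBigO.of_bound C ?_
  filter_upwards [eventually_gt_atTop 2] with t ht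
  rw [indicator_of_mem (mem_Ioi.2 ht), Complex.norm_real, Real.norm_eq_abs, neg_neg,
    Real.norm_of_nonneg (by positivity)]
  exact h t ht

lemma fP_top : fP =O[atTop] (fun t : ℝ => t ^ (- -(1:ℝ))) :=
  aux_bigO_top _ 1 1 (fun t ht => by simpa using aux_pi_bound t (by linarith))
lemma fL_top : fL =O[atTop] (fun t : ℝ => t ^ (- -(1:ℝ))) :=
  aux_bigO_top _ 1 (1 / Real.log 2) (fun t ht => by
    rw [aux_li_eq t ht.le, Real.rpow_one]; exact auxL_bound t ht.le)
lemma fG_top : fG =O[atTop] (fun t : ℝ => t ^ (- -(0:ℝ))) :=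
  aux_bigO_top _ 0 (1 / Real.log 2) (fun t ht => by
    have h2 : 0 < Real.log 2 := Real.log_pos (by norm_num)
    have h4 : Real.log 2 ≤ Real.log t := Real.log_le_log (by norm_num) ht.le
    rw [Real.rpow_zero, mul_one, abs_of_nonneg (one_div_nonneg.2 (by linarith))]
    gcongr)

lemma fE_top {C : ℝ} (hC : 0 < C) (h : ∀ x : ℝ, 2 ≤ x →
      |primePi x - li x| ≤ C * Real.sqrt x * Real.log x) {e : ℝ} (he : 0 < e) :
    fE =O[atTop] (fun t : ℝ => t ^ (- -(1/2 + e))) :=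
  aux_bigO_top _ _ (C / e) (fun t ht => by
    refine (h t ht.le).trans ?_
    have h1 := Real.log_le_rpow_div (by linarith : 0 ≤ t) he
    rw [Real.rpow_add (by linarith), ← Real.sqrt_eq_rpow]
    calc C * Real.sqrt t * Real.log t ≤ C * Real.sqrt t * (t ^ e / e) := by gcongr
      _ = _ := by field_simp)

lemma fE_diff {C : ℝ} (hC : 0 < C) (h : ∀ x : ℝ, 2 ≤ x →
      |primePi x - li x| ≤ C * Real.sqrt x * Real.log x) {s : ℂ} (hs : 1/2 < s.re) :
    DifferentiableAt ℂ (fun s => mellin fE (-s)) s := by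
  have := mellin_differentiableAt_of_isBigO_rpow (s := -s) fE_loc
    (fE_top hC h (e := (s.re - 1/2)/2) (by linarith)) (by rw [neg_re]; linarith)
    (aux_bigO_zero _ (-s.re - 1)) (by rw [neg_re]; linarith)
  exact DifferentiableAt.comp s (f := fun s : ℂ => -s) this (by fun_prop)

lemma fP_conv {s : ℂ} (hs : 1 < s.re) : MellinConvergent fP (-s) :=
  mellinConvergent_of_isBigO_rpow fP_loc fP_top (by rw [neg_re]; linarith)
    (aux_bigO_zero _ (-s.re - 1)) (by rw [neg_re]; linarith)
lemma fL_conv {s : ℂ} (hs : 1 < s.re) : MellinConvergent fL (-s) :=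
  mellinConvergent_of_isBigO_rpow fL_loc fL_top (by rw [neg_re]; linarith)
    (aux_bigO_zero _ (-s.re - 1)) (by rw [neg_re]; linarith)
lemma fG_conv {s : ℂ} (hs : 1 < s.re) : MellinConvergent fG (1-s) :=
  mellinConvergent_of_isBigO_rpow fG_loc fG_top (by simp; linarith)
    (aux_bigO_zero _ (-s.re - 1)) (by simp; linarith)

lemma fE_eq {s : ℂ} (hs : 1 < s.re) : mellin fP (-s) = mellin fE (-s) + mellin fL (-s) := by
  have h1 : fE = fun t => fP t - fL t := by
    ext t
    unfold fE fP fL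
    by_cases ht : t ∈ Ioi (2:ℝ) <;> simp [ht]
  have := ((hasMellin_sub (fP_conv hs) (fL_conv hs))).2
  rw [h1, this]
  ring

noncomputable def fH (s : ℂ) : ℂ := mellin fG (1 - s)

lemma fH_deriv {s : ℂ} (hs : 1 < s.re) :
    HasDerivAt fH (- ((2:ℂ) ^ (1 - s) / (s - 1))) s := by
  have h1 := (mellin_hasDerivAt_of_isBigO_rpow (s := 1 - s) fG_loc fG_top (by simp; linarith)
    (aux_bigO_zero _ (-s.re - 1)) (by simp; linarith)).2
  have h2 : mellin (fun t => Real.log t • fG t) (1 - s) = (2:ℂ) ^ (1 - s) / (s - 1) := by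
    have : (fun t => Real.log t • fG t) = (Ioi (2:ℝ)).indicator (fun _ => (1:ℂ)) := by
      ext t
      unfold fG
      by_cases ht : t ∈ Ioi (2:ℝ)
      · have h3 : Real.log t ≠ 0 := (Real.log_pos (by rw [mem_Ioi] at ht; linarith)).ne'
        simp only [ht, indicator_of_mem]
        rw [Complex.real_smul, ← Complex.ofReal_mul, mul_one_div_cancel h3]
        simp
      · simp [ht]
    rw [this, aux_mellin_ind]
    have h4 := integral_Ioi_cpow_of_lt (a := 1 - s - 1) (by simp; linarith) (c := 2) (by norm_num)
    simp only [mul_one]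
    rw [h4]
    have : s - 1 ≠ 0 := fun h => by
      have := congrArg re h; simp at this; linarith
    rw [show 1 - s - 1 + 1 = -(s - 1) by ring]
    push_cast
    rw [show -(s-1) = 1 - s by ring]
    rw [show 1 - s = -(s - 1) by ring]
    field_simp
  rw [h2] at h1
  have h3 : HasDerivAt (fun s : ℂ => 1 - s) (-1) s := (hasDerivAt_id s).const_sub 1
  have := HasDerivAt.comp s h1 h3
  rw [mul_neg_one] at this
  exact this

lemma fL_eq {s : ℂ} (hs : 1 < s.re) : s * mellin fL (-s) = fH s := by
  unfold fH
  have c1 := aux_conv_ind _ _ (fL_conv hs)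
  have c2 := aux_conv_ind _ _ (fG_conv hs)
  have key := integral_Ioi_mul_deriv_eq_deriv_mul (a := (2:ℝ)) (a' := (0:ℂ)) (b' := 0)
    (u := fun t => (auxL t : ℂ)) (u' := fun t => ((1 / Real.log t : ℝ) : ℂ))
    (v := fun t : ℝ => -((t:ℂ) ^ (-s))) (v' := fun t : ℝ => s * (t:ℂ) ^ (-s - 1))
    (by
      intro x hx
      have := (auxL_deriv x).ofReal_comp
      rw [max_eq_left (le_of_lt hx)] at this
      exact this)
    (by
      intro x hx
      have hx0 : x ≠ 0 := by rw [mem_Ioi] at hx; linarith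
      have hs0 : s ≠ 0 := fun h => by rw [h] at hs; simp at hs; linarith
      have := (hasDerivAt_ofReal_cpow_const (x := x) hx0 (r := -s) (neg_ne_zero.2 hs0)).neg
      rw [neg_mul, neg_neg] at this
      exact this)
    (by
      have c3 : IntegrableOn (fun t : ℝ => s * ((t:ℂ) ^ (-s - 1) * (li t : ℂ))) (Ioi 2) :=
        c1.const_mul s
      refine c3.congr_fun (fun t ht => ?_) measurableSet_Ioi
      simp only [Pi.mul_apply, aux_li_eq t (le_of_lt ht)]
      ring)
    (by
      refine c2.neg.congr_fun (fun t ht => ?_) measurableSet_Ioi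
      simp only [Pi.mul_apply, Pi.neg_apply, show 1 - s - 1 = -s by ring]
      ring)
    (by
      have : ContinuousAt (fun t : ℝ => (auxL t : ℂ) * -((t:ℂ) ^ (-s))) 2 := by
        refine ContinuousAt.mul ?_ ?_
        · exact (Complex.continuous_ofReal.comp auxL_cont).continuousAt
        · exact (continuousAt_ofReal_cpow_const 2 (-s) (Or.inr (by norm_num))).neg
      have h2 := this.tendsto.mono_left (nhdsWithin_le_nhds (s := Ioi 2))
      simpa [auxL, Pi.mul_def] using h2)
    (by
      rw [tendsto_zero_iff_norm_tendsto_zero]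
      have h1 : Tendsto (fun t : ℝ => 1 / Real.log 2 * t ^ (-(s.re - 1))) atTop (𝓝 0) := by
        simpa using (tendsto_rpow_neg_atTop (by linarith : 0 < s.re - 1)).const_mul (1 / Real.log 2)
      refine squeeze_zero' (Eventually.of_forall fun _ => norm_nonneg _) ?_ h1
      filter_upwards [eventually_ge_atTop 2] with t ht
      have ht0 : 0 < t := by linarith
      rw [Pi.mul_apply, norm_mul, norm_neg, Complex.norm_cpow_eq_rpow_re_of_pos ht0,
        Complex.norm_real, Real.norm_eq_abs]
      calc |auxL t| * t ^ (-s).re ≤ (1 / Real.log 2 * t) * t ^ (-s).re := by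
            gcongr; exact auxL_bound t ht
        _ = _ := by
          rw [mul_assoc, show -(s.re - 1) = 1 + (-s).re by simp; ring, Real.rpow_add ht0,
            Real.rpow_one])
  have e1 : mellin fL (-s) = ∫ t in Ioi (2:ℝ), (t:ℂ) ^ (-s - 1) * (auxL t : ℂ) := by
    unfold fL
    rw [aux_mellin_ind]
    exact setIntegral_congr_fun measurableSet_Ioi
      (fun t ht => by simp only [aux_li_eq t (le_of_lt ht)])
  have e2 : mellin fG (1 - s) = ∫ t in Ioi (2:ℝ), (t:ℂ) ^ (-s) * ((1 / Real.log t : ℝ) : ℂ) := by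
    unfold fG
    rw [aux_mellin_ind, show 1 - s - 1 = -s by ring]
  rw [e1, e2, ← integral_const_mul]
  calc _ = ∫ t in Ioi (2:ℝ), (auxL t : ℂ) * (s * (t:ℂ) ^ (-s - 1)) := by
        congr 1; ext t; ring
    _ = _ := key
    _ = _ := by
      rw [sub_zero, zero_sub, ← integral_neg]
      congr 1; ext t; ring

lemma aux_primeSum {s : ℂ} (hs : 1 < s.re) :
    ∑' p : Nat.Primes, ((p : ℕ) : ℂ) ^ (-s) = s * mellin fP (-s) := by
  have hcount : ∀ n : ℕ, ∑ k ∈ Finset.Icc 1 n, (if k.Prime then (1:ℝ) else 0) = primePi n := by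
    intro n
    rw [← Finset.sum_filter]
    unfold primePi
    simp only [Finset.sum_const, nsmul_eq_mul, mul_one, Nat.floor_natCast]
    congr 2
    ext p
    simp only [Finset.mem_filter, Finset.mem_Icc, Finset.mem_range]
    constructor
    · rintro ⟨h, hp⟩; exact ⟨by omega, hp⟩
    · rintro ⟨h, hp⟩; exact ⟨⟨hp.one_lt.le, by omega⟩, hp⟩
  have key := LSeries_eq_mul_integral_of_nonneg (fun n : ℕ => if n.Prime then (1:ℝ) else 0)
    (r := 1) zero_le_one hs (by
      refine IsBigO.of_bound 1 (Eventually.of_forall fun n => ?_)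
      rw [hcount, Real.norm_eq_abs, Real.rpow_one, one_mul, Real.norm_natCast]
      exact aux_pi_bound n (by positivity)) (by intro n; positivity)
  have e1 : ∑' p : Nat.Primes, ((p : ℕ) : ℂ) ^ (-s) =
      LSeries (fun n : ℕ => (((if n.Prime then (1:ℝ) else 0 : ℝ)) : ℂ)) s := by
    rw [Nat.Primes.tsum_eq_tsum_ite (f := fun n : ℕ => (n : ℂ) ^ (-s))]
    unfold LSeries
    congr 1
    ext n
    rw [LSeries.term_def]
    by_cases hp : n.Prime
    · simp [hp, hp.ne_zero, cpow_neg]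
    · simp [hp]
  rw [e1, key]
  congr 1
  have e2 : mellin fP (-s) = ∫ t in Ioi (1:ℝ), (fP t) * (t:ℂ) ^ (-(s+1)) := by
    unfold fP
    rw [aux_mellin_ind]
    have : (fun t : ℝ => (Ioi (2:ℝ)).indicator (fun t => (primePi t : ℂ)) t * (t:ℂ) ^ (-(s+1)))
      = (Ioi (2:ℝ)).indicator (fun t : ℝ => (t:ℂ) ^ (-s - 1) * (primePi t : ℂ)) := by
      ext t
      by_cases ht : t ∈ Ioi (2:ℝ)
      · simp only [ht, indicator_of_mem]
        rw [show -(s+1) = -s - 1 by ring, mul_comm]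
      · simp [ht]
    rw [this, setIntegral_indicator measurableSet_Ioi]
    congr 2
    ext t
    simp only [mem_inter_iff, mem_Ioi]
    exact ⟨fun h => ⟨by linarith, h⟩, fun h => h.2⟩
  rw [e2]
  have hne : ∀ᵐ t : ℝ ∂volume.restrict (Ioi (1:ℝ)), t ≠ 2 := by
    refine ae_restrict_of_ae ?_
    simp [ae_iff, measure_singleton]
  refine integral_congr_ae ?_
  filter_upwards [hne, ae_restrict_mem measurableSet_Ioi] with t ht ht1
  congr 1
  have h3 : ∑ k ∈ Finset.Icc 1 ⌊t⌋₊, (((if k.Prime then (1:ℝ) else 0 : ℝ)) : ℂ) = (primePi t : ℂ) := by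
    rw [← Complex.ofReal_sum, hcount]
    unfold primePi
    simp
  rw [h3]
  unfold fP
  by_cases h4 : t ∈ Ioi (2:ℝ)
  · simp [h4]
  · rw [indicator_of_notMem h4]
    have h5 : t < 2 := lt_of_le_of_ne (not_lt.1 h4) ht
    rw [mem_Ioi] at ht1
    have h6 : ⌊t⌋₊ = 1 := by
      rw [Nat.floor_eq_iff (by linarith)]; norm_num; exact ⟨ht1.le, by linarith⟩
    unfold primePi
    rw [h6]
    norm_num
    decide

noncomputable def fQ (s : ℂ) : ℂ :=
  ∑' p : Nat.Primes, (-Complex.log (1 - ((p : ℕ) : ℂ) ^ (-s)) - ((p : ℕ) : ℂ) ^ (-s))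

lemma aux_norm_lt (p : Nat.Primes) {s : ℂ} {σ : ℝ} (hσ : σ ≤ s.re) :
    ‖((p : ℕ) : ℂ) ^ (-s)‖ ≤ ((p : ℕ) : ℝ) ^ (-σ) := by
  rw [Complex.norm_natCast_cpow_of_pos p.2.pos, neg_re]
  exact Real.rpow_le_rpow_of_exponent_le (by exact_mod_cast p.2.one_lt.le) (by linarith)

lemma aux_norm_lt' (p : Nat.Primes) {σ : ℝ} (hσ : 0 < σ) :
    ((p : ℕ) : ℝ) ^ (-σ) ≤ 2 ^ (-σ) :=
  Real.rpow_le_rpow_of_nonpos (by norm_num) (by exact_mod_cast p.2.two_le) (by linarith)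

lemma aux_term_bound (p : Nat.Primes) {s : ℂ} {σ : ℝ} (h0 : 0 < σ) (hσ : σ ≤ s.re) :
    ‖-Complex.log (1 - ((p : ℕ) : ℂ) ^ (-s)) - ((p : ℕ) : ℂ) ^ (-s)‖ ≤
      ((p : ℕ) : ℝ) ^ (-2 * σ) * ((1 - 2 ^ (-σ))⁻¹ / 2) := by
  have h1 := aux_norm_lt p hσ
  have h2 := aux_norm_lt' p h0
  have h3 : (2:ℝ) ^ (-σ) < 1 := Real.rpow_lt_one_of_one_lt_of_neg (by norm_num) (by linarith)
  set z := ((p : ℕ) : ℂ) ^ (-s)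
  have h4 := Complex.norm_log_one_add_sub_self_le (z := -z) (by rw [norm_neg]; linarith)
  rw [norm_neg] at h4
  have h5 : ‖-Complex.log (1 - z) - z‖ = ‖Complex.log (1 + -z) - -z‖ := by
    rw [← norm_neg]; congr 1; rw [← sub_eq_add_neg]; ring
  rw [h5]
  refine h4.trans ?_
  have h6 : ((p : ℕ) : ℝ) ^ (-2 * σ) = (((p : ℕ) : ℝ) ^ (-σ)) ^ 2 := by
    rw [← Real.rpow_natCast, ← Real.rpow_mul (by positivity)]; congr 1; push_cast; ring
  rw [h6, mul_div_assoc]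
  have : 0 < 1 - (2:ℝ) ^ (-σ) := by linarith
  have h7 : 1 - (2:ℝ) ^ (-σ) ≤ 1 - ‖z‖ := by linarith
  have h8 : (1 - ‖z‖)⁻¹ ≤ (1 - (2:ℝ) ^ (-σ))⁻¹ := inv_anti₀ this h7
  have h9 : 0 ≤ (1 - ‖z‖)⁻¹ := inv_nonneg.2 (by linarith)
  gcongr

lemma fQ_diff {s : ℂ} (hs : 1/2 < s.re) : DifferentiableAt ℂ fQ s := by
  set σ := (1/2 + s.re)/2 with hσ
  have hσ1 : 1/2 < σ := by linarith
  have hσ2 : σ < s.re := by linarith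
  have hU : IsOpen {w : ℂ | σ < w.re} := isOpen_lt continuous_const Complex.continuous_re
  have := differentiableOn_tsum_of_summable_norm (U := {w : ℂ | σ < w.re})
    (F := fun (p : Nat.Primes) (s : ℂ) =>
      (-Complex.log (1 - ((p : ℕ) : ℂ) ^ (-s)) - ((p : ℕ) : ℂ) ^ (-s)))
    (u := fun p : Nat.Primes => ((p : ℕ) : ℝ) ^ (-2 * σ) * ((1 - 2 ^ (-σ))⁻¹ / 2))
    ((Nat.Primes.summable_rpow.2 (by linarith)).mul_right _)
    (by
      intro p w hw
      have hp : ((p : ℕ) : ℂ) ≠ 0 := by exact_mod_cast p.2.ne_zero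
      have d : DifferentiableAt ℂ (fun s : ℂ => ((p : ℕ) : ℂ) ^ (-s)) w :=
        DifferentiableAt.const_cpow (by fun_prop) (Or.inl hp)
      refine DifferentiableAt.differentiableWithinAt ?_
      refine DifferentiableAt.sub (DifferentiableAt.neg (DifferentiableAt.clog (by fun_prop) ?_)) d
      have h1 := aux_norm_lt p (le_of_lt hw)
      have h2 := aux_norm_lt' p (by linarith : 0 < σ)
      have h3 : (2:ℝ) ^ (-σ) < 1 := Real.rpow_lt_one_of_one_lt_of_neg (by norm_num) (by linarith)
      rw [sub_eq_add_neg]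
      exact mem_slitPlane_of_norm_lt_one (by rw [norm_neg]; linarith)) hU
    (fun p w hw => aux_term_bound p (by linarith) (le_of_lt hw))
  exact this.differentiableAt (hU.mem_nhds hσ2)

lemma aux_zeta_eq {s : ℂ} (hs : 1 < s.re) :
    riemannZeta s = exp (fQ s + s * mellin fE (-s)) * exp (fH s) := by
  have e : s * mellin fE (-s) + fH s = ∑' p : Nat.Primes, ((p : ℕ) : ℂ) ^ (-s) := by
    rw [aux_primeSum hs, fE_eq hs, ← fL_eq hs]; ring
  rw [← Complex.exp_add, add_assoc, e, ← riemannZeta_eulerProduct_exp_log hs]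
  congr 1
  unfold fQ
  have s1 : Summable (fun p : Nat.Primes => ((p : ℕ) : ℂ) ^ (-s)) :=
    Summable.of_norm_bounded (Nat.Primes.summable_rpow.2 (by linarith : -s.re < -1))
      (fun p => aux_norm_lt p le_rfl)
  have s2 : Summable (fun p : Nat.Primes =>
      (-Complex.log (1 - ((p : ℕ) : ℂ) ^ (-s)) - ((p : ℕ) : ℂ) ^ (-s))) :=
    Summable.of_norm_bounded
      ((Nat.Primes.summable_rpow.2 (by linarith : -2 * s.re < -1)).mul_right _)
      (fun p => aux_term_bound p (by linarith) le_rfl)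
  rw [← s2.tsum_add s1]
  congr 1
  ext p
  ring

lemma aux_nonzero {C : ℝ} (hC : 0 < C) (h : ∀ x : ℝ, 2 ≤ x →
      |primePi x - li x| ≤ C * Real.sqrt x * Real.log x) {ρ : ℂ} (hρ : 1/2 < ρ.re)
      (hρ1 : ρ ≠ 1) : riemannZeta ρ ≠ 0 := by
  -- a disc inside the half plane containing `ρ` and `2`
  obtain ⟨R, hR, hR2, hRρ⟩ : ∃ R : ℝ, 2 < R ∧ (2:ℂ) ∈ Metric.ball (R:ℂ) (R - 1/2) ∧
      ρ ∈ Metric.ball (R:ℂ) (R - 1/2) := by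
    set d := ρ.re - 1/2 with hd
    have hd0 : 0 < d := by linarith
    refine ⟨3 + (d^2 + ρ.im^2)/d, by linarith [show 0 ≤ (d^2 + ρ.im^2)/d by positivity], ?_, ?_⟩
    all_goals
      set R := 3 + (d^2 + ρ.im^2)/d with hR
      have h3 : 3 ≤ R := by linarith [show 0 ≤ (d^2 + ρ.im^2)/d by positivity]
    · rw [Metric.mem_ball, Complex.dist_eq, show (2:ℂ) - (R:ℂ) = ((2 - R : ℝ) : ℂ) by push_cast; rfl,
        Complex.norm_real, Real.norm_eq_abs, abs_of_neg (by linarith)]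
      linarith
    · rw [Metric.mem_ball, Complex.dist_eq]
      have h4 : R * d = 3 * d + (d^2 + ρ.im^2) := by rw [hR]; field_simp
      refine lt_of_pow_lt_pow_left₀ 2 (by linarith) ?_
      rw [Complex.sq_norm, Complex.normSq_apply]
      simp only [sub_re, ofReal_re, sub_im, ofReal_im, sub_zero]
      have h5 : ρ.re = d + 1/2 := by linarith
      rw [h5]
      nlinarith
  set D := Metric.ball (R:ℂ) (R - 1/2) with hD
  have hDo : IsOpen D := Metric.isOpen_ball
  have hDre : ∀ s ∈ D, 1/2 < s.re := by
    intro s hs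
    rw [hD, Metric.mem_ball, Complex.dist_eq] at hs
    have := (Complex.abs_re_le_norm (s - R)).trans_lt hs
    rw [abs_lt] at this
    simp at this
    linarith [this.1]
  -- primitive
  obtain ⟨K, hK⟩ : ∃ K : ℂ → ℂ, ∀ z ∈ D,
      HasDerivAt K (dslope (fun s : ℂ => -(2:ℂ) ^ (1 - s)) 1 z) z := by
    have d1 : DifferentiableOn ℂ (fun s : ℂ => -(2:ℂ) ^ (1 - s)) univ := fun w _ =>
      (DifferentiableAt.neg (DifferentiableAt.const_cpow (by fun_prop)
        (Or.inl (by norm_num)))).differentiableWithinAt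
    have d2 := (Complex.differentiableOn_dslope (c := (1:ℂ)) univ_mem).2 d1
    exact (d2.mono (subset_univ D)).isExactOn_ball
  -- the set D ∩ {Re > 1}
  set V := D ∩ {s : ℂ | 1 < s.re} with hV
  have hVo : IsOpen V := hDo.inter (isOpen_lt continuous_const Complex.continuous_re)
  have hVc : Convex ℝ V := (convex_ball _ _).inter (convex_halfSpace_re_gt 1)
  have h2V : (2:ℂ) ∈ V := ⟨hR2, by simp⟩
  set g : ℂ → ℂ := fun s => (s - 1) * exp (fH s - K s) with hg
  have hgd : ∀ s ∈ V, HasDerivAt g 0 s := by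
    intro s hs
    have hs1 : s - 1 ≠ 0 := fun h => by
      have h1 : 1 < s.re := hs.2
      have := congrArg re h; simp at this; linarith
    have d1 := ((hasDerivAt_id s).sub_const 1).mul ((fH_deriv hs.2).sub (hK s hs.1)).cexp
    refine d1.congr_deriv ?_
    rw [dslope_of_ne _ (sub_ne_zero.1 hs1), slope_def_field]
    simp
    field_simp
    ring
  have hgc : ∀ s ∈ V, g s = g 2 := by
    intro s hs
    exact hVc.is_const_of_fderivWithin_eq_zero (𝕜 := ℂ)
      (fun w hw => (hgd w hw).differentiableAt.differentiableWithinAt)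
      (fun w hw => by
        rw [fderivWithin_of_isOpen hVo hw]
        ext
        simp [(hgd w hw).deriv]) hs h2V
  have hc : g 2 ≠ 0 := by
    simp only [hg]
    exact mul_ne_zero (by norm_num) (Complex.exp_ne_zero _)
  -- the two analytic functions
  have hKd : DifferentiableOn ℂ K D := fun z hz => (hK z hz).differentiableAt.differentiableWithinAt
  have hA : DifferentiableOn ℂ (fun s => g 2 * exp (fQ s + s * mellin fE (-s) + K s)) D := by
    intro s hs
    have q := (fQ_diff (hDre s hs)).differentiableWithinAt (s := D)
    have m := (fE_diff hC h (hDre s hs)).differentiableWithinAt (s := D)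
    have k := hKd s hs
    exact (((q.add (differentiableWithinAt_id.mul m)).add k).cexp).const_mul _
  have hE : EqOn (fun s => (s - 1) * riemannZeta s)
      (fun s => g 2 * exp (fQ s + s * mellin fE (-s) + K s)) V := by
    intro s hs
    simp only
    rw [← hgc s hs, aux_zeta_eq hs.2]
    simp only [hg]
    rw [mul_assoc, ← Complex.exp_add, ← Complex.exp_add]
    congr 2
    ring
  have hz0 : ∀ s : ℂ, s ≠ 1 → (s - 1) * riemannZeta s = 1 + (s - 1) * riemannZeta₀ s := by
    intro s hs
    have : s - 1 ≠ 0 := sub_ne_zero.2 hs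
    rw [show riemannZeta s = (s - 1)⁻¹ + riemannZeta₀ s by simp [riemannZeta₀, hs]]
    field_simp
  have hZ : DifferentiableOn ℂ (fun s => 1 + (s - 1) * riemannZeta₀ s) D := by
    have := differentiable_riemannZeta₀
    intro s hs
    exact DifferentiableAt.differentiableWithinAt (by fun_prop)
  have hfin := (hZ.analyticOnNhd hDo).eqOn_of_preconnected_of_eventuallyEq (hA.analyticOnNhd hDo)
    (convex_ball _ _).isPreconnected hR2 (by
      filter_upwards [hVo.mem_nhds h2V] with s hs
      have hs1 : s ≠ 1 := fun h => by
        have h1 : 1 < s.re := hs.2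
        rw [h] at h1; simp at h1
      rw [← hz0 s hs1]
      exact hE hs) hRρ
  intro h0
  have h1 := hz0 ρ hρ1
  rw [h0, mul_zero] at h1
  simp only [← h1] at hfin
  exact mul_ne_zero hc (Complex.exp_ne_zero _) hfin.symm

end AuxSec

/-- If there is a constant `C > 0` with `|π(x) - li(x)| ≤ C √x log x` for all
`x ≥ 2`, then the Riemann Hypothesis holds: every zero of `ζ` with real part
strictly between `0` and `1` has real part `1/2`. -/
theorem primePi_error_bound_implies_rh
    (h : ∃ C : ℝ, 0 < C ∧ ∀ x : ℝ, 2 ≤ x →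
      |primePi x - li x| ≤ C * Real.sqrt x * Real.log x) :
    ∀ s : ℂ, riemannZeta s = 0 → 0 < s.re → s.re < 1 → s.re = 1 / 2 := by
  obtain ⟨C, hC, h⟩ := h
  intro s hs h0 h1
  have hne1 : s ≠ 1 := fun h => by rw [h] at h1; simp at h1
  rcases lt_trichotomy s.re (1/2) with hlt | heq | hgt
  · exfalso
    have hz : riemannZeta (1 - s) = 0 := by
      rw [riemannZeta_one_sub (fun n hn => ?_) hne1, hs, mul_zero]
      rw [hn] at h0
      simp at h0
      have : (0:ℝ) ≤ n := by positivity
      linarith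
    refine aux_nonzero hC h (ρ := 1 - s) (by simp; linarith) (fun hh => ?_) hz
    have : s = 0 := by linear_combination -hh
    rw [this] at h0
    simp at h0
  · exact heq
  · exact absurd hs (aux_nonzero hC h hgt hne1)
end
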